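/- arXiv:1402.4790 — 2 statements merged into one kernel-verified Lean document; each statement's English description precedes it below -/
import Mathlib

section
/- Let D be a division ring, m, n, p, q be positive integers with m ≥ 2 and n ≥ 2, and φ : M_{m×n}(D) → M_{p×q}(D) be an adjacency preserver that maps 0 to 0 and is not degenerate with respect to 0. Then there exist invertible matrices P ∈ GL_m(D) and Q ∈ GL_n(D) such that the map A ∈ M_2(D) ↦ φ(P [[A, 0],[0, 0]] Q) (with [[A,0],[0,0]] ∈ M_{m×n}(D)) is not degenerate with respect to 0 and maps at least one rank 2 matrix to a rank 2 matrix. -/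
open Matrix

variable {D : Type*} [DivisionRing D]

/-- The rank of a matrix over a division ring: the dimension of its row space,
i.e. of the left `D`-subspace of `D^n` spanned by the rows. -/
noncomputable def rowRank {m n : ℕ} (A : Matrix (Fin m) (Fin n) D) : ℕ :=
  Module.finrank D (Submodule.span D (Set.range fun i => A i))

/-- Two matrices are adjacent if their difference has rank one. -/
def Adjacent {m n : ℕ} (A B : Matrix (Fin m) (Fin n) D) : Prop :=
  rowRank (A - B) = 1

/-- `R(x)`: the set of matrices of the form `ᵗu x` for a fixed row vector `x`. -/
def Rvec {m n : ℕ} (x : Fin n → D) : Set (Matrix (Fin m) (Fin n) D) :=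
  { M | ∃ u : Fin m → D, ∀ i j, M i j = u i * x j }

/-- `L(ᵗy)`: the set of matrices of the form `ᵗy v` for a fixed column vector `ᵗy`. -/
def Lvec {m n : ℕ} (y : Fin m → D) : Set (Matrix (Fin m) (Fin n) D) :=
  { M | ∃ v : Fin n → D, ∀ i j, M i j = y i * v j }

/-- `R_d`: the matrices whose row space is contained in `d`. -/
def Rsub {m n : ℕ} (d : Submodule D (Fin n → D)) : Set (Matrix (Fin m) (Fin n) D) :=
  { M | ∀ i, M i ∈ d }

/-- `L_e`: the matrices whose column space (a right subspace, i.e. a `Dᵐᵒᵖ`-submodule)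
is contained in `e`. -/
def Lsub {m n : ℕ} (e : Submodule Dᵐᵒᵖ (Fin m → D)) : Set (Matrix (Fin m) (Fin n) D) :=
  { M | ∀ j, (fun i => M i j) ∈ e }

/-- The orthogonal set of a set `e` of column vectors. -/
def perpSet {m : ℕ} (e : Set (Fin m → D)) : Set (Fin m → D) :=
  { u | ∀ v ∈ e, ∑ i, u i * v i = 0 }

/-- The `p × q` matrix with upper-left block `B` and zeros elsewhere. -/
def pad {m n : ℕ} (p q : ℕ) (B : Matrix (Fin m) (Fin n) D) :
    Matrix (Fin p) (Fin q) D :=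
  Matrix.of fun i j =>
    if hi : (i : ℕ) < m then if hj : (j : ℕ) < n then B ⟨i, hi⟩ ⟨j, hj⟩ else 0 else 0

/-- `φ` is degenerate with respect to `A`. -/
def DegenerateAt {m n p q : ℕ} (φ : Matrix (Fin m) (Fin n) D → Matrix (Fin p) (Fin q) D)
    (A : Matrix (Fin m) (Fin n) D) : Prop :=
  ∃ x : Fin p → D, x ≠ 0 ∧ ∃ y : Fin q → D, y ≠ 0 ∧
    ∀ M : Matrix (Fin m) (Fin n) D, rowRank M ≤ 1 →
      φ (A + M) - φ A ∈ Rvec y ∪ Lvec x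

/-- `φ` is degenerate: degenerate with respect to every matrix. -/
def Degenerate {m n p q : ℕ} (φ : Matrix (Fin m) (Fin n) D → Matrix (Fin p) (Fin q) D) :
    Prop :=
  ∀ A, DegenerateAt φ A

/-- A map (sending `0` to `0`) is degenerate with respect to `0` iff it maps every matrix of
rank at most one into `R(y) ∪ L(ᵗx)` for some nonzero `y`, `x`. -/
def DegZero {m n p q : ℕ} (φ : Matrix (Fin m) (Fin n) D → Matrix (Fin p) (Fin q) D) :
    Prop :=
  ∃ x : Fin p → D, x ≠ 0 ∧ ∃ y : Fin q → D, y ≠ 0 ∧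
    ∀ M : Matrix (Fin m) (Fin n) D, rowRank M ≤ 1 → φ M ∈ Rvec y ∪ Lvec x

/-- A standard adjacency preserver. -/
def Standard {m n p q : ℕ} (φ : Matrix (Fin m) (Fin n) D → Matrix (Fin p) (Fin q) D) :
    Prop :=
  (m ≤ p ∧ n ≤ q ∧ ∃ τ : D ≃+* D, ∃ T : Matrix (Fin p) (Fin p) D,
    ∃ S : Matrix (Fin q) (Fin q) D, ∃ R : Matrix (Fin p) (Fin q) D,
    IsUnit T ∧ IsUnit S ∧ ∀ A, φ A = T * pad p q (A.map τ) * S + R) ∨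
  (n ≤ p ∧ m ≤ q ∧ ∃ σ : D → D, Function.Bijective σ ∧ σ 1 = 1 ∧
    (∀ a b, σ (a + b) = σ a + σ b) ∧ (∀ a b, σ (a * b) = σ b * σ a) ∧
    ∃ T : Matrix (Fin p) (Fin p) D, ∃ S : Matrix (Fin q) (Fin q) D,
    ∃ R : Matrix (Fin p) (Fin q) D, IsUnit T ∧ IsUnit S ∧
    ∀ A, φ A = T * pad p q (A.map σ).transpose * S + R)

/-- A division ring is EAS if every (unital) ring endomorphism of it is surjective. -/
def EAS (D : Type*) [DivisionRing D] : Prop :=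
  ∀ f : D →+* D, Function.Surjective f

/-- A set of matrices is adjacent if any two distinct members are adjacent. -/
def IsAdjacentSet {m n : ℕ} (S : Set (Matrix (Fin m) (Fin n) D)) : Prop :=
  ∀ A ∈ S, ∀ B ∈ S, A ≠ B → Adjacent A B

/-- A matrix of the form `ᵗa z`, i.e. a matrix of rank at most one. -/
def IsDyad {m n : ℕ} (M : Matrix (Fin m) (Fin n) D) : Prop :=
  ∃ (a : Fin m → D) (z : Fin n → D), M = vecMulVec a z

section RowRank

variable {m n : ℕ}

theorem isDyad_vecMulVec (a : Fin m → D) (z : Fin n → D) : IsDyad (vecMulVec a z) :=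
  ⟨a, z, rfl⟩

theorem rowRank_le_one_iff {M : Matrix (Fin m) (Fin n) D} : rowRank M ≤ 1 ↔ IsDyad M := by
  unfold rowRank
  constructor
  · intro h
    obtain ⟨v, hv⟩ := finrank_le_one_iff.1 h
    choose c hc using fun i => hv ⟨M i, Submodule.subset_span ⟨i, rfl⟩⟩
    refine ⟨c, v, ?_⟩
    ext i j
    have := congrFun (congrArg Subtype.val (hc i)) j
    simpa [vecMulVec_apply] using this.symm
  · rintro ⟨a, z, rfl⟩
    have hle : Submodule.span D (Set.range fun i => (vecMulVec a z) i) ≤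
        Submodule.span D {z} := by
      rw [Submodule.span_le]
      rintro _ ⟨i, rfl⟩
      exact Submodule.mem_span_singleton.2 ⟨a i, by ext; simp [vecMulVec_apply]⟩
    refine (Submodule.finrank_mono hle).trans ?_
    simpa using finrank_span_le_card (R := D) ({z} : Set (Fin n → D))

theorem rowRank_eq_zero_iff {M : Matrix (Fin m) (Fin n) D} : rowRank M = 0 ↔ M = 0 := by
  unfold rowRank
  rw [Submodule.finrank_eq_zero, Submodule.span_eq_bot]
  constructor
  · intro h
    ext i j
    exact congrFun (h _ ⟨i, rfl⟩) j
  · rintro rfl _ ⟨i, rfl⟩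
    rfl

theorem adjacent_iff {A B : Matrix (Fin m) (Fin n) D} :
    Adjacent A B ↔ A ≠ B ∧ IsDyad (A - B) := by
  unfold Adjacent
  rw [← rowRank_le_one_iff, ← sub_ne_zero, Ne, ← rowRank_eq_zero_iff]
  omega

theorem rowRank_add_le_two {M N : Matrix (Fin m) (Fin n) D} (hM : IsDyad M) (hN : IsDyad N) :
    rowRank (M + N) ≤ 2 := by
  classical
  obtain ⟨a, z, rfl⟩ := hM
  obtain ⟨b, w, rfl⟩ := hN
  have hle : Submodule.span D (Set.range fun i => (vecMulVec a z + vecMulVec b w) i) ≤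
      Submodule.span D (({z, w} : Finset (Fin n → D)) : Set (Fin n → D)) := by
    rw [Submodule.span_le]
    rintro _ ⟨i, rfl⟩
    rw [Finset.coe_pair]
    exact Submodule.mem_span_pair.2 ⟨a i, b i, by ext; simp [vecMulVec_apply]⟩
  exact ((Submodule.finrank_mono hle).trans (finrank_span_finset_le_card _)).trans
    Finset.card_le_two

end RowRank

section Dyads

variable {m n : ℕ}

theorem vecMulVec_ne_zero' {a : Fin m → D} {z : Fin n → D} (ha : a ≠ 0) (hz : z ≠ 0) :
    vecMulVec a z ≠ 0 := by
  obtain ⟨i, hi⟩ := Function.ne_iff.1 ha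
  obtain ⟨j, hj⟩ := Function.ne_iff.1 hz
  intro h
  exact mul_ne_zero hi hj (congrFun (congrFun h i) j)

theorem vecMulVec_mem_Rvec (a : Fin m → D) (z : Fin n → D) : vecMulVec a z ∈ Rvec z :=
  ⟨a, fun _ _ => rfl⟩

theorem zero_mem_Rvec (z : Fin n → D) : (0 : Matrix (Fin m) (Fin n) D) ∈ Rvec z :=
  ⟨0, fun _ _ => (zero_mul _).symm⟩

theorem zero_mem_Lvec (a : Fin m → D) : (0 : Matrix (Fin m) (Fin n) D) ∈ Lvec a :=
  ⟨0, fun _ _ => (mul_zero _).symm⟩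

theorem ne_zero_of_mem_Rvec {M : Matrix (Fin m) (Fin n) D} {z : Fin n → D} (hM : M ≠ 0)
    (h : M ∈ Rvec z) : z ≠ 0 := by
  rintro rfl
  obtain ⟨u, hu⟩ := h
  exact hM (by ext i j; simp [hu])

theorem ne_zero_of_mem_Lvec {M : Matrix (Fin m) (Fin n) D} {a : Fin m → D} (hM : M ≠ 0)
    (h : M ∈ Lvec a) : a ≠ 0 := by
  rintro rfl
  obtain ⟨v, hv⟩ := h
  exact hM (by ext i j; simp [hv])

theorem mem_Rvec_iff {M : Matrix (Fin m) (Fin n) D} {z : Fin n → D} :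
    M ∈ Rvec z ↔ ∃ u, M = vecMulVec u z :=
  ⟨fun ⟨u, h⟩ => ⟨u, Matrix.ext h⟩, fun ⟨u, h⟩ => ⟨u, fun i j => by rw [h]; rfl⟩⟩

theorem mem_Lvec_iff {M : Matrix (Fin m) (Fin n) D} {a : Fin m → D} :
    M ∈ Lvec a ↔ ∃ v, M = vecMulVec a v :=
  ⟨fun ⟨u, h⟩ => ⟨u, Matrix.ext h⟩, fun ⟨u, h⟩ => ⟨u, fun i j => by rw [h]; rfl⟩⟩

/-- If a nonzero matrix lies in `R(y)` and in `R(x)`, then `R(x) ⊆ R(y)`. -/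
theorem Rvec_subset_of_mem {m' : ℕ} {M : Matrix (Fin m) (Fin n) D} {x y : Fin n → D}
    (hM : M ≠ 0) (hx : M ∈ Rvec x) (hy : M ∈ Rvec y) :
    (Rvec x : Set (Matrix (Fin m') (Fin n) D)) ⊆ Rvec y := by
  obtain ⟨u, hu⟩ := hx
  obtain ⟨v, hv⟩ := hy
  have : ∃ i, u i ≠ 0 := by
    by_contra! h
    exact hM (by ext i j; simp [hu, h])
  obtain ⟨i, hi⟩ := this
  rintro N ⟨w, hw⟩
  refine ⟨fun k => w k * ((u i)⁻¹ * v i), fun k j => ?_⟩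
  rw [hw, mul_assoc, mul_assoc, ← hv, hu, inv_mul_cancel_left₀ hi]

theorem Lvec_subset_of_mem {n' : ℕ} {M : Matrix (Fin m) (Fin n) D} {a b : Fin m → D}
    (hM : M ≠ 0) (ha : M ∈ Lvec a) (hb : M ∈ Lvec b) :
    (Lvec a : Set (Matrix (Fin m) (Fin n') D)) ⊆ Lvec b := by
  obtain ⟨u, hu⟩ := ha
  obtain ⟨v, hv⟩ := hb
  have : ∃ j, u j ≠ 0 := by
    by_contra! h
    exact hM (by ext i j; simp [hu, h])
  obtain ⟨j, hj⟩ := this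
  rintro N ⟨w, hw⟩
  refine ⟨fun k => (v j * (u j)⁻¹) * w k, fun i k => ?_⟩
  rw [hw, ← mul_assoc, ← mul_assoc, ← hv, hu, mul_inv_cancel_right₀ hj]

/-- A dyad whose difference from `ᵗa z` is a dyad shares its row or its column with it. -/
theorem IsDyad.mem_Rvec_or_mem_Lvec {M : Matrix (Fin m) (Fin n) D} (hM : IsDyad M)
    {a : Fin m → D} {z : Fin n → D} (h0 : vecMulVec a z ≠ 0)
    (h : IsDyad (M - vecMulVec a z)) : M ∈ Rvec z ∨ M ∈ Lvec a := by
  obtain ⟨c, d, rfl⟩ := hM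
  obtain ⟨e, f, h⟩ := h
  have h (i j) : c i * d j - a i * z j = e i * f j := congrFun (congrFun h i) j
  have : ∃ i j, a i * z j ≠ 0 := by
    by_contra! h
    exact h0 (by ext i j; exact h i j)
  obtain ⟨i, j, hij⟩ := this
  have hi : a i ≠ 0 := left_ne_zero_of_mul hij
  have hj : z j ≠ 0 := right_ne_zero_of_mul hij
  have prop {s t : D} (hs : s ≠ 0) (hst : ∀ l, s * d l = t * z l) :
      vecMulVec c d ∈ Rvec z := by
    refine ⟨fun k => c k * (s⁻¹ * t), fun k l => ?_⟩
    rw [vecMulVec_apply, mul_assoc, mul_assoc, ← hst, inv_mul_cancel_left₀ hs]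
  by_cases hei : e i = 0
  · have hrow (l) : c i * d l = a i * z l := by
      have := h i l
      rwa [hei, zero_mul, sub_eq_zero] at this
    refine Or.inl (prop (s := c i) ?_ hrow)
    intro hc
    have := hrow j
    rw [hc, zero_mul] at this
    exact hij this.symm
  · have hrow (k l) : (c k - e k * (e i)⁻¹ * c i) * d l =
        (a k - e k * (e i)⁻¹ * a i) * z l := by
      have h1 : e k * (e i)⁻¹ * (c i * d l - a i * z l) = c k * d l - a k * z l := by
        rw [h, h, mul_assoc, inv_mul_cancel_left₀ hei]
      rw [sub_mul, sub_mul, mul_assoc _ (c i), mul_assoc _ (a i)]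
      rw [mul_sub] at h1
      rw [sub_eq_sub_iff_sub_eq_sub, ← h1]
    by_cases hk : ∃ k, c k - e k * (e i)⁻¹ * c i ≠ 0
    · obtain ⟨k, hk⟩ := hk
      exact Or.inl (prop hk (hrow k))
    · push Not at hk
      refine Or.inr ⟨fun l => (a i)⁻¹ * c i * d l, fun k l => ?_⟩
      have hak : a k = e k * (e i)⁻¹ * a i := by
        have := hrow k j
        rw [hk, zero_mul] at this
        exact sub_eq_zero.1 ((mul_eq_zero.1 this.symm).resolve_right hj)
      rw [vecMulVec_apply, sub_eq_zero.1 (hk k), hak]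
      simp only [mul_assoc, mul_inv_cancel_left₀ hi]

theorem exists_eq_mul_of_mem_Rvec_of_mem_Lvec {M : Matrix (Fin m) (Fin n) D} {a : Fin m → D}
    {z : Fin n → D} (ha : M ∈ Lvec a) (hz : M ∈ Rvec z) (ha0 : a ≠ 0) :
    ∃ c : D, ∀ i j, M i j = a i * c * z j := by
  obtain ⟨v, hv⟩ := ha
  obtain ⟨u, hu⟩ := hz
  obtain ⟨i, hi⟩ := Function.ne_iff.1 ha0
  have hi : a i ≠ 0 := hi
  refine ⟨(a i)⁻¹ * u i, fun k j => ?_⟩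
  rw [mul_assoc, mul_assoc, ← hu, hv, hv, inv_mul_cancel_left₀ hi]

end Dyads

variable {E : Type*} [DivisionRing E]

/-- Adjacency preservers between matrix spaces over possibly different division rings. -/
def PreservesAdjacency {m n p q : ℕ}
    (φ : Matrix (Fin m) (Fin n) D → Matrix (Fin p) (Fin q) E) : Prop :=
  ∀ A B, A ≠ B → IsDyad (A - B) → φ A ≠ φ B ∧ IsDyad (φ A - φ B)

/-- Degeneracy with respect to `0`, for maps between matrix spaces over possibly different
division rings. -/
def DegenerateOnDyads {m n p q : ℕ}
    (φ : Matrix (Fin m) (Fin n) D → Matrix (Fin p) (Fin q) E) : Prop :=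
  ∃ x : Fin p → E, x ≠ 0 ∧ ∃ y : Fin q → E, y ≠ 0 ∧
    ∀ M, IsDyad M → φ M ∈ Rvec y ∪ Lvec x

theorem PreservesAdjacency.ne_zero_and_isDyad {m n p q : ℕ}
    {φ : Matrix (Fin m) (Fin n) D → Matrix (Fin p) (Fin q) E} (hφ : PreservesAdjacency φ)
    (h0 : φ 0 = 0) {M : Matrix (Fin m) (Fin n) D} (hM : M ≠ 0) (hd : IsDyad M) :
    φ M ≠ 0 ∧ IsDyad (φ M) := by
  simpa [h0] using hφ M 0 hM (by simpa using hd)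

section TwoByTwo

variable {p q : ℕ}

theorem single_eq_vecMulVec_left {m n : ℕ} (i : Fin m) (j : Fin n) (c : D) :
    Matrix.single i j c = vecMulVec (Pi.single i c) (Pi.single j 1) := by
  ext k l
  by_cases hk : i = k <;> by_cases hl : j = l <;>
    simp [vecMulVec_apply, hk, hl, eq_comm]

theorem single_eq_vecMulVec_right {m n : ℕ} (i : Fin m) (j : Fin n) (c : D) :
    Matrix.single i j c = vecMulVec (Pi.single i 1) (Pi.single j c) := by
  ext k l
  by_cases hk : i = k <;> by_cases hl : j = l <;>
    simp [vecMulVec_apply, hk, hl, eq_comm]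

theorem not_isDyad_of_col_one {s t : D} (h : s ≠ t) : ¬ IsDyad !![1, s; 1, t] := by
  rintro ⟨a, z, e⟩
  have e00 : 1 = a 0 * z 0 := congrFun (congrFun e 0) 0
  have e01 : s = a 0 * z 1 := congrFun (congrFun e 0) 1
  have e10 : 1 = a 1 * z 0 := congrFun (congrFun e 1) 0
  have e11 : t = a 1 * z 1 := congrFun (congrFun e 1) 1
  have hz : z 0 ≠ 0 := by
    intro hz
    simp [hz] at e00
  have : a 0 = a 1 := mul_right_cancel₀ hz (e00.symm.trans e10)
  exact h (by rw [e01, e11, this])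

theorem not_isDyad_of_zero {s t u : D} (ht : t ≠ 0) (hu : u ≠ 0) :
    ¬ IsDyad !![t, s; 0, u] := by
  rintro ⟨a, z, e⟩
  have e00 : t = a 0 * z 0 := congrFun (congrFun e 0) 0
  have e10 : 0 = a 1 * z 0 := congrFun (congrFun e 1) 0
  have e11 : u = a 1 * z 1 := congrFun (congrFun e 1) 1
  rcases mul_eq_zero.1 e10.symm with h | h
  · exact hu (by simp [e11, h])
  · exact ht (by simp [e00, h])

theorem isDyad_fin_two {M : Matrix (Fin 2) (Fin 2) D} (a₀ a₁ z₀ z₁ : D)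
    (h00 : M 0 0 = a₀ * z₀) (h01 : M 0 1 = a₀ * z₁) (h10 : M 1 0 = a₁ * z₀)
    (h11 : M 1 1 = a₁ * z₁) : IsDyad M := by
  refine ⟨![a₀, a₁], ![z₀, z₁], ?_⟩
  ext i j
  fin_cases i <;> fin_cases j <;> simpa [vecMulVec_apply]

variable {ψ : Matrix (Fin 2) (Fin 2) D → Matrix (Fin p) (Fin q) E}
  {X : Fin 2 → Fin q → E} {a : Fin 2 → Fin p → E}

theorem mem_Rvec_single (hr : ∀ j u, ψ (vecMulVec u (Pi.single j 1)) ∈ Rvec (X j))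
    (i j : Fin 2) (c : D) : ψ (Matrix.single i j c) ∈ Rvec (X j) := by
  rw [single_eq_vecMulVec_left]
  exact hr _ _

theorem mem_Lvec_single (hl : ∀ i v, ψ (vecMulVec (Pi.single i 1) v) ∈ Lvec (a i))
    (i j : Fin 2) (c : D) : ψ (Matrix.single i j c) ∈ Lvec (a i) := by
  rw [single_eq_vecMulVec_right]
  exact hl _ _

theorem single_ne_zero_and_isDyad {i j : Fin 2} {c : D} (hc : c ≠ 0) :
    Matrix.single i j c ≠ 0 ∧ IsDyad (Matrix.single i j c) := by
  refine ⟨fun h => hc ?_, ?_⟩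
  · simpa using congrFun (congrFun h i) j
  · rw [single_eq_vecMulVec_left]
    exact isDyad_vecMulVec _ _

/-- A map sending the rows and the columns of the `2 × 2` matrix units to distinct rows and
columns is not degenerate. -/
theorem not_degenerateOnDyads_of_grid (hψ : PreservesAdjacency ψ) (h0 : ψ 0 = 0)
    (hr : ∀ j u, ψ (vecMulVec u (Pi.single j 1)) ∈ Rvec (X j))
    (hl : ∀ i v, ψ (vecMulVec (Pi.single i 1) v) ∈ Lvec (a i))
    (hR : ∀ M : Matrix (Fin p) (Fin q) E, M ∈ Rvec (X 0) → M ∈ Rvec (X 1) → M = 0)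
    (hL : ∀ M : Matrix (Fin p) (Fin q) E, M ∈ Lvec (a 0) → M ∈ Lvec (a 1) → M = 0) :
    ¬ DegenerateOnDyads ψ := by
  rintro ⟨x, -, y, -, h⟩
  have hne (i j : Fin 2) : ψ (Matrix.single i j 1) ≠ 0 :=
    (hψ.ne_zero_and_isDyad h0 (single_ne_zero_and_isDyad one_ne_zero).1
      (single_ne_zero_and_isDyad one_ne_zero).2).1
  have hmem (i j : Fin 2) := h _ (single_ne_zero_and_isDyad (i := i) (j := j) one_ne_zero).2
  have hrow (i j : Fin 2) (hy : ψ (Matrix.single i j 1) ∈ Rvec y) :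
      Rvec y ⊆ (Rvec (X j) : Set (Matrix (Fin p) (Fin q) E)) :=
    Rvec_subset_of_mem (hne i j) hy (mem_Rvec_single hr i j 1)
  have hcol (i : Fin 2) : ∃ j, ψ (Matrix.single i j 1) ∈ Lvec x := by
    rcases hmem i 0 with h | h
    · rcases hmem i 1 with h' | h'
      · exact absurd (hR _ (hrow i 0 h h) (hrow i 1 h' h)) (hne i 0)
      · exact ⟨1, h'⟩
    · exact ⟨0, h⟩
  obtain ⟨j, hj⟩ := hcol 0
  obtain ⟨k, hk⟩ := hcol 1
  have hsub := Lvec_subset_of_mem (n' := q) (hne 1 k) hk (mem_Lvec_single hl 1 k 1)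
  exact hne 0 j (hL _ (mem_Lvec_single hl 0 j 1) (hsub hj))

/-- Such a map sends some matrix of rank two outside the matrices of rank at most one. -/
theorem exists_not_isDyad_of_grid (hψ : PreservesAdjacency ψ) (h0 : ψ 0 = 0)
    (hDE : (∀ t : D, t = 0 ∨ t = 1) → ∀ t : E, t = 0 ∨ t = 1)
    (hr : ∀ j u, ψ (vecMulVec u (Pi.single j 1)) ∈ Rvec (X j))
    (hl : ∀ i v, ψ (vecMulVec (Pi.single i 1) v) ∈ Lvec (a i))
    (hR : ∀ M : Matrix (Fin p) (Fin q) E, M ∈ Rvec (X 0) → M ∈ Rvec (X 1) → M = 0)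
    (hL : ∀ M : Matrix (Fin p) (Fin q) E, M ∈ Lvec (a 0) → M ∈ Lvec (a 1) → M = 0) :
    ∃ A, ¬ IsDyad A ∧ ¬ IsDyad (ψ A) := by
  by_contra! hcon
  have cross {A : Matrix (Fin 2) (Fin 2) D} (hA : ¬ IsDyad A) (i j : Fin 2) {c : D}
      (hc : c ≠ 0) (h : IsDyad (A - Matrix.single i j c)) :
      ψ A ∈ Rvec (X j) ∨ ψ A ∈ Lvec (a i) := by
    obtain ⟨hs0, hsd⟩ := single_ne_zero_and_isDyad (i := i) (j := j) hc
    have hN := (hψ.ne_zero_and_isDyad h0 hs0 hsd).1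
    have hNl := mem_Lvec_single hl i j c
    have hNr := mem_Rvec_single hr i j c
    have hne : A ≠ Matrix.single i j c := by
      rintro rfl
      exact hA hsd
    have hd := (hψ _ _ hne h).2
    obtain ⟨v, hv⟩ := mem_Lvec_iff.1 hNl
    rw [hv] at hd hN hNr
    exact ((hcon A hA).mem_Rvec_or_mem_Lvec hN hd).imp_left
      fun h' => Rvec_subset_of_mem hN (vecMulVec_mem_Rvec _ _) hNr h'
  by_cases hD : ∃ t : D, t ≠ 0 ∧ t ≠ 1
  · obtain ⟨t, ht0, ht1⟩ := hD
    have vanish {s t : D} (hs : s ≠ 0) (ht : t ≠ 0) (hst : s ≠ t) :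
        ψ !![1, s; 1, t] = 0 := by
      have hA := not_isDyad_of_col_one hst
      have h00 := cross hA 0 0 (c := 1 - s * t⁻¹)
        (by rw [sub_ne_zero]; intro h; apply hst; rw [← mul_one t]
            simpa [ht] using congrArg (· * t) h.symm)
        (isDyad_fin_two (s * t⁻¹) 1 1 t (by simp) (by simp [ht]) (by simp) (by simp))
      have h01 := cross hA 0 1 (c := s - t) (sub_ne_zero.2 hst)
        (isDyad_fin_two 1 1 1 t (by simp) (by simp) (by simp) (by simp))
      have h10 := cross hA 1 0 (c := 1 - t * s⁻¹)
        (by rw [sub_ne_zero]; intro h; apply hst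
            simpa [hs] using congrArg (· * s) h)
        (isDyad_fin_two 1 (t * s⁻¹) 1 s (by simp) (by simp) (by simp) (by simp [hs]))
      have h11 := cross hA 1 1 (c := t - s) (sub_ne_zero.2 hst.symm)
        (isDyad_fin_two 1 1 1 s (by simp) (by simp) (by simp) (by simp))
      have hR' := hR (ψ !![1, s; 1, t])
      have hL' := hL (ψ !![1, s; 1, t])
      tauto
    have hne : t ≠ t * t := fun h => ht1 (mul_left_cancel₀ ht0 (by rw [← h, mul_one]))
    have h1 := vanish one_ne_zero ht0 ht1.symm
    have h2 := vanish ht0 (mul_ne_zero ht0 ht0) hne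
    refine (hψ !![1, 1; 1, t] !![1, t; 1, t * t] ?_ ?_).1 (h1.trans h2.symm)
    · intro h
      exact ht1 (congrFun (congrFun h 0) 1).symm
    · exact isDyad_fin_two 1 t 0 (1 - t) (by simp) (by simp) (by simp) (by simp [mul_sub])
  · have hE := hDE fun t => by
      by_contra! h
      exact hD ⟨t, h⟩
    have unique {i j : Fin 2} {M N : Matrix (Fin p) (Fin q) E} (hM : M ∈ Lvec (a i))
        (hM' : M ∈ Rvec (X j)) (hM0 : M ≠ 0) (hN : N ∈ Lvec (a i)) (hN' : N ∈ Rvec (X j))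
        (hN0 : N ≠ 0) : M = N := by
      have key : ∀ M : Matrix (Fin p) (Fin q) E, M ∈ Lvec (a i) → M ∈ Rvec (X j) → M ≠ 0 →
          M = vecMulVec (a i) (X j) := by
        intro M h1 h2 h3
        obtain ⟨c, hc⟩ :=
          exists_eq_mul_of_mem_Rvec_of_mem_Lvec h1 h2 (ne_zero_of_mem_Lvec h3 h1)
        rcases hE c with rfl | rfl
        · exact absurd (by ext k l; simp [hc]) h3
        · ext k l
          simp [hc, vecMulVec_apply]
      rw [key M hM hM' hM0, key N hN hN' hN0]
    have neg_one : (-1 : D) ≠ 0 := neg_ne_zero.2 one_ne_zero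
    have vanish {A : Matrix (Fin 2) (Fin 2) D} (hA : ¬ IsDyad A) {i j : Fin 2} {c : D}
        (hc : c ≠ 0) (hd : IsDyad (A - Matrix.single i j c))
        (h : ψ A ≠ 0 → ψ A ∈ Rvec (X j) ∧ ψ A ∈ Lvec (a i)) : ψ A = 0 := by
      by_contra hne
      obtain ⟨hs0, hsd⟩ := single_ne_zero_and_isDyad (i := i) (j := j) hc
      refine (hψ A (Matrix.single i j c) ?_ hd).1 ?_
      · rintro rfl
        exact hA hsd
      · exact unique (h hne).2 (h hne).1 hne (mem_Lvec_single hl i j c)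
          (mem_Rvec_single hr i j c) (hψ.ne_zero_and_isDyad h0 hs0 hsd).1
    have hT : ψ !![1, 1; 0, 1] = 0 := by
      have hA : ¬ IsDyad !![(1 : D), 1; 0, 1] := not_isDyad_of_zero one_ne_zero one_ne_zero
      have h00 := cross hA 0 0 (c := 1) one_ne_zero
        (isDyad_fin_two 1 1 0 1 (by simp) (by simp) (by simp) (by simp))
      have h11 := cross hA 1 1 (c := 1) one_ne_zero
        (isDyad_fin_two 1 0 1 1 (by simp) (by simp) (by simp) (by simp))
      have hd := isDyad_fin_two (M := !![(1 : D), 1; 0, 1] - Matrix.single 1 0 (-1)) 1 1 1 1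
        (by simp) (by simp) (by simp) (by simp)
      have h10 := cross hA 1 0 neg_one hd
      have hR' := hR (ψ !![1, 1; 0, 1])
      have hL' := hL (ψ !![1, 1; 0, 1])
      exact vanish hA neg_one hd (by tauto)
    have hS : ψ !![1, 1; 1, 0] = 0 := by
      have hA : ¬ IsDyad !![(1 : D), 1; 1, 0] := not_isDyad_of_col_one one_ne_zero
      have h01 := cross hA 0 1 (c := 1) one_ne_zero
        (isDyad_fin_two 1 1 1 0 (by simp) (by simp) (by simp) (by simp))
      have h10 := cross hA 1 0 (c := 1) one_ne_zero
        (isDyad_fin_two 1 0 1 1 (by simp) (by simp) (by simp) (by simp))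
      have hd := isDyad_fin_two (M := !![(1 : D), 1; 1, 0] - Matrix.single 1 1 (-1)) 1 1 1 1
        (by simp) (by simp) (by simp) (by simp)
      have h11 := cross hA 1 1 neg_one hd
      have hR' := hR (ψ !![1, 1; 1, 0])
      have hL' := hL (ψ !![1, 1; 1, 0])
      exact vanish hA neg_one hd (by tauto)
    refine (hψ !![1, 1; 0, 1] !![1, 1; 1, 0] ?_ ?_).1 (hT.trans hS.symm)
    · intro h
      exact one_ne_zero (congrFun (congrFun h 1) 0).symm
    · exact isDyad_fin_two 0 1 (-1) 1 (by simp) (by simp) (by simp) (by simp)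

end TwoByTwo

section Blocks

open MulOpposite

theorem exists_isUnit_rows {k n : ℕ} (h : k ≤ n) {v : Fin k → Fin n → D}
    (hv : LinearIndependent D v) :
    ∃ Q : Matrix (Fin n) (Fin n) D, IsUnit Q ∧ ∀ i, Q (Fin.castLE h i) = v i := by
  have : Fintype (Module.Basis.sumExtendIndex hv) :=
    have : Finite (Fin k ⊕ Module.Basis.sumExtendIndex hv) :=
      Module.Finite.finite_basis (Module.Basis.sumExtend hv)
    have : Finite (Module.Basis.sumExtendIndex hv) := Finite.sum_right (Fin k)
    Fintype.ofFinite _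
  have hcard : Fintype.card (Module.Basis.sumExtendIndex hv) = n - k := by
    have := Module.finrank_eq_card_basis (Module.Basis.sumExtend hv)
    simp only [Module.finrank_fin_fun, Fintype.card_sum, Fintype.card_fin] at this
    omega
  let e : Fin k ⊕ Module.Basis.sumExtendIndex hv ≃ Fin n :=
    ((Equiv.refl _).sumCongr (Fintype.equivFinOfCardEq hcard)).trans
      (finSumFinEquiv.trans (finCongr (by omega)))
  have he (i : Fin k) : e.symm (Fin.castLE h i) = Sum.inl i := by
    rw [Equiv.symm_apply_eq]
    ext
    simp [e]
  let b := (Module.Basis.sumExtend hv).reindex e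
  refine ⟨Matrix.of fun i => b i, ?_, fun i => ?_⟩
  · rw [isUnit_iff_exists]
    refine ⟨Matrix.of fun i j => b.repr (Pi.single i 1) j, ?_, ?_⟩
    · ext i j
      have h1 : b i = ∑ l, b i l • (Pi.single l 1 : Fin n → D) := by
        ext j
        simp [Finset.sum_apply, Pi.single_apply]
      have h2 := congrArg (fun w => b.repr w j) h1
      simp only [map_sum, map_smul, Module.Basis.repr_self, Finsupp.coe_finsetSum,
        Finset.sum_apply, Finsupp.smul_apply, smul_eq_mul] at h2
      rw [mul_apply]
      simp only [of_apply]
      rw [← h2, Finsupp.single_apply, one_apply]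
    · ext i j
      have := congrFun (b.sum_repr (Pi.single i 1)) j
      simpa [mul_apply, one_apply, Finset.sum_apply, Pi.single_apply, eq_comm] using this
  · change b (Fin.castLE h i) = v i
    rw [Module.Basis.reindex_apply, he, Module.Basis.sumExtend]
    simp
    rfl

theorem exists_isUnit_cols {k m : ℕ} (h : k ≤ m) {v : Fin k → Fin m → D}
    (hv : LinearIndependent Dᵐᵒᵖ fun i => op ∘ v i) :
    ∃ P : Matrix (Fin m) (Fin m) D, IsUnit P ∧ ∀ i j, P i (Fin.castLE h j) = v j i := by
  obtain ⟨Q, hQ, hrow⟩ := exists_isUnit_rows h hv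
  obtain ⟨Q', h1, h2⟩ := isUnit_iff_exists.1 hQ
  have key {M N : Matrix (Fin m) (Fin m) Dᵐᵒᵖ} (hMN : M * N = 1) :
      Nᵀ.map unop * Mᵀ.map unop = 1 := by
    ext i j
    have := congrArg unop (congrFun (congrFun hMN j) i)
    rw [mul_apply, Finset.unop_sum] at this
    rw [mul_apply]
    simp only [unop_mul] at this
    simp only [map_apply, transpose_apply, this, one_apply, eq_comm (a := j)]
    split_ifs <;> rfl
  refine ⟨Qᵀ.map unop, isUnit_iff_exists.2 ⟨Q'ᵀ.map unop, key h2, key h1⟩, fun i j => ?_⟩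
  simp [hrow]

variable {m n p q : ℕ}

theorem mul_pad_mul {k l : ℕ} (hk : k ≤ m) (hl : l ≤ n) (P : Matrix (Fin m) (Fin m) D)
    (Q : Matrix (Fin n) (Fin n) D) (A : Matrix (Fin k) (Fin l) D) :
    P * pad m n A * Q =
      P.submatrix id (Fin.castLE hk) * A * Q.submatrix (Fin.castLE hl) id := by
  have hpad : pad m n A = (1 : Matrix (Fin m) (Fin m) D).submatrix id (Fin.castLE hk) * A *
      (1 : Matrix (Fin n) (Fin n) D).submatrix (Fin.castLE hl) id := by
    have hpad' : pad m n A = Matrix.of fun i j => ∑ b, (∑ a, (if i = Fin.castLE hk a then 1 else 0)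
        * A a b) * (if Fin.castLE hl b = j then 1 else 0) := by
      ext i j
      have hi : (∃ a, i = Fin.castLE hk a) ∨ ¬ (i : ℕ) < k := by
        by_cases h : (i : ℕ) < k
        · exact Or.inl ⟨⟨i, h⟩, rfl⟩
        · exact Or.inr h
      have hj : (∃ b, j = Fin.castLE hl b) ∨ ¬ (j : ℕ) < l := by
        by_cases h : (j : ℕ) < l
        · exact Or.inl ⟨⟨j, h⟩, rfl⟩
        · exact Or.inr h
      rcases hi with ⟨a, rfl⟩ | hi
      · rcases hj with ⟨b, rfl⟩ | hj
        · simp [pad]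
        · have (b : Fin l) : Fin.castLE hl b ≠ j := by
            rintro rfl
            exact hj b.2
          simp [pad, hj, this]
      · have (a : Fin k) : i ≠ Fin.castLE hk a := by
          rintro rfl
          exact hi a.2
        simp [pad, hi, this]
    rw [hpad']
    ext i j
    simp [mul_apply, one_apply]
  have hP : P * (1 : Matrix (Fin m) (Fin m) D).submatrix id (Fin.castLE hk) =
      P.submatrix id (Fin.castLE hk) := by
    ext i j
    simp [mul_apply, one_apply]
  have hQ : (1 : Matrix (Fin n) (Fin n) D).submatrix (Fin.castLE hl) id * Q =
      Q.submatrix (Fin.castLE hl) id := by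
    ext i j
    simp [mul_apply, one_apply]
  rw [hpad, ← hP, ← hQ]
  simp only [Matrix.mul_assoc]

theorem mul_pad_mul_injective {k l : ℕ} (hk : k ≤ m) (hl : l ≤ n)
    {P : Matrix (Fin m) (Fin m) D} {Q : Matrix (Fin n) (Fin n) D} (hP : IsUnit P)
    (hQ : IsUnit Q) :
    Function.Injective fun A : Matrix (Fin k) (Fin l) D => P * pad m n A * Q := by
  obtain ⟨P', -, hP'⟩ := isUnit_iff_exists.1 hP
  obtain ⟨Q', hQ', -⟩ := isUnit_iff_exists.1 hQ
  have hinv (M : Matrix (Fin m) (Fin n) D) : P' * (P * M * Q) * Q' = M := by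
    rw [Matrix.mul_assoc P, ← Matrix.mul_assoc P', hP', Matrix.one_mul, Matrix.mul_assoc, hQ',
      Matrix.mul_one]
  intro A B h
  have h : pad m n A = pad m n B := by
    rw [← hinv (pad m n A), ← hinv (pad m n B)]
    exact congrArg (fun M => P' * M * Q') h
  ext i j
  simpa [pad] using congrFun (congrFun h (Fin.castLE hk i)) (Fin.castLE hl j)

theorem IsDyad.mul_mul {k l : ℕ} {A : Matrix (Fin k) (Fin l) D} (hA : IsDyad A)
    (U : Matrix (Fin m) (Fin k) D) (V : Matrix (Fin l) (Fin n) D) : IsDyad (U * A * V) := by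
  obtain ⟨a, z, rfl⟩ := hA
  exact ⟨_, _, by rw [mul_vecMulVec, vecMulVec_mul]⟩

theorem mul_pad_mul_sub {k l : ℕ} (hk : k ≤ m) (hl : l ≤ n) (P : Matrix (Fin m) (Fin m) D)
    (Q : Matrix (Fin n) (Fin n) D) (A B : Matrix (Fin k) (Fin l) D) :
    P * pad m n A * Q - P * pad m n B * Q = P * pad m n (A - B) * Q := by
  simp only [mul_pad_mul hk hl, Matrix.mul_sub, Matrix.sub_mul]

theorem IsDyad.mul_pad_mul {k l : ℕ} (hk : k ≤ m) (hl : l ≤ n)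
    {A : Matrix (Fin k) (Fin l) D} (hA : IsDyad A) (P : Matrix (Fin m) (Fin m) D)
    (Q : Matrix (Fin n) (Fin n) D) : IsDyad (P * pad m n A * Q) := by
  rw [_root_.mul_pad_mul hk hl]
  exact hA.mul_mul _ _

variable {φ : Matrix (Fin m) (Fin n) D → Matrix (Fin p) (Fin q) E}

theorem PreservesAdjacency.comp_mul_pad_mul (hφ : PreservesAdjacency φ) {k l : ℕ} (hk : k ≤ m)
    (hl : l ≤ n) {P : Matrix (Fin m) (Fin m) D} {Q : Matrix (Fin n) (Fin n) D} (hP : IsUnit P)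
    (hQ : IsUnit Q) :
    PreservesAdjacency fun A : Matrix (Fin k) (Fin l) D => φ (P * pad m n A * Q) := by
  intro A B hne hd
  refine hφ _ _ ((mul_pad_mul_injective hk hl hP hQ).ne hne) ?_
  rw [mul_pad_mul_sub hk hl]
  exact hd.mul_pad_mul hk hl P Q

theorem PreservesAdjacency.isDyad_sub (hφ : PreservesAdjacency φ)
    {A B : Matrix (Fin m) (Fin n) D} (h : IsDyad (A - B)) : IsDyad (φ A - φ B) := by
  by_cases hne : A = B
  · rw [hne, sub_self]
    exact ⟨0, 0, by simp⟩
  · exact (hφ A B hne h).2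

theorem PreservesAdjacency.isDyad (hφ : PreservesAdjacency φ) (h0 : φ 0 = 0)
    {A : Matrix (Fin m) (Fin n) D} (h : IsDyad A) : IsDyad (φ A) := by
  simpa [h0] using hφ.isDyad_sub (A := A) (B := 0) (by simpa using h)

/-- Adjacency preservers map `R(x)` into a single row or a single column. -/
theorem PreservesAdjacency.image_Rvec [NeZero m] (hφ : PreservesAdjacency φ) (h0 : φ 0 = 0)
    {x : Fin n → D} (hx : x ≠ 0) :
    (∃ z, ∀ u, φ (vecMulVec u x) ∈ Rvec z) ∨ ∃ a, ∀ u, φ (vecMulVec u x) ∈ Lvec a := by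
  have hdyad (u : Fin m → D) : IsDyad (φ (vecMulVec u x)) :=
    hφ.isDyad h0 (isDyad_vecMulVec u x)
  have hsub (u v : Fin m → D) : IsDyad (φ (vecMulVec u x) - φ (vecMulVec v x)) :=
    hφ.isDyad_sub ⟨u - v, x, (sub_vecMulVec u v x).symm⟩
  have hne : φ (vecMulVec 1 x) ≠ 0 :=
    (hφ.ne_zero_and_isDyad h0 (vecMulVec_ne_zero' one_ne_zero hx) (isDyad_vecMulVec _ _)).1
  obtain ⟨a, z, haz⟩ := hdyad 1
  by_cases hz : ∀ u, φ (vecMulVec u x) ∈ Rvec z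
  · exact Or.inl ⟨z, hz⟩
  push Not at hz
  obtain ⟨v, hv⟩ := hz
  have hs := hsub v 1
  rw [haz] at hs hne
  obtain ⟨w, hw⟩ := mem_Lvec_iff.1 (((hdyad v).mem_Rvec_or_mem_Lvec hne hs).resolve_left hv)
  have hv0 : φ (vecMulVec v x) ≠ 0 := by
    intro h
    exact hv (h ▸ zero_mem_Rvec z)
  refine Or.inr ⟨a, fun u => ?_⟩
  by_cases hu0 : φ (vecMulVec u x) = 0
  · exact hu0 ▸ zero_mem_Lvec a
  have h1 := hsub u 1
  have h2 := hsub u v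
  rw [haz] at h1
  rw [hw] at h2 hv0 hv
  rcases (hdyad u).mem_Rvec_or_mem_Lvec hne h1 with h1 | h1
  · rcases (hdyad u).mem_Rvec_or_mem_Lvec hv0 h2 with h2 | h2
    · exact absurd (Rvec_subset_of_mem hu0 h2 h1 (vecMulVec_mem_Rvec a w)) hv
    · exact h2
  · exact h1

/-- A nondegenerate adjacency preserver maps two spaces `R(x)`, `R(y)` into distinct rows, or
into distinct columns. -/
theorem PreservesAdjacency.exists_distinct [NeZero m] [NeZero p] [NeZero q]
    (hφ : PreservesAdjacency φ) (h0 : φ 0 = 0) (hdeg : ¬ DegenerateOnDyads φ) :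
    (∃ x y x' y', x ≠ 0 ∧ y ≠ 0 ∧ (∀ u, φ (vecMulVec u x) ∈ Rvec x') ∧
      (∀ u, φ (vecMulVec u y) ∈ Rvec y') ∧
      ∀ M : Matrix (Fin p) (Fin q) E, M ∈ Rvec x' → M ∈ Rvec y' → M = 0) ∨
    ∃ x y a b, x ≠ 0 ∧ y ≠ 0 ∧ (∀ u, φ (vecMulVec u x) ∈ Lvec a) ∧
      (∀ u, φ (vecMulVec u y) ∈ Lvec b) ∧
      ∀ M : Matrix (Fin p) (Fin q) E, M ∈ Lvec a → M ∈ Lvec b → M = 0 := by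
  by_contra! hcon
  obtain ⟨hrow, hcol⟩ := hcon
  have hne {x : Fin n → D} (hx : x ≠ 0) : φ (vecMulVec 1 x) ≠ 0 :=
    (hφ.ne_zero_and_isDyad h0 (vecMulVec_ne_zero' one_ne_zero hx) (isDyad_vecMulVec _ _)).1
  have hR : ∃ y, y ≠ 0 ∧ ∀ x ≠ 0, ∀ x', (∀ u, φ (vecMulVec u x) ∈ Rvec x') →
      ∀ u, φ (vecMulVec u x) ∈ Rvec y := by
    by_cases h : ∃ x, x ≠ 0 ∧ ∃ x', ∀ u, φ (vecMulVec u x) ∈ Rvec x'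
    · obtain ⟨y, hy, y', hy'⟩ := h
      refine ⟨y', ne_zero_of_mem_Rvec (hne hy) (hy' 1), fun x hx x' hx' u => ?_⟩
      obtain ⟨M, h1, h2, h3⟩ := hrow x y x' y' hx hy hx' hy'
      exact Rvec_subset_of_mem h3 h1 h2 (hx' u)
    · exact ⟨1, one_ne_zero, fun x hx x' hx' => absurd ⟨x, hx, x', hx'⟩ h⟩
  have hL : ∃ b, b ≠ 0 ∧ ∀ x ≠ 0, ∀ a, (∀ u, φ (vecMulVec u x) ∈ Lvec a) →
      ∀ u, φ (vecMulVec u x) ∈ Lvec b := by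
    by_cases h : ∃ x, x ≠ 0 ∧ ∃ a, ∀ u, φ (vecMulVec u x) ∈ Lvec a
    · obtain ⟨y, hy, b, hb⟩ := h
      refine ⟨b, ne_zero_of_mem_Lvec (hne hy) (hb 1), fun x hx a ha u => ?_⟩
      obtain ⟨M, h1, h2, h3⟩ := hcol x y a b hx hy ha hb
      exact Lvec_subset_of_mem h3 h1 h2 (ha u)
    · exact ⟨1, one_ne_zero, fun x hx a ha => absurd ⟨x, hx, a, ha⟩ h⟩
  obtain ⟨y, hy0, hy⟩ := hR
  obtain ⟨b, hb0, hb⟩ := hL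
  refine hdeg ⟨b, hb0, y, hy0, ?_⟩
  rintro _ ⟨u, x, rfl⟩
  by_cases hx : x = 0
  · left
    rw [hx, show vecMulVec u (0 : Fin n → D) = 0 by ext; simp [vecMulVec_apply], h0]
    exact zero_mem_Rvec y
  · rcases hφ.image_Rvec h0 hx with ⟨z, hz⟩ | ⟨a, ha⟩
    · exact Or.inl (hy x hx z hz u)
    · exact Or.inr (hb x hx a ha u)

/-- If `R(x)` and `R(y)` are mapped into distinct rows, then every `L(u)` is mapped into a
column. -/
theorem PreservesAdjacency.image_Lvec (hφ : PreservesAdjacency φ) (h0 : φ 0 = 0)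
    {x y : Fin n → D} {x' y' : Fin q → E} (hx0 : x ≠ 0) (hy0 : y ≠ 0)
    (hx : ∀ u, φ (vecMulVec u x) ∈ Rvec x') (hy : ∀ u, φ (vecMulVec u y) ∈ Rvec y')
    (hR : ∀ M : Matrix (Fin p) (Fin q) E, M ∈ Rvec x' → M ∈ Rvec y' → M = 0)
    {u : Fin m → D} (hu : u ≠ 0) : ∃ a, ∀ z, φ (vecMulVec u z) ∈ Lvec a := by
  have hdyad (z : Fin n → D) : IsDyad (φ (vecMulVec u z)) :=
    hφ.isDyad h0 (isDyad_vecMulVec u z)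
  have hsub (z w : Fin n → D) : IsDyad (φ (vecMulVec u z) - φ (vecMulVec u w)) :=
    hφ.isDyad_sub ⟨u, z - w, (vecMulVec_sub u z w).symm⟩
  have hne {z : Fin n → D} (hz : z ≠ 0) : φ (vecMulVec u z) ≠ 0 :=
    (hφ.ne_zero_and_isDyad h0 (vecMulVec_ne_zero' hu hz) (isDyad_vecMulVec _ _)).1
  obtain ⟨b, hb⟩ := mem_Rvec_iff.1 (hy u)
  have hby := hne hy0
  have hxy := hsub x y
  rw [hb] at hby hxy
  have hxb : φ (vecMulVec u x) ∈ Lvec b :=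
    ((hdyad x).mem_Rvec_or_mem_Lvec hby hxy).resolve_left
      fun h => hne hx0 (hR _ (hx u) h)
  obtain ⟨v, hv⟩ := mem_Lvec_iff.1 hxb
  have hbv := hne hx0
  have hvx := hx u
  rw [hv] at hbv hvx
  refine ⟨b, fun z => ?_⟩
  have h1 := hsub z x
  have h2 := hsub z y
  rw [hv] at h1
  rw [hb] at h2
  rcases (hdyad z).mem_Rvec_or_mem_Lvec hbv h1 with h1 | h1
  · rcases (hdyad z).mem_Rvec_or_mem_Lvec hby h2 with h2 | h2
    · rw [hR _ (Rvec_subset_of_mem hbv (vecMulVec_mem_Rvec b v) hvx h1) h2]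
      exact zero_mem_Lvec b
    · exact h2
  · exact h1

theorem PreservesAdjacency.exists_block_of_rows (hφ : PreservesAdjacency φ) (h0 : φ 0 = 0)
    (hm : 2 ≤ m) (hn : 2 ≤ n) (hDE : (∀ t : D, t = 0 ∨ t = 1) → ∀ t : E, t = 0 ∨ t = 1)
    (hdeg : ¬ DegenerateOnDyads φ) {x y : Fin n → D} {x' y' : Fin q → E} (hx0 : x ≠ 0)
    (hy0 : y ≠ 0) (hx : ∀ u, φ (vecMulVec u x) ∈ Rvec x')
    (hy : ∀ u, φ (vecMulVec u y) ∈ Rvec y')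
    (hR : ∀ M : Matrix (Fin p) (Fin q) E, M ∈ Rvec x' → M ∈ Rvec y' → M = 0) :
    ∃ P : Matrix (Fin m) (Fin m) D, ∃ Q : Matrix (Fin n) (Fin n) D, IsUnit P ∧ IsUnit Q ∧
      ¬ DegenerateOnDyads (fun A : Matrix (Fin 2) (Fin 2) D => φ (P * pad m n A * Q)) ∧
      ∃ A : Matrix (Fin 2) (Fin 2) D, ¬ IsDyad A ∧ ¬ IsDyad (φ (P * pad m n A * Q)) := by
  have : NeZero m := ⟨by omega⟩
  have hne {u : Fin m → D} {z : Fin n → D} (hu : u ≠ 0) (hz : z ≠ 0) :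
      φ (vecMulVec u z) ≠ 0 :=
    (hφ.ne_zero_and_isDyad h0 (vecMulVec_ne_zero' hu hz) (isDyad_vecMulVec _ _)).1
  have himage {u : Fin m → D} (hu : u ≠ 0) := hφ.image_Lvec h0 hx0 hy0 hx hy hR hu
  obtain ⟨u, v, a, b, hu0, hv0, hu, hv, hL⟩ : ∃ (u v : Fin m → D) (a b : Fin p → E),
      u ≠ 0 ∧ v ≠ 0 ∧ (∀ z, φ (vecMulVec u z) ∈ Lvec a) ∧
      (∀ z, φ (vecMulVec v z) ∈ Lvec b) ∧
      ∀ M : Matrix (Fin p) (Fin q) E, M ∈ Lvec a → M ∈ Lvec b → M = 0 := by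
    by_contra! hcon
    obtain ⟨b, hb⟩ := himage (u := 1) one_ne_zero
    have h1 := hne (u := 1) one_ne_zero hx0
    refine hdeg ⟨b, ne_zero_of_mem_Lvec h1 (hb x), x', ne_zero_of_mem_Rvec h1 (hx 1), ?_⟩
    rintro _ ⟨u, z, rfl⟩
    right
    by_cases hu : u = 0
    · rw [hu, zero_vecMulVec, h0]
      exact zero_mem_Lvec b
    · obtain ⟨a, ha⟩ := himage hu
      obtain ⟨M, hMa, hMb, hM⟩ := hcon u 1 a b hu one_ne_zero ha hb
      exact Lvec_subset_of_mem hM hMa hMb (ha z)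
  have hxy : LinearIndependent D ![x, y] := by
    rw [LinearIndependent.pair_iff' hx0]
    rintro c rfl
    refine hne (u := u) hu0 hy0 (hR _ ?_ (hy u))
    have : vecMulVec u (c • x) = vecMulVec (fun i => u i * c) x := by
      ext
      simp [vecMulVec_apply, mul_assoc]
    rw [this]
    exact hx _
  have huv : LinearIndependent Dᵐᵒᵖ fun i => MulOpposite.op ∘ (![u, v] i) := by
    have : (fun i => MulOpposite.op ∘ (![u, v] i)) =
        ![MulOpposite.op ∘ u, MulOpposite.op ∘ v] := by
      ext i
      fin_cases i <;> rfl
    rw [this, LinearIndependent.pair_iff' fun h => hu0 (funext fun i => by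
      simpa using congrFun h i)]
    intro c hc
    refine hne hv0 hx0 (hL _ ?_ (hv x))
    have : vecMulVec v x = vecMulVec u (c.unop • x) := by
      ext i j
      have h := congrArg unop (congrFun hc i)
      simp only [Pi.smul_apply, Function.comp_apply, smul_eq_mul, unop_mul, unop_op] at h
      simp [vecMulVec_apply, ← h, mul_assoc]
    rw [this]
    exact hu _
  obtain ⟨P, hP, hPc⟩ := exists_isUnit_cols hm huv
  obtain ⟨Q, hQ, hQr⟩ := exists_isUnit_rows hn hxy
  have hψ := hφ.comp_mul_pad_mul (k := 2) (l := 2) hm hn hP hQ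
  have hψ0 : φ (P * pad m n (0 : Matrix (Fin 2) (Fin 2) D) * Q) = 0 := by
    rw [mul_pad_mul hm hn]
    simpa using h0
  have hr (j : Fin 2) (w : Fin 2 → D) :
      φ (P * pad m n (vecMulVec w (Pi.single j 1)) * Q) ∈ Rvec (![x', y'] j) := by
    rw [mul_pad_mul hm hn, mul_vecMulVec, vecMulVec_mul, single_one_vecMul]
    have : (Q.submatrix (Fin.castLE hn) id).row j = ![x, y] j := by
      rw [← hQr]
      rfl
    rw [this]
    fin_cases j
    · exact hx _
    · exact hy _
  have hl (i : Fin 2) (w : Fin 2 → D) :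
      φ (P * pad m n (vecMulVec (Pi.single i 1) w) * Q) ∈ Lvec (![a, b] i) := by
    rw [mul_pad_mul hm hn, mul_vecMulVec, vecMulVec_mul, mulVec_single_one]
    have : (P.submatrix id (Fin.castLE hm)).col i = ![u, v] i := by
      ext k
      rw [← hPc]
      rfl
    rw [this]
    fin_cases i
    · exact hu _
    · exact hv _
  exact ⟨P, Q, hP, hQ, not_degenerateOnDyads_of_grid hψ hψ0 hr hl hR hL,
    exists_not_isDyad_of_grid hψ hψ0 hDE hr hl hR hL⟩

end Blocks

section OpTranspose

open MulOpposite

variable {m n p q : ℕ}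

theorem op_transpose_mem_Rvec {M : Matrix (Fin m) (Fin n) D} {a : Fin m → D} :
    Mᵀ.map op ∈ Rvec (op ∘ a) ↔ M ∈ Lvec a := by
  constructor
  · rintro ⟨u, hu⟩
    exact ⟨unop ∘ u, fun i j => by simpa using congrArg unop (hu j i)⟩
  · rintro ⟨v, hv⟩
    exact ⟨op ∘ v, fun i j => by simp [hv]⟩

theorem op_transpose_mem_Lvec {M : Matrix (Fin m) (Fin n) D} {z : Fin n → D} :
    Mᵀ.map op ∈ Lvec (op ∘ z) ↔ M ∈ Rvec z := by
  constructor
  · rintro ⟨u, hu⟩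
    exact ⟨unop ∘ u, fun i j => by simpa using congrArg unop (hu j i)⟩
  · rintro ⟨v, hv⟩
    exact ⟨op ∘ v, fun i j => by simp [hv]⟩

theorem isDyad_op_transpose_iff {M : Matrix (Fin m) (Fin n) D} :
    IsDyad (Mᵀ.map op) ↔ IsDyad M := by
  constructor
  · rintro ⟨a, z, h⟩
    refine ⟨unop ∘ z, unop ∘ a, ?_⟩
    ext i j
    simpa [vecMulVec_apply] using congrArg unop (congrFun (congrFun h j) i)
  · rintro ⟨a, z, rfl⟩
    exact ⟨op ∘ z, op ∘ a, by ext; simp [vecMulVec_apply]⟩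

variable {φ : Matrix (Fin m) (Fin n) D → Matrix (Fin p) (Fin q) E}

theorem PreservesAdjacency.op_transpose (hφ : PreservesAdjacency φ) :
    PreservesAdjacency fun A => (φ A)ᵀ.map op := by
  intro A B hne hd
  obtain ⟨h1, h2⟩ := hφ A B hne hd
  refine ⟨fun h => h1 ?_, ?_⟩
  · ext i j
    simpa using congrArg unop (congrFun (congrFun h j) i)
  · have : (φ A)ᵀ.map op - (φ B)ᵀ.map op = (φ A - φ B)ᵀ.map op := by
      ext
      simp
    rw [this]
    exact isDyad_op_transpose_iff.2 h2

theorem degenerateOnDyads_op_transpose_iff :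
    DegenerateOnDyads (fun A => (φ A)ᵀ.map op) ↔ DegenerateOnDyads φ := by
  constructor
  · rintro ⟨x, hx, y, hy, h⟩
    refine ⟨unop ∘ y, fun h' => hy (funext fun i => by simpa using congrFun h' i),
      unop ∘ x, fun h' => hx (funext fun i => by simpa using congrFun h' i), fun M hM => ?_⟩
    rcases h M hM with h | h
    · exact Or.inr (op_transpose_mem_Rvec.1 h)
    · exact Or.inl (op_transpose_mem_Lvec.1 h)
  · rintro ⟨x, hx, y, hy, h⟩
    refine ⟨op ∘ y, fun h' => hy (funext fun i => by simpa using congrFun h' i),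
      op ∘ x, fun h' => hx (funext fun i => by simpa using congrFun h' i), fun M hM => ?_⟩
    rcases h M hM with h | h
    · exact Or.inr (op_transpose_mem_Lvec.2 h)
    · exact Or.inl (op_transpose_mem_Rvec.2 h)

end OpTranspose

theorem PreservesAdjacency.exists_block {m n p q : ℕ}
    {φ : Matrix (Fin m) (Fin n) D → Matrix (Fin p) (Fin q) D} (hφ : PreservesAdjacency φ)
    (h0 : φ 0 = 0) (hm : 2 ≤ m) (hn : 2 ≤ n) (hp : 0 < p) (hq : 0 < q)
    (hdeg : ¬ DegenerateOnDyads φ) :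
    ∃ P : Matrix (Fin m) (Fin m) D, ∃ Q : Matrix (Fin n) (Fin n) D, IsUnit P ∧ IsUnit Q ∧
      ¬ DegenerateOnDyads (fun A : Matrix (Fin 2) (Fin 2) D => φ (P * pad m n A * Q)) ∧
      ∃ A : Matrix (Fin 2) (Fin 2) D, ¬ IsDyad A ∧ ¬ IsDyad (φ (P * pad m n A * Q)) := by
  have : NeZero m := ⟨by omega⟩
  have : NeZero p := ⟨by omega⟩
  have : NeZero q := ⟨by omega⟩
  rcases hφ.exists_distinct h0 hdeg with
    ⟨x, y, x', y', hx0, hy0, hx, hy, hR⟩ | ⟨x, y, a, b, hx0, hy0, hx, hy, hL⟩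
  · exact hφ.exists_block_of_rows h0 hm hn id hdeg hx0 hy0 hx hy hR
  · obtain ⟨P, Q, hP, hQ, h1, A, hA, h2⟩ := hφ.op_transpose.exists_block_of_rows
      (by ext; simp [h0]) hm hn
      (fun h t => (h t.unop).imp MulOpposite.unop_injective.eq_iff.1
        MulOpposite.unop_injective.eq_iff.1)
      (degenerateOnDyads_op_transpose_iff.not.2 hdeg) hx0 hy0
      (fun u => op_transpose_mem_Rvec.2 (hx u)) (fun u => op_transpose_mem_Rvec.2 (hy u))
      (fun M h1 h2 => by
        have hM : M = ((M.map MulOpposite.unop)ᵀ)ᵀ.map MulOpposite.op := by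
          ext
          simp
        rw [hM] at h1 h2 ⊢
        rw [hL _ (op_transpose_mem_Rvec.1 h1) (op_transpose_mem_Rvec.1 h2)]
        ext
        simp)
    exact ⟨P, Q, hP, hQ, degenerateOnDyads_op_transpose_iff.not.1 h1, A, hA,
      isDyad_op_transpose_iff.not.1 h2⟩

theorem degZero_iff {m n p q : ℕ} {φ : Matrix (Fin m) (Fin n) D → Matrix (Fin p) (Fin q) D} :
    DegZero φ ↔ DegenerateOnDyads φ := by
  simp only [DegZero, DegenerateOnDyads, rowRank_le_one_iff]

/-- Proposition 3.11, initial reduction. -/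
theorem stmt9 (m n p q : ℕ) (hm : 2 ≤ m) (hn : 2 ≤ n) (hp : 0 < p) (hq : 0 < q)
    (φ : Matrix (Fin m) (Fin n) D → Matrix (Fin p) (Fin q) D)
    (hφ : ∀ A B, Adjacent A B → Adjacent (φ A) (φ B)) (h0 : φ 0 = 0)
    (hdeg : ¬ DegZero φ) :
    ∃ P : Matrix (Fin m) (Fin m) D, ∃ Q : Matrix (Fin n) (Fin n) D,
      IsUnit P ∧ IsUnit Q ∧
      ¬ DegZero (fun A : Matrix (Fin 2) (Fin 2) D => φ (P * pad m n A * Q)) ∧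
      ∃ A : Matrix (Fin 2) (Fin 2) D,
        rowRank A = 2 ∧ rowRank (φ (P * pad m n A * Q)) = 2 := by
  have hφ' : PreservesAdjacency φ := fun A B hne hd =>
    adjacent_iff.1 (hφ A B (adjacent_iff.2 ⟨hne, hd⟩))
  obtain ⟨P, Q, hP, hQ, hdeg', A, hA, hA'⟩ :=
    hφ'.exists_block h0 hm hn hp hq (degZero_iff.not.1 hdeg)
  refine ⟨P, Q, hP, hQ, degZero_iff.not.2 hdeg', A, ?_, ?_⟩
  · rw [← rowRank_le_one_iff] at hA
    have : rowRank A ≤ 2 := by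
      simpa [rowRank] using Submodule.finrank_le (Submodule.span D (Set.range fun i => A i))
    omega
  · have hsplit : IsDyad (A - vecMulVec (Pi.single 0 1) (A 0)) :=
      isDyad_fin_two 0 1 (A 1 0) (A 1 1) (by simp [vecMulVec_apply]) (by simp [vecMulVec_apply])
        (by simp [vecMulVec_apply]) (by simp [vecMulVec_apply])
    have h1 : IsDyad (φ (P * pad m n (vecMulVec (Pi.single 0 1) (A 0)) * Q)) :=
      hφ'.isDyad h0 ((isDyad_vecMulVec _ _).mul_pad_mul hm hn P Q)
    have h2 := (hφ'.comp_mul_pad_mul hm hn hP hQ).isDyad_sub hsplit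
    have h3 := rowRank_add_le_two h2 h1
    rw [sub_add_cancel] at h3
    rw [← rowRank_le_one_iff] at hA'
    omega
end

section
/- Let p, q ≥ 2 be integers, D be an EAS division ring, and φ : M_2(D) → M_{p×q}(D) be an adjacency preserver such that φ(0) = 0. Assume that φ does not map the set of rank 1 matrices into an adjacent set, and that φ maps at least one rank 2 matrix to a rank 2 matrix. Then φ is standard. -/
open Matrix

variable {D : Type*} [DivisionRing D]

section Basics

variable {E : Type*} [DivisionRing E]

/-- Two column vectors are independent (over the right scalars), witnessed by a dual pair. -/
def ColInd {m : ℕ} (u s : Fin m → E) : Prop :=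
  ∃ c d : Fin m → E, c ⬝ᵥ u = 1 ∧ c ⬝ᵥ s = 0 ∧ d ⬝ᵥ u = 0 ∧ d ⬝ᵥ s = 1

/-- Two row vectors are independent (over the left scalars), witnessed by a dual pair. -/
def RowInd {m : ℕ} (v t : Fin m → E) : Prop :=
  ∃ c d : Fin m → E, v ⬝ᵥ c = 1 ∧ t ⬝ᵥ c = 0 ∧ v ⬝ᵥ d = 0 ∧ t ⬝ᵥ d = 1

/-- `Z = U * V` with `U` left invertible with two columns and `V` right invertible with
two rows; equivalently `Z` has rank two. -/
def RankTwo {p q : ℕ} (Z : Matrix (Fin p) (Fin q) E) : Prop :=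
  ∃ (U : Matrix (Fin p) (Fin 2) E) (V : Matrix (Fin 2) (Fin q) E)
    (U' : Matrix (Fin 2) (Fin p) E) (V' : Matrix (Fin q) (Fin 2) E),
    U' * U = 1 ∧ V * V' = 1 ∧ Z = U * V

theorem ColInd.symm {m : ℕ} {u s : Fin m → E} (h : ColInd u s) : ColInd s u := by
  obtain ⟨c, d, h1, h2, h3, h4⟩ := h
  exact ⟨d, c, h4, h3, h2, h1⟩

theorem RowInd.symm {m : ℕ} {u s : Fin m → E} (h : RowInd u s) : RowInd s u := by
  obtain ⟨c, d, h1, h2, h3, h4⟩ := h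
  exact ⟨d, c, h4, h3, h2, h1⟩

theorem ColInd.ne_zero {m : ℕ} {u s : Fin m → E} (h : ColInd u s) : u ≠ 0 := by
  obtain ⟨c, d, h1, h2, h3, h4⟩ := h
  rintro rfl
  simp at h1

theorem RowInd.ne_zero {m : ℕ} {u s : Fin m → E} (h : RowInd u s) : u ≠ 0 := by
  obtain ⟨c, d, h1, h2, h3, h4⟩ := h
  rintro rfl
  simp at h1

theorem dotProduct_op_smul' {m : ℕ} (c u : Fin m → E) (k : E) :
    c ⬝ᵥ (MulOpposite.op k • u) = (c ⬝ᵥ u) * k := by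
  simp [dotProduct, Finset.sum_mul, mul_assoc]

theorem op_smul_vecMulVec' {m n : ℕ} (u : Fin m → E) (v : Fin n → E) (k : E) :
    vecMulVec (MulOpposite.op k • u) v = vecMulVec u (k • v) := by
  ext i j; simp [vecMulVec_apply, mul_assoc]

theorem vecMulVec_zero' {m n : ℕ} (u : Fin m → E) : vecMulVec u (0 : Fin n → E) = 0 := by
  ext i j; simp [vecMulVec_apply]

theorem zero_vecMulVec' {m n : ℕ} (v : Fin n → E) : vecMulVec (0 : Fin m → E) v = 0 := by
  ext i j; simp [vecMulVec_apply]

theorem vecMulVec_eq_zero' {m n : ℕ} {u : Fin m → E} {v : Fin n → E} :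
    vecMulVec u v = 0 ↔ u = 0 ∨ v = 0 := by
  refine ⟨fun h => ?_, ?_⟩
  · by_contra! hc
    obtain ⟨i, hi⟩ := Function.ne_iff.mp hc.1
    obtain ⟨j, hj⟩ := Function.ne_iff.mp hc.2
    exact mul_ne_zero hi hj (congrFun (congrFun h i) j)
  · rintro (rfl | rfl)
    exacts [zero_vecMulVec' v, vecMulVec_zero' u]

theorem ColInd.not_smul {m : ℕ} {u s : Fin m → E} (h : ColInd u s) (k : E) :
    s ≠ MulOpposite.op k • u := by
  obtain ⟨c, d, h1, h2, h3, h4⟩ := h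
  rintro rfl
  simp [h3] at h4

theorem RowInd.not_smul {m : ℕ} {u s : Fin m → E} (h : RowInd u s) (k : E) :
    s ≠ k • u := by
  obtain ⟨c, d, h1, h2, h3, h4⟩ := h
  rintro rfl
  simp [h3] at h4

theorem colInd_or_smul {m : ℕ} {u s : Fin m → E} (hu : u ≠ 0) (hs : s ≠ 0) :
    ColInd u s ∨ ∃ k : E, k ≠ 0 ∧ s = MulOpposite.op k • u := by
  obtain ⟨i, hi⟩ := Function.ne_iff.mp hu
  simp only [Pi.zero_apply] at hi
  by_cases h : ∀ j, s j = u j * ((u i)⁻¹ * s i)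
  · right
    refine ⟨(u i)⁻¹ * s i, ?_, ?_⟩
    · intro h0
      apply hs
      funext j
      rw [h j, h0]; simp
    · funext j
      rw [h j]; simp
  · left
    push Not at h
    obtain ⟨j, hj⟩ := h
    set r := s j - u j * ((u i)⁻¹ * s i) with hr
    have hr0 : r ≠ 0 := sub_ne_zero.mpr hj
    set d : Fin m → E := r⁻¹ • (Pi.single j 1 - Pi.single i (u j * (u i)⁻¹)) with hd
    have hdu : d ⬝ᵥ u = 0 := by
      simp [hd, sub_dotProduct, smul_dotProduct, hi]
    have hds : d ⬝ᵥ s = 1 := by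
      have : d ⬝ᵥ s = r⁻¹ * r := by
        simp [hd, hr, sub_dotProduct, smul_dotProduct, mul_assoc]
      rw [this, inv_mul_cancel₀ hr0]
    refine ⟨Pi.single i (u i)⁻¹ - ((u i)⁻¹ * s i) • d, d, ?_, ?_, hdu, hds⟩
    · simp [sub_dotProduct, hdu, hi]
    · simp [sub_dotProduct, hds]

theorem rowInd_or_smul {m : ℕ} {u s : Fin m → E} (hu : u ≠ 0) (hs : s ≠ 0) :
    RowInd u s ∨ ∃ k : E, k ≠ 0 ∧ s = k • u := by
  obtain ⟨i, hi⟩ := Function.ne_iff.mp hu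
  simp only [Pi.zero_apply] at hi
  by_cases h : ∀ j, s j = s i * (u i)⁻¹ * u j
  · right
    refine ⟨s i * (u i)⁻¹, ?_, ?_⟩
    · intro h0
      apply hs
      funext j
      rw [h j, h0]; simp
    · funext j
      rw [h j]; simp
  · left
    push Not at h
    obtain ⟨j, hj⟩ := h
    set r := s j - s i * (u i)⁻¹ * u j with hr
    have hr0 : r ≠ 0 := sub_ne_zero.mpr hj
    set d : Fin m → E :=
      MulOpposite.op r⁻¹ • (Pi.single j 1 - Pi.single i ((u i)⁻¹ * u j)) with hd
    have hdu : u ⬝ᵥ d = 0 := by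
      rw [hd, dotProduct_op_smul']
      simp [dotProduct_sub, hi]
    have hds : s ⬝ᵥ d = 1 := by
      have : s ⬝ᵥ d = r * r⁻¹ := by
        rw [hd, dotProduct_op_smul']
        simp [hr, dotProduct_sub, mul_assoc]
      rw [this, mul_inv_cancel₀ hr0]
    refine ⟨Pi.single i (u i)⁻¹ - MulOpposite.op (s i * (u i)⁻¹) • d, d, ?_, ?_, hdu, hds⟩
    · rw [dotProduct_sub, dotProduct_op_smul', hdu]; simp [hi]
    · rw [dotProduct_sub, dotProduct_op_smul', hds]; simp

theorem ColInd.smul {m : ℕ} {u s : Fin m → E} (h : ColInd u s) {k l : E} (hk : k ≠ 0)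
    (hl : l ≠ 0) : ColInd (MulOpposite.op k • u) (MulOpposite.op l • s) := by
  obtain ⟨c, d, h1, h2, h3, h4⟩ := h
  refine ⟨k⁻¹ • c, l⁻¹ • d, ?_⟩
  simp [h1, h2, h3, h4, hk, hl]

theorem RowInd.smul {m : ℕ} {u s : Fin m → E} (h : RowInd u s) {k l : E} (hk : k ≠ 0)
    (hl : l ≠ 0) : RowInd (k • u) (l • s) := by
  obtain ⟨c, d, h1, h2, h3, h4⟩ := h
  refine ⟨MulOpposite.op k⁻¹ • c, MulOpposite.op l⁻¹ • d, ?_⟩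
  simp [h1, h2, h3, h4, hk, hl]

/-- A relation between two rank one matrices with independent columns. -/
theorem ColInd.rows_of_add {m n : ℕ} {u s : Fin m → E} (h : ColInd u s)
    {v t : Fin n → E} {a : Fin m → E} {b : Fin n → E}
    (e : vecMulVec u v + vecMulVec s t = vecMulVec a b) :
    ∃ k l : E, v = k • b ∧ t = l • b := by
  obtain ⟨c, d, h1, h2, h3, h4⟩ := h
  refine ⟨c ⬝ᵥ a, d ⬝ᵥ a, ?_, ?_⟩
  · have := congrArg (fun M => c ᵥ* M) e
    simpa [vecMul_add, vecMul_vecMulVec, h1, h2] using this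
  · have := congrArg (fun M => d ᵥ* M) e
    simpa [vecMul_add, vecMul_vecMulVec, h3, h4] using this

theorem ColInd.unique {m n : ℕ} {u s : Fin m → E} (h : ColInd u s)
    {v t v' t' : Fin n → E}
    (e : vecMulVec u v + vecMulVec s t = vecMulVec u v' + vecMulVec s t') :
    v = v' ∧ t = t' := by
  obtain ⟨c, d, h1, h2, h3, h4⟩ := h
  constructor
  · have := congrArg (fun M => c ᵥ* M) e
    simpa [vecMul_add, vecMul_vecMulVec, h1, h2] using this
  · have := congrArg (fun M => d ᵥ* M) e
    simpa [vecMul_add, vecMul_vecMulVec, h3, h4] using this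

theorem RowInd.unique {n : ℕ} {v t : Fin n → E} (h : RowInd v t) {a b a' b' : E}
    (e : a • v + b • t = a' • v + b' • t) : a = a' ∧ b = b' := by
  obtain ⟨c, d, h1, h2, h3, h4⟩ := h
  constructor
  · have := congrArg (fun M => M ⬝ᵥ c) e
    simpa [add_dotProduct, h1, h2] using this
  · have := congrArg (fun M => M ⬝ᵥ d) e
    simpa [add_dotProduct, h3, h4] using this

theorem vecMulVec_left_cancel {m n : ℕ} {u : Fin m → E} (hu : u ≠ 0) {v w : Fin n → E}
    (h : vecMulVec u v = vecMulVec u w) : v = w := by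
  have : vecMulVec u (v - w) = 0 := by rw [vecMulVec_sub, h, sub_self]
  rw [vecMulVec_eq_zero'] at this
  exact sub_eq_zero.mp (this.resolve_left hu)

/-- A nonzero matrix in `L(u)` and in `L(s)`. -/
theorem ColInd.eq_zero_of_eq {m n : ℕ} {u s : Fin m → E} (h : ColInd u s)
    {v t : Fin n → E} (e : vecMulVec u v = vecMulVec s t) : v = 0 ∧ t = 0 :=
  h.unique (v' := 0) (t' := t) (v := v) (t := 0) (by simpa [vecMulVec_zero'] using e)
    |>.imp_right Eq.symm

theorem RowInd.eq_zero_of_eq {m n : ℕ} {v t : Fin n → E} (h : RowInd v t)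
    {u s : Fin m → E} (e : vecMulVec u v = vecMulVec s t) : u = 0 ∧ s = 0 := by
  obtain ⟨c, d, h1, h2, h3, h4⟩ := h
  constructor
  · have := congrArg (fun M => M *ᵥ c) e
    simpa [vecMulVec_mulVec, h1, h2] using this
  · have := congrArg (fun M => M *ᵥ d) e
    simpa [vecMulVec_mulVec, h3, h4] using this.symm

/-- A rank one matrix lying in `L(u)` and in `R(v)`. -/
theorem eq_smul_of_vecMulVec_eq {m n : ℕ} {u z : Fin m → E} {w v : Fin n → E} (hu : u ≠ 0)
    (hv : v ≠ 0) (e : vecMulVec u w = vecMulVec z v) : ∃ k : E, w = k • v := by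
  by_cases hw : w = 0
  · exact ⟨0, by simp [hw]⟩
  rcases rowInd_or_smul hv hw with h | ⟨k, -, hk⟩
  · exact absurd (h.eq_zero_of_eq e.symm).2 hu
  · exact ⟨k, hk⟩

theorem rankTwo_of_ind {p q : ℕ} {u s : Fin p → E} {v t : Fin q → E} (h : ColInd u s)
    (h' : RowInd v t) : RankTwo (vecMulVec u v + vecMulVec s t) := by
  obtain ⟨c, d, h1, h2, h3, h4⟩ := h
  obtain ⟨c', d', h1', h2', h3', h4'⟩ := h'
  refine ⟨Matrix.of fun i k => ![u i, s i] k, Matrix.of ![v, t], Matrix.of ![c, d],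
    Matrix.of fun i k => ![c' i, d' i] k, ?_, ?_, ?_⟩
  · ext i j
    fin_cases i <;> fin_cases j <;> simpa [mul_apply, dotProduct] using by assumption
  · ext i j
    fin_cases i <;> fin_cases j <;> simpa [mul_apply, dotProduct] using by assumption
  · ext i j
    simp [mul_apply, vecMulVec_apply]

theorem rankTwo_or {p q : ℕ} (u s : Fin p → E) (v t : Fin q → E) :
    RankTwo (vecMulVec u v + vecMulVec s t) ∨
      ∃ a b, vecMulVec u v + vecMulVec s t = vecMulVec a b := by
  by_cases hu : u = 0
  · right; exact ⟨s, t, by simp [hu]⟩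
  by_cases hs : s = 0
  · right; exact ⟨u, v, by simp [hs]⟩
  by_cases hv : v = 0
  · right; exact ⟨s, t, by simp [hv, vecMulVec_zero']⟩
  by_cases ht : t = 0
  · right; exact ⟨u, v, by simp [ht, vecMulVec_zero']⟩
  rcases colInd_or_smul hu hs with h | ⟨k, -, rfl⟩
  · rcases rowInd_or_smul hv ht with h' | ⟨k, -, rfl⟩
    · exact Or.inl (rankTwo_of_ind h h')
    · right
      refine ⟨u + MulOpposite.op k • s, v, ?_⟩
      rw [add_vecMulVec, op_smul_vecMulVec']
  · right
    refine ⟨u, v + k • t, ?_⟩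
    rw [vecMulVec_add, op_smul_vecMulVec']

theorem rowRank_eq_zero_iff_s10 {p q : ℕ} (A : Matrix (Fin p) (Fin q) E) :
    rowRank A = 0 ↔ A = 0 := by
  unfold rowRank
  rw [Submodule.finrank_eq_zero, Submodule.span_eq_bot]
  constructor
  · intro h
    ext i j
    rw [h (A i) ⟨i, rfl⟩]; rfl
  · rintro rfl x ⟨i, rfl⟩
    rfl

theorem rowRank_vecMulVec_le {p q : ℕ} (u : Fin p → E) (v : Fin q → E) :
    rowRank (vecMulVec u v) ≤ 1 := by
  unfold rowRank
  have h : Submodule.span E (Set.range fun i => vecMulVec u v i) ≤ Submodule.span E {v} := by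
    rw [Submodule.span_le]
    rintro _ ⟨i, rfl⟩
    exact Submodule.mem_span_singleton.mpr ⟨u i, rfl⟩
  refine (Submodule.finrank_mono h).trans ?_
  simpa using finrank_span_le_card (R := E) ({v} : Set (Fin q → E))

theorem rowRank_eq_one_iff {p q : ℕ} (A : Matrix (Fin p) (Fin q) E) :
    rowRank A = 1 ↔ ∃ u v, u ≠ 0 ∧ v ≠ 0 ∧ A = vecMulVec u v := by
  constructor
  · intro h
    have h' := h
    unfold rowRank at h'
    rw [finrank_eq_one_iff'] at h'
    obtain ⟨⟨v, hv⟩, hv0, hspan⟩ := h'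
    have : ∀ i, ∃ c : E, c • v = A i := fun i => by
      obtain ⟨c, hc⟩ := hspan ⟨A i, Submodule.subset_span ⟨i, rfl⟩⟩
      exact ⟨c, congrArg Subtype.val hc⟩
    choose u hu using this
    have hA : A = vecMulVec u v := by
      ext i j
      rw [← hu i]; rfl
    refine ⟨u, v, ?_, fun h => hv0 (Subtype.ext h), hA⟩
    rintro rfl
    rw [zero_vecMulVec'] at hA
    have := (rowRank_eq_zero_iff_s10 A).mpr hA
    omega
  · rintro ⟨u, v, hu, hv, rfl⟩
    refine le_antisymm (rowRank_vecMulVec_le u v) (Nat.one_le_iff_ne_zero.mpr ?_)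
    rw [Ne, rowRank_eq_zero_iff_s10, vecMulVec_eq_zero']
    tauto

theorem adjacent_iff_s10 {p q : ℕ} {A B : Matrix (Fin p) (Fin q) E} :
    Adjacent A B ↔ ∃ u v, u ≠ 0 ∧ v ≠ 0 ∧ A - B = vecMulVec u v :=
  rowRank_eq_one_iff _

theorem rankTwo_of_rowRank {p q : ℕ} {Z : Matrix (Fin p) (Fin q) E} (h : rowRank Z = 2) :
    RankTwo Z := by
  let b := Module.finBasisOfFinrankEq E _ h
  obtain ⟨u, s, v, t, hZ⟩ : ∃ u s v t, Z = vecMulVec u v + vecMulVec s t := by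
    refine ⟨fun i => b.repr ⟨Z i, Submodule.subset_span ⟨i, rfl⟩⟩ 0,
      fun i => b.repr ⟨Z i, Submodule.subset_span ⟨i, rfl⟩⟩ 1, (b 0 : _), (b 1 : _), ?_⟩
    ext i j
    have := congrArg Subtype.val (b.sum_repr ⟨Z i, Submodule.subset_span ⟨i, rfl⟩⟩)
    rw [Fin.sum_univ_two] at this
    exact (congrFun this j).symm
  rcases rankTwo_or u s v t with h' | ⟨a, c, h'⟩
  · rw [hZ]; exact h'
  · have := rowRank_vecMulVec_le a c
    rw [← h', ← hZ, h] at this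
    omega

end Basics

section Plane

variable {E : Type*} [DivisionRing E]

theorem exists_colInd {y : Fin 2 → E} (hy : y ≠ 0) : ∃ y', ColInd y y' := by
  by_contra! h
  have key : ∀ z : Fin 2 → E, z ≠ 0 → ∃ k : E, k ≠ 0 ∧ z = MulOpposite.op k • y :=
    fun z hz => (colInd_or_smul hy hz).resolve_left (h z)
  obtain ⟨k, hk, e⟩ := key ![1, 0] (fun e => by simpa using congrFun e 0)
  obtain ⟨l, hl, e'⟩ := key ![0, 1] (fun e => by simpa using congrFun e 1)
  have h1 := congrFun e 1
  have h0 := congrFun e' 0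
  simp [hk, hl] at h1 h0
  apply hy
  ext i
  fin_cases i <;> simp [h0, h1]

theorem exists_rowInd {y : Fin 2 → E} (hy : y ≠ 0) : ∃ y', RowInd y y' := by
  by_contra! h
  have key : ∀ z : Fin 2 → E, z ≠ 0 → ∃ k : E, k ≠ 0 ∧ z = k • y :=
    fun z hz => (rowInd_or_smul hy hz).resolve_left (h z)
  obtain ⟨k, hk, e⟩ := key ![1, 0] (fun e => by simpa using congrFun e 0)
  obtain ⟨l, hl, e'⟩ := key ![0, 1] (fun e => by simpa using congrFun e 1)
  have h1 := congrFun e 1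
  have h0 := congrFun e' 0
  simp [hk, hl] at h1 h0
  apply hy
  ext i
  fin_cases i <;> simp [h0, h1]

theorem exists_dotProduct_eq_one {x : Fin 2 → E} (hx : x ≠ 0) : ∃ y, x ⬝ᵥ y = 1 := by
  obtain ⟨x', c, d, h, -⟩ := exists_rowInd hx
  exact ⟨c, h⟩

/-- A left inverse pair of `2 × 2` data is a resolution of the identity. -/
theorem one_eq_of_dual {x d y c : Fin 2 → E} (h1 : x ⬝ᵥ y = 1) (h2 : x ⬝ᵥ c = 0)
    (h3 : d ⬝ᵥ y = 0) (h4 : d ⬝ᵥ c = 1) :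
    (1 : Matrix (Fin 2) (Fin 2) E) = vecMulVec y x + vecMulVec c d := by
  have h : (Matrix.of ![x, d]) * (Matrix.of fun i k => ![y i, c i] k) = 1 := by
    ext i j
    simp only [dotProduct, Fin.sum_univ_two] at h1 h2 h3 h4
    fin_cases i <;> fin_cases j <;> simpa [mul_apply] using by assumption
  rw [mul_eq_one_comm] at h
  rw [← h]
  ext i j
  simp [mul_apply, vecMulVec_apply]

theorem dual_of_one_eq {x d y c : Fin 2 → E}
    (h : (1 : Matrix (Fin 2) (Fin 2) E) = vecMulVec y x + vecMulVec c d) :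
    x ⬝ᵥ y = 1 ∧ x ⬝ᵥ c = 0 ∧ d ⬝ᵥ y = 0 ∧ d ⬝ᵥ c = 1 := by
  have e : (Matrix.of fun i k => ![y i, c i] k) * (Matrix.of ![x, d]) = 1 := by
    rw [h]
    ext i j
    simp [mul_apply, vecMulVec_apply]
  rw [mul_eq_one_comm] at e
  have e' := fun i j => congrFun (congrFun e i) j
  refine ⟨?_, ?_, ?_, ?_⟩
  · simpa [mul_apply, dotProduct] using e' 0 0
  · simpa [mul_apply, dotProduct] using e' 0 1
  · simpa [mul_apply, dotProduct] using e' 1 0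
  · simpa [mul_apply, dotProduct] using e' 1 1

theorem RowInd.exists_eq {v t : Fin 2 → E} (h : RowInd v t) (w : Fin 2 → E) :
    ∃ a b : E, w = a • v + b • t := by
  obtain ⟨c, d, h1, h2, h3, h4⟩ := h
  refine ⟨w ⬝ᵥ c, w ⬝ᵥ d, ?_⟩
  have := congrArg (fun M => w ᵥ* M) (one_eq_of_dual h1 h3 h2 h4)
  simpa [vecMul_add, vecMul_vecMulVec] using this

theorem adjacent_one_of_dotProduct {x y : Fin 2 → E} (h : x ⬝ᵥ y = 1) :
    Adjacent 1 (vecMulVec y x) := by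
  have hx : x ≠ 0 := by rintro rfl; simp at h
  have hy : y ≠ 0 := by rintro rfl; simp at h
  obtain ⟨x', a, c, h1, h2, h3, h4⟩ := exists_rowInd hx
  have hc : c ≠ 0 := by rintro rfl; simp at h4
  rcases colInd_or_smul hy hc with ⟨e, d, -, -, h5, h6⟩ | ⟨k, hk, rfl⟩
  · rw [adjacent_iff_s10]
    refine ⟨c, d, hc, by rintro rfl; simp at h6, ?_⟩
    rw [one_eq_of_dual h h3 h5 h6, add_sub_cancel_left]
  · rw [dotProduct_op_smul', h] at h3
    simp [hk] at h3

/-- The summands of a decomposition of a rank two matrix as a sum of two rank one matrices. -/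
theorem decomposition_mul {p q : ℕ} {U : Matrix (Fin p) (Fin 2) E} {V : Matrix (Fin 2) (Fin q) E}
    {U' : Matrix (Fin 2) (Fin p) E} {V' : Matrix (Fin q) (Fin 2) E}
    (hU : U' * U = 1) (hV : V * V' = 1) {u s : Fin p → E} {v t : Fin q → E}
    (h : U * V = vecMulVec u v + vecMulVec s t) :
    (v ᵥ* V') ⬝ᵥ (U' *ᵥ u) = 1 ∧ (v ᵥ* V') ᵥ* V = v := by
  have e : (1 : Matrix (Fin 2) (Fin 2) E) =
      vecMulVec (U' *ᵥ u) (v ᵥ* V') + vecMulVec (U' *ᵥ s) (t ᵥ* V') := by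
    rw [← mul_vecMulVec, ← vecMulVec_mul, ← mul_vecMulVec, ← vecMulVec_mul, ← Matrix.mul_add,
      ← Matrix.add_mul, ← h, Matrix.mul_assoc U V V', hV, Matrix.mul_one, hU]
  obtain ⟨h1, h2, h3, h4⟩ := dual_of_one_eq e
  refine ⟨h1, ?_⟩
  have e2 : V = vecMulVec (U' *ᵥ u) v + vecMulVec (U' *ᵥ s) t := by
    rw [← mul_vecMulVec, ← mul_vecMulVec, ← Matrix.mul_add, ← h, ← Matrix.mul_assoc, hU,
      Matrix.one_mul]
  conv_lhs => rw [e2]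
  rw [vecMul_add, vecMul_vecMulVec, vecMul_vecMulVec, h1, h2]
  simp

/-- A family of pairwise adjacent-or-equal matrices containing zero lies in some `L(u)` or in
some `R(v)`. -/
theorem clique_subset {ι : Type*} {p q : ℕ} (S : ι → Matrix (Fin p) (Fin q) E)
    (hS0 : ∀ i, ∃ u v, S i = vecMulVec u v)
    (hS : ∀ i j, ∃ u v, S i - S j = vecMulVec u v) (hne : ∃ i, S i ≠ 0) :
    (∃ u ≠ 0, ∀ i, ∃ w, S i = vecMulVec u w) ∨ (∃ v ≠ 0, ∀ i, ∃ z, S i = vecMulVec z v) := by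
  obtain ⟨i, hi⟩ := hne
  obtain ⟨u, v, e⟩ := hS0 i
  have hu : u ≠ 0 := by rintro rfl; exact hi (by rw [e, zero_vecMulVec'])
  have hv : v ≠ 0 := by rintro rfl; exact hi (by rw [e, vecMulVec_zero'])
  by_cases hL : ∀ j, ∃ w, S j = vecMulVec u w
  · exact Or.inl ⟨u, hu, hL⟩
  right
  push Not at hL
  obtain ⟨j, hj⟩ := hL
  obtain ⟨u', v', e'⟩ := hS0 j
  have hu' : u' ≠ 0 := by rintro rfl; exact hj 0 (by rw [e', zero_vecMulVec', vecMulVec_zero'])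
  have hv' : v' ≠ 0 := by rintro rfl; exact hj 0 (by rw [e', vecMulVec_zero', vecMulVec_zero'])
  have huu : ColInd u u' := by
    refine (colInd_or_smul hu hu').resolve_right ?_
    rintro ⟨k, -, rfl⟩
    exact hj (k • v') (by rw [e', op_smul_vecMulVec'])
  have hdiff : ∀ (a b : Fin p → E) (c d : Fin q → E), ColInd a b → d ≠ 0 →
      (∃ s t, vecMulVec a c - vecMulVec b d = vecMulVec s t) → ∃ k : E, c = k • d := by
    rintro a b c d hab hd ⟨s, t, h⟩
    obtain ⟨k, l, rfl, hl⟩ := hab.rows_of_add (v := c) (t := -d) (a := s) (b := t)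
      (by rw [vecMulVec_neg, ← sub_eq_add_neg, h])
    have hl0 : l ≠ 0 := by rintro rfl; simp at hl; exact hd hl
    refine ⟨-(k * l⁻¹), ?_⟩
    rw [neg_smul, ← smul_neg, hl, smul_smul, mul_assoc, inv_mul_cancel₀ hl0, mul_one]
  obtain ⟨k, hk⟩ := hdiff u' u v' v huu.symm hv (by rw [← e, ← e']; exact hS j i)
  have hk0 : k ≠ 0 := by rintro rfl; simp at hk; exact hv' hk
  refine ⟨v, hv, fun l => ?_⟩
  obtain ⟨a, b, el⟩ := hS0 l
  by_cases ha : a = 0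
  · exact ⟨0, by rw [el, ha, zero_vecMulVec', zero_vecMulVec']⟩
  have fin : (∃ m : E, b = m • v) → ∃ z, S l = vecMulVec z v := by
    rintro ⟨m, rfl⟩
    exact ⟨MulOpposite.op m • a, by rw [el, op_smul_vecMulVec']⟩
  rcases colInd_or_smul hu ha with h | ⟨m, hm, rfl⟩
  · exact fin (hdiff a u b v h.symm hv (by rw [← e, ← el]; exact hS l i))
  · have h : ColInd (MulOpposite.op m • u) u' := by
      simpa using huu.smul hm one_ne_zero
    obtain ⟨n, hn⟩ := hdiff _ u' b v' h hv' (by rw [← e', ← el]; exact hS l j)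
    exact fin ⟨n * k, by rw [hn, hk, smul_smul]⟩

end Plane

section Classification

variable {K E : Type*} [DivisionRing K] [DivisionRing E]

/-- `φ` maps `L(y)` into `L(u)`. -/
def MapsLL {m n p q : ℕ} (φ : Matrix (Fin m) (Fin n) K → Matrix (Fin p) (Fin q) E)
    (y : Fin m → K) (u : Fin p → E) : Prop :=
  ∀ w, ∃ t, φ (vecMulVec y w) = vecMulVec u t

/-- `φ` maps `L(y)` into `R(v)`. -/
def MapsLR {m n p q : ℕ} (φ : Matrix (Fin m) (Fin n) K → Matrix (Fin p) (Fin q) E)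
    (y : Fin m → K) (v : Fin q → E) : Prop :=
  ∀ w, ∃ s, φ (vecMulVec y w) = vecMulVec s v

/-- `φ` maps `R(x)` into `L(u)`. -/
def MapsRL {m n p q : ℕ} (φ : Matrix (Fin m) (Fin n) K → Matrix (Fin p) (Fin q) E)
    (x : Fin n → K) (u : Fin p → E) : Prop :=
  ∀ z, ∃ t, φ (vecMulVec z x) = vecMulVec u t

/-- `φ` maps `R(x)` into `R(v)`. -/
def MapsRR {m n p q : ℕ} (φ : Matrix (Fin m) (Fin n) K → Matrix (Fin p) (Fin q) E)
    (x : Fin n → K) (v : Fin q → E) : Prop :=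
  ∀ z, ∃ s, φ (vecMulVec z x) = vecMulVec s v

/-- An adjacency preserver fixing the origin. -/
structure IsPreserver {m n p q : ℕ} (φ : Matrix (Fin m) (Fin n) K → Matrix (Fin p) (Fin q) E) :
    Prop where
  adj : ∀ A B, Adjacent A B → Adjacent (φ A) (φ B)
  zero : φ 0 = 0

/-- Every `L(y)` is mapped into some `L(u)` and every `R(x)` into some `R(v)`. -/
def TypeDirect {m n p q : ℕ} (φ : Matrix (Fin m) (Fin n) K → Matrix (Fin p) (Fin q) E) : Prop :=
  (∀ y, y ≠ 0 → ∃ u, u ≠ 0 ∧ MapsLL φ y u) ∧ (∀ x, x ≠ 0 → ∃ v, v ≠ 0 ∧ MapsRR φ x v)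

/-- Every `L(y)` is mapped into some `R(v)` and every `R(x)` into some `L(u)`. -/
def TypeSwap {m n p q : ℕ} (φ : Matrix (Fin m) (Fin n) K → Matrix (Fin p) (Fin q) E) : Prop :=
  (∀ y, y ≠ 0 → ∃ v, v ≠ 0 ∧ MapsLR φ y v) ∧ (∀ x, x ≠ 0 → ∃ u, u ≠ 0 ∧ MapsRL φ x u)

/-- All rank one matrices are mapped into a single `L(u)`. -/
def CollapseL {m n p q : ℕ} (φ : Matrix (Fin m) (Fin n) K → Matrix (Fin p) (Fin q) E) : Prop :=
  ∃ u, ∀ z w, ∃ t, φ (vecMulVec z w) = vecMulVec u t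

/-- All rank one matrices are mapped into a single `R(v)`. -/
def CollapseR {m n p q : ℕ} (φ : Matrix (Fin m) (Fin n) K → Matrix (Fin p) (Fin q) E) : Prop :=
  ∃ v, ∀ z w, ∃ s, φ (vecMulVec z w) = vecMulVec s v

theorem adjacent_vecMulVec_zero {m n : ℕ} {u : Fin m → K} {v : Fin n → K} (hu : u ≠ 0)
    (hv : v ≠ 0) : Adjacent (vecMulVec u v) 0 :=
  adjacent_iff_s10.mpr ⟨u, v, hu, hv, sub_zero _⟩

theorem adjacent_vecMulVec_left {m n : ℕ} {u : Fin m → K} {v w : Fin n → K} (hu : u ≠ 0)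
    (hv : v ≠ w) : Adjacent (vecMulVec u v) (vecMulVec u w) :=
  adjacent_iff_s10.mpr ⟨u, v - w, hu, sub_ne_zero.mpr hv, by rw [vecMulVec_sub]⟩

theorem adjacent_vecMulVec_right {m n : ℕ} {u s : Fin m → K} {v : Fin n → K} (hv : v ≠ 0)
    (hu : u ≠ s) : Adjacent (vecMulVec u v) (vecMulVec s v) :=
  adjacent_iff_s10.mpr ⟨u - s, v, sub_ne_zero.mpr hu, hv, by rw [sub_vecMulVec]⟩

theorem Adjacent.ne {m n : ℕ} {A B : Matrix (Fin m) (Fin n) K} (h : Adjacent A B) : A ≠ B := by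
  rintro rfl
  obtain ⟨u, v, hu, hv, h⟩ := adjacent_iff_s10.mp h
  rw [sub_self, eq_comm, vecMulVec_eq_zero'] at h
  tauto

variable {m n p q : ℕ} {φ : Matrix (Fin m) (Fin n) K → Matrix (Fin p) (Fin q) E}

theorem IsPreserver.map_ne_zero (hφ : IsPreserver φ) {y : Fin m → K} {w : Fin n → K}
    (hy : y ≠ 0) (hw : w ≠ 0) : φ (vecMulVec y w) ≠ 0 := by
  have := (hφ.adj _ _ (adjacent_vecMulVec_zero hy hw)).ne
  rwa [hφ.zero] at this

theorem IsPreserver.map_vecMulVec (hφ : IsPreserver φ) (y : Fin m → K) (w : Fin n → K) :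
    ∃ u v, φ (vecMulVec y w) = vecMulVec u v := by
  by_cases hy : y = 0
  · exact ⟨0, 0, by rw [hy, zero_vecMulVec', hφ.zero, zero_vecMulVec']⟩
  by_cases hw : w = 0
  · exact ⟨0, 0, by rw [hw, vecMulVec_zero', hφ.zero, zero_vecMulVec']⟩
  have := hφ.adj _ _ (adjacent_vecMulVec_zero hy hw)
  obtain ⟨u, v, -, -, h⟩ := adjacent_iff_s10.mp this
  exact ⟨u, v, by rw [← h, hφ.zero, sub_zero]⟩

theorem IsPreserver.left_cases (hφ : IsPreserver φ) (hn : 0 < n) {y : Fin m → K} (hy : y ≠ 0) :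
    (∃ u, u ≠ 0 ∧ MapsLL φ y u) ∨ (∃ v, v ≠ 0 ∧ MapsLR φ y v) := by
  refine (clique_subset (fun w => φ (vecMulVec y w)) (fun w => hφ.map_vecMulVec y w) ?_ ?_)
  · intro w w'
    by_cases h : w = w'
    · exact ⟨0, 0, by rw [h, sub_self, zero_vecMulVec']⟩
    obtain ⟨u, v, -, -, h⟩ := adjacent_iff_s10.mp (hφ.adj _ _ (adjacent_vecMulVec_left hy h))
    exact ⟨u, v, h⟩
  · refine ⟨Pi.single ⟨0, hn⟩ 1, hφ.map_ne_zero hy ?_⟩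
    simp

theorem IsPreserver.right_cases (hφ : IsPreserver φ) (hm : 0 < m) {x : Fin n → K} (hx : x ≠ 0) :
    (∃ u, u ≠ 0 ∧ MapsRL φ x u) ∨ (∃ v, v ≠ 0 ∧ MapsRR φ x v) := by
  refine (clique_subset (fun w => φ (vecMulVec w x)) (fun w => hφ.map_vecMulVec w x) ?_ ?_)
  · intro w w'
    by_cases h : w = w'
    · exact ⟨0, 0, by rw [h, sub_self, zero_vecMulVec']⟩
    obtain ⟨u, v, -, -, h⟩ := adjacent_iff_s10.mp (hφ.adj _ _ (adjacent_vecMulVec_right hx h))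
    exact ⟨u, v, h⟩
  · refine ⟨Pi.single ⟨0, hm⟩ 1, hφ.map_ne_zero ?_ hx⟩
    simp

theorem MapsLL.of_smul {y : Fin m → K} {u : Fin p → E} {k : E}
    (h : MapsLL φ y (MulOpposite.op k • u)) : MapsLL φ y u := fun w => by
  obtain ⟨t, ht⟩ := h w
  exact ⟨k • t, by rw [ht, op_smul_vecMulVec']⟩

theorem MapsRL.of_smul {x : Fin n → K} {u : Fin p → E} {k : E}
    (h : MapsRL φ x (MulOpposite.op k • u)) : MapsRL φ x u := fun w => by
  obtain ⟨t, ht⟩ := h w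
  exact ⟨k • t, by rw [ht, op_smul_vecMulVec']⟩

theorem MapsLR.of_smul {y : Fin m → K} {v : Fin q → E} {k : E}
    (h : MapsLR φ y (k • v)) : MapsLR φ y v := fun w => by
  obtain ⟨t, ht⟩ := h w
  exact ⟨MulOpposite.op k • t, by rw [ht, op_smul_vecMulVec']⟩

theorem MapsRR.of_smul {x : Fin n → K} {v : Fin q → E} {k : E}
    (h : MapsRR φ x (k • v)) : MapsRR φ x v := fun w => by
  obtain ⟨t, ht⟩ := h w
  exact ⟨MulOpposite.op k • t, by rw [ht, op_smul_vecMulVec']⟩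

/-- A common nonzero value of `L(u)` and `L(u')` forces `u` and `u'` to be proportional. -/
theorem not_colInd_of_mem (hφ : IsPreserver φ) {y : Fin m → K} {x : Fin n → K} (hy : y ≠ 0)
    (hx : x ≠ 0) {u u' : Fin p → E} (h : ∃ t, φ (vecMulVec y x) = vecMulVec u t)
    (h' : ∃ t, φ (vecMulVec y x) = vecMulVec u' t) : ¬ ColInd u u' := by
  intro hi
  obtain ⟨t, ht⟩ := h
  obtain ⟨t', ht'⟩ := h'
  have := hi.eq_zero_of_eq (ht.symm.trans ht')
  exact hφ.map_ne_zero hy hx (by rw [ht, this.1, vecMulVec_zero'])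

theorem not_rowInd_of_mem (hφ : IsPreserver φ) {y : Fin m → K} {x : Fin n → K} (hy : y ≠ 0)
    (hx : x ≠ 0) {v v' : Fin q → E} (h : ∃ t, φ (vecMulVec y x) = vecMulVec t v)
    (h' : ∃ t, φ (vecMulVec y x) = vecMulVec t v') : ¬ RowInd v v' := by
  intro hi
  obtain ⟨t, ht⟩ := h
  obtain ⟨t', ht'⟩ := h'
  have := hi.eq_zero_of_eq (ht.symm.trans ht')
  exact hφ.map_ne_zero hy hx (by rw [ht, this.1, zero_vecMulVec'])

theorem not_colInd_mem_both (hφ : IsPreserver φ) {y y' : Fin m → K} {x x' : Fin n → K}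
    (hy : y ≠ 0) (hy' : y' ≠ 0) (hx : x ≠ 0) (hx' : x' ≠ 0) {u u' u₀ : Fin p → E} (hu₀ : u₀ ≠ 0)
    (hi : ColInd u u') (h : ∃ t, φ (vecMulVec y x) = vecMulVec u t)
    (h' : ∃ t, φ (vecMulVec y' x') = vecMulVec u' t)
    (h₀ : ∃ t, φ (vecMulVec y x) = vecMulVec u₀ t)
    (h₀' : ∃ t, φ (vecMulVec y' x') = vecMulVec u₀ t) : False := by
  obtain ⟨k, hk, rfl⟩ := (colInd_or_smul hu₀ hi.ne_zero).resolve_left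
    (not_colInd_of_mem hφ hy hx h₀ h)
  obtain ⟨l, hl, rfl⟩ := (colInd_or_smul hu₀ hi.symm.ne_zero).resolve_left
    (not_colInd_of_mem hφ hy' hx' h₀' h')
  exact hi.not_smul (k⁻¹ * l) (by simp [smul_smul, ← MulOpposite.op_mul, hk])

theorem not_rowInd_mem_both (hφ : IsPreserver φ) {y y' : Fin m → K} {x x' : Fin n → K}
    (hy : y ≠ 0) (hy' : y' ≠ 0) (hx : x ≠ 0) (hx' : x' ≠ 0) {v v' v₀ : Fin q → E} (hv₀ : v₀ ≠ 0)
    (hi : RowInd v v') (h : ∃ t, φ (vecMulVec y x) = vecMulVec t v)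
    (h' : ∃ t, φ (vecMulVec y' x') = vecMulVec t v')
    (h₀ : ∃ t, φ (vecMulVec y x) = vecMulVec t v₀)
    (h₀' : ∃ t, φ (vecMulVec y' x') = vecMulVec t v₀) : False := by
  obtain ⟨k, hk, rfl⟩ := (rowInd_or_smul hv₀ hi.ne_zero).resolve_left
    (not_rowInd_of_mem hφ hy hx h₀ h)
  obtain ⟨l, hl, rfl⟩ := (rowInd_or_smul hv₀ hi.symm.ne_zero).resolve_left
    (not_rowInd_of_mem hφ hy' hx' h₀' h')
  exact hi.not_smul (l * k⁻¹) (by simp [smul_smul, hk])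

end Classification

section Trichotomy

variable {K E : Type*} [DivisionRing K] [DivisionRing E]

/-- `M` lies in `L(u)` and in `R(v)`. -/
def MemBoth {p q : ℕ} (u : Fin p → E) (v : Fin q → E) (M : Matrix (Fin p) (Fin q) E) : Prop :=
  (∃ t, M = vecMulVec u t) ∧ ∃ s, M = vecMulVec s v

theorem MemBoth.exists_smul {p q : ℕ} {u : Fin p → E} {v : Fin q → E}
    {M : Matrix (Fin p) (Fin q) E} (hu : u ≠ 0) (hv : v ≠ 0) (h : MemBoth u v M) :
    ∃ k : E, M = vecMulVec u (k • v) := by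
  obtain ⟨⟨t, ht⟩, s, hs⟩ := h
  obtain ⟨k, rfl⟩ := eq_smul_of_vecMulVec_eq hu hv (ht.symm.trans hs)
  exact ⟨k, ht⟩

variable {p q : ℕ} {φ : Matrix (Fin 2) (Fin 2) K → Matrix (Fin p) (Fin q) E}

/-- Two rank one idempotents mapped into `L(u) ∩ R(v)` have the same image. -/
theorem IsPreserver.idem_eq (hφ : IsPreserver φ) (h1 : RankTwo (φ 1)) {x y x' y' : Fin 2 → K}
    (hxy : x ⬝ᵥ y = 1) (hxy' : x' ⬝ᵥ y' = 1) {u : Fin p → E} {v : Fin q → E} (hu : u ≠ 0)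
    (hv : v ≠ 0) (h : MemBoth u v (φ (vecMulVec y x))) (h' : MemBoth u v (φ (vecMulVec y' x'))) :
    φ (vecMulVec y x) = φ (vecMulVec y' x') := by
  obtain ⟨U, V, U', V', hU, hV, e1⟩ := h1
  have key : ∀ {x y : Fin 2 → K} {k : E}, x ⬝ᵥ y = 1 →
      φ (vecMulVec y x) = vecMulVec u (k • v) → k * ((v ᵥ* V') ⬝ᵥ (U' *ᵥ u)) = 1 := by
    intro x y k hxy e
    obtain ⟨s, t, -, -, hst⟩ := adjacent_iff_s10.mp (hφ.adj _ _ (adjacent_one_of_dotProduct hxy))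
    have := (decomposition_mul hU hV (u := u) (v := k • v) (s := s) (t := t)
      (by rw [← e, ← hst, ← e1, add_sub_cancel])).1
    rwa [smul_vecMul, smul_dotProduct, smul_eq_mul] at this
  obtain ⟨k, hk⟩ := h.exists_smul hu hv
  obtain ⟨k', hk'⟩ := h'.exists_smul hu hv
  rw [hk, hk', eq_inv_of_mul_eq_one_left (key hxy hk), eq_inv_of_mul_eq_one_left (key hxy' hk')]

theorem IsPreserver.idem_false (hφ : IsPreserver φ) (h1 : RankTwo (φ 1)) {x y x' y' : Fin 2 → K}
    (hxy : x ⬝ᵥ y = 1) (hxy' : x' ⬝ᵥ y' = 1) {u : Fin p → E} {v : Fin q → E} (hu : u ≠ 0)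
    (hv : v ≠ 0) (h : MemBoth u v (φ (vecMulVec y x))) (h' : MemBoth u v (φ (vecMulVec y' x')))
    (ha : Adjacent (vecMulVec y x) (vecMulVec y' x')) : False :=
  (hφ.adj _ _ ha).ne (hφ.idem_eq h1 hxy hxy' hu hv h h')

theorem IsPreserver.not_mapsLL_mapsLR (hφ : IsPreserver φ) (h1 : RankTwo (φ 1)) {y : Fin 2 → K}
    (hy : y ≠ 0) {u : Fin p → E} {v : Fin q → E} (hu : u ≠ 0) (hv : v ≠ 0)
    (h : MapsLL φ y u) (h' : MapsLR φ y v) : False := by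
  obtain ⟨y', x, d, hx, hx', hd, hd'⟩ := exists_colInd hy
  refine hφ.idem_false h1 hx (x' := x + d) (y' := y) ?_ hu hv ⟨h _, h' _⟩ ⟨h _, h' _⟩
    (adjacent_vecMulVec_left hy ?_)
  · rw [add_dotProduct, hx, hd, add_zero]
  · intro e
    have : d = 0 := by simpa using e
    simp [this] at hd'

theorem IsPreserver.not_mapsRL_mapsRR (hφ : IsPreserver φ) (h1 : RankTwo (φ 1)) {x : Fin 2 → K}
    (hx : x ≠ 0) {u : Fin p → E} {v : Fin q → E} (hu : u ≠ 0) (hv : v ≠ 0)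
    (h : MapsRL φ x u) (h' : MapsRR φ x v) : False := by
  obtain ⟨x', y, d, hy, hy', hd, hd'⟩ := exists_rowInd hx
  refine hφ.idem_false h1 hy (y' := y + d) (x' := x) ?_ hu hv ⟨h _, h' _⟩ ⟨h _, h' _⟩
    (adjacent_vecMulVec_right hx ?_)
  · rw [dotProduct_add, hy, hd, add_zero]
  · intro e
    have : d = 0 := by simpa using e
    simp [this] at hd'

theorem IsPreserver.direct_or_collapse (hφ : IsPreserver φ) {y y' : Fin 2 → K} (hy : y ≠ 0)
    (hy' : y' ≠ 0) {u u' : Fin p → E} (hu : ColInd u u') (h : MapsLL φ y u)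
    (h' : MapsLL φ y' u') : TypeDirect φ ∨ CollapseR φ := by
  have hR : ∀ x, x ≠ 0 → ∃ v, v ≠ 0 ∧ MapsRR φ x v := fun x hx => by
    refine (hφ.right_cases two_pos hx).resolve_left ?_
    rintro ⟨u₀, hu₀, h₀⟩
    exact not_colInd_mem_both hφ hy hy' hx hx hu₀ hu (h x) (h' x) (h₀ y) (h₀ y')
  by_cases hv : ∃ x x' v v', x ≠ 0 ∧ x' ≠ 0 ∧ MapsRR φ x v ∧ MapsRR φ x' v' ∧ RowInd v v'
  · obtain ⟨x, x', v, v', hx, hx', hxv, hxv', hi⟩ := hv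
    refine Or.inl ⟨fun z hz => (hφ.left_cases two_pos hz).resolve_right ?_, hR⟩
    rintro ⟨v₀, hv₀, h₀⟩
    exact not_rowInd_mem_both hφ hz hz hx hx' hv₀ hi (hxv z) (hxv' z) (h₀ x) (h₀ x')
  · right
    have hx0 : (![1, 0] : Fin 2 → K) ≠ 0 := fun e => by simpa using congrFun e 0
    obtain ⟨v, hv0, hv1⟩ := hR _ hx0
    refine ⟨v, fun z w => ?_⟩
    by_cases hw : w = 0
    · exact ⟨0, by rw [hw, vecMulVec_zero', hφ.zero, zero_vecMulVec']⟩
    obtain ⟨v', hv0', hv1'⟩ := hR w hw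
    obtain ⟨k, -, rfl⟩ := (rowInd_or_smul hv0 hv0').resolve_left
      (fun hi => hv ⟨_, _, _, _, hx0, hw, hv1, hv1', hi⟩)
    exact hv1'.of_smul z

theorem IsPreserver.swap_or_collapse (hφ : IsPreserver φ) {y y' : Fin 2 → K} (hy : y ≠ 0)
    (hy' : y' ≠ 0) {v v' : Fin q → E} (hv : RowInd v v') (h : MapsLR φ y v)
    (h' : MapsLR φ y' v') : TypeSwap φ ∨ CollapseL φ := by
  have hR : ∀ x, x ≠ 0 → ∃ u, u ≠ 0 ∧ MapsRL φ x u := fun x hx => by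
    refine (hφ.right_cases two_pos hx).resolve_right ?_
    rintro ⟨v₀, hv₀, h₀⟩
    exact not_rowInd_mem_both hφ hy hy' hx hx hv₀ hv (h x) (h' x) (h₀ y) (h₀ y')
  by_cases hu : ∃ x x' u u', x ≠ 0 ∧ x' ≠ 0 ∧ MapsRL φ x u ∧ MapsRL φ x' u' ∧ ColInd u u'
  · obtain ⟨x, x', u, u', hx, hx', hxu, hxu', hi⟩ := hu
    refine Or.inl ⟨fun z hz => (hφ.left_cases two_pos hz).resolve_left ?_, hR⟩
    rintro ⟨u₀, hu₀, h₀⟩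
    exact not_colInd_mem_both hφ hz hz hx hx' hu₀ hi (hxu z) (hxu' z) (h₀ x) (h₀ x')
  · right
    have hx0 : (![1, 0] : Fin 2 → K) ≠ 0 := fun e => by simpa using congrFun e 0
    obtain ⟨u, hu0, hu1⟩ := hR _ hx0
    refine ⟨u, fun z w => ?_⟩
    by_cases hw : w = 0
    · exact ⟨0, by rw [hw, vecMulVec_zero', hφ.zero, vecMulVec_zero']⟩
    obtain ⟨u', hu0', hu1'⟩ := hR w hw
    obtain ⟨k, -, rfl⟩ := (colInd_or_smul hu0 hu0').resolve_left
      (fun hi => hu ⟨_, _, _, _, hx0, hw, hu1, hu1', hi⟩)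
    exact hu1'.of_smul z

/-- Two independent rows cannot both be mapped from `L(y)` into `L(u) ∩ R(v)`. -/
theorem IsPreserver.not_memBoth (hφ : IsPreserver φ) (h1 : RankTwo (φ 1)) (e : K ≃ E)
    {y x x' : Fin 2 → K} (hy : y ≠ 0) (hx : RowInd x x') {u : Fin p → E} {v : Fin q → E}
    (hu : u ≠ 0) (hv : v ≠ 0) (h : ∀ d : K, MemBoth u v (φ (vecMulVec y (d • x))))
    (h' : ∀ d : K, MemBoth u v (φ (vecMulVec y (d • x'))))
    (hK : Finite K ∨ x ⬝ᵥ y ≠ 0 ∧ x' ⬝ᵥ y ≠ 0) : False := by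
  rcases hK with hK | ⟨hxy, hxy'⟩
  · choose k hk using fun d => (h d).exists_smul hu hv
    obtain ⟨k', hk'⟩ := (h' 1).exists_smul hu hv
    have hinj : Function.Injective k := by
      intro a b hab
      by_contra hne
      refine (hφ.adj _ _ (adjacent_vecMulVec_left hy (v := a • x) (w := b • x) ?_)).ne
        (by rw [hk, hk, hab])
      intro h
      exact hne ((smul_left_injective K hx.ne_zero) h)
    obtain ⟨d, rfl⟩ := (Finite.injective_iff_surjective_of_equiv e).mp hinj k'
    refine (hφ.adj _ _ (adjacent_vecMulVec_left hy (v := d • x) (w := (1 : K) • x') ?_)).ne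
      (by rw [hk, hk'])
    rw [one_smul]
    exact fun h => hx.not_smul d h.symm
  · refine hφ.idem_false h1 (x := (x ⬝ᵥ y)⁻¹ • x) (x' := (x' ⬝ᵥ y)⁻¹ • x') (y := y) (y' := y)
      ?_ ?_ hu hv (h _) (h' _) (adjacent_vecMulVec_left hy ?_)
    · rw [smul_dotProduct, smul_eq_mul, inv_mul_cancel₀ hxy]
    · rw [smul_dotProduct, smul_eq_mul, inv_mul_cancel₀ hxy']
    · intro h
      refine hx.not_smul ((x' ⬝ᵥ y) * (x ⬝ᵥ y)⁻¹) ?_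
      rw [mul_smul, h, smul_smul, mul_inv_cancel₀ hxy', one_smul]

theorem rowInd_cons_one {a b : K} (h : a ≠ b) : RowInd ![1, a] ![1, b] := by
  refine (rowInd_or_smul (fun e => by simpa using congrFun e 0)
    (fun e => by simpa using congrFun e 0)).resolve_right ?_
  rintro ⟨k, -, e⟩
  have e0 := congrFun e 0
  have e1 := congrFun e 1
  simp only [Pi.smul_apply, cons_val_zero, cons_val_one, smul_eq_mul, mul_one] at e0 e1
  rw [← e0, one_mul] at e1
  exact h e1.symm

/-- The mixed configuration is impossible. -/
theorem IsPreserver.not_mixed (hφ : IsPreserver φ) (h1 : RankTwo (φ 1)) (e : K ≃ E)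
    {y₀ y₁ : Fin 2 → K} (hy₀ : y₀ ≠ 0) (hy₁ : y₁ ≠ 0) {u : Fin p → E} {v : Fin q → E}
    (hu : u ≠ 0) (hv : v ≠ 0) (h₀ : MapsLL φ y₀ u) (h₁ : MapsLR φ y₁ v)
    (hR : ∀ x, x ≠ 0 → MapsRL φ x u ∨ MapsRR φ x v) : False := by
  have hop : ∀ (y x : Fin 2 → K) (d : K),
      vecMulVec y (d • x) = vecMulVec (MulOpposite.op d • y) x := fun y x d => by
    rw [op_smul_vecMulVec']
  have hRL : ∀ x x', RowInd x x' → MapsRL φ x u → MapsRL φ x' u →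
      (Finite K ∨ x ⬝ᵥ y₁ ≠ 0 ∧ x' ⬝ᵥ y₁ ≠ 0) → False := fun x x' hi h h' hK =>
    hφ.not_memBoth h1 e hy₁ hi hu hv (fun d => ⟨by rw [hop]; exact h _, h₁ _⟩)
      (fun d => ⟨by rw [hop]; exact h' _, h₁ _⟩) hK
  have hRR : ∀ x x', RowInd x x' → MapsRR φ x v → MapsRR φ x' v →
      (Finite K ∨ x ⬝ᵥ y₀ ≠ 0 ∧ x' ⬝ᵥ y₀ ≠ 0) → False := fun x x' hi h h' hK =>
    hφ.not_memBoth h1 e hy₀ hi hu hv (fun d => ⟨h₀ _, by rw [hop]; exact h _⟩)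
      (fun d => ⟨h₀ _, by rw [hop]; exact h' _⟩) hK
  have hne : ∀ a : K, (![1, a] : Fin 2 → K) ≠ 0 := fun a e => by simpa using congrFun e 0
  rcases finite_or_infinite K with hK | hK
  · have i1 : RowInd (![1, 0] : Fin 2 → K) ![1, 1] := rowInd_cons_one zero_ne_one
    have i2 : RowInd (![1, 0] : Fin 2 → K) ![0, 1] := by
      refine ⟨![1, 0], ![0, 1], ?_, ?_, ?_, ?_⟩ <;> simp
    have i3 : RowInd (![1, 1] : Fin 2 → K) ![0, 1] := by
      refine ⟨![1, 0], ![-1, 1], ?_, ?_, ?_, ?_⟩ <;> simp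
    rcases hR _ i1.ne_zero with a | a <;> rcases hR _ i3.ne_zero with b | b <;>
      rcases hR _ i2.symm.ne_zero with c | c
    · exact hRL _ _ i1 a b (Or.inl hK)
    · exact hRL _ _ i1 a b (Or.inl hK)
    · exact hRL _ _ i2 a c (Or.inl hK)
    · exact hRR _ _ i3 b c (Or.inl hK)
    · exact hRL _ _ i3 b c (Or.inl hK)
    · exact hRR _ _ i2 a c (Or.inl hK)
    · exact hRR _ _ i1 a b (Or.inl hK)
    · exact hRR _ _ i1 a b (Or.inl hK)
  · have hfin : ∀ y : Fin 2 → K, y ≠ 0 → {a : K | ![1, a] ⬝ᵥ y = 0}.Finite := by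
      intro y hy
      refine Set.Subsingleton.finite ?_
      intro a ha b hb
      by_contra hab
      obtain ⟨c, d, h1, h2, h3, h4⟩ := rowInd_cons_one hab
      have := congrArg (fun M => M *ᵥ y) (one_eq_of_dual h1 h3 h2 h4)
      simp only [one_mulVec, add_mulVec, vecMulVec_mulVec] at this
      rw [ha, hb] at this
      simp at this
      exact hy this
    have huniv : {a : K | MapsRL φ ![1, a] u} ∪ {a : K | MapsRR φ ![1, a] v} = Set.univ :=
      Set.eq_univ_of_forall fun a => hR _ (hne a)
    rcases Set.infinite_union.mp (huniv ▸ Set.infinite_univ) with hi | hi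
    · obtain ⟨a, ha, b, hb, hab⟩ := (hi.sdiff (hfin y₁ hy₁)).nontrivial
      exact hRL _ _ (rowInd_cons_one hab) ha.1 hb.1 (Or.inr ⟨ha.2, hb.2⟩)
    · obtain ⟨a, ha, b, hb, hab⟩ := (hi.sdiff (hfin y₀ hy₀)).nontrivial
      exact hRR _ _ (rowInd_cons_one hab) ha.1 hb.1 (Or.inr ⟨ha.2, hb.2⟩)

/-- The possible shapes of an adjacency preserver on rank one matrices. -/
theorem IsPreserver.classification (hφ : IsPreserver φ) (h1 : RankTwo (φ 1)) (e : K ≃ E) :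
    TypeDirect φ ∨ TypeSwap φ ∨ CollapseL φ ∨ CollapseR φ := by
  by_cases hA : ∃ y y' u u', y ≠ 0 ∧ y' ≠ 0 ∧ MapsLL φ y u ∧ MapsLL φ y' u' ∧ ColInd u u'
  · obtain ⟨y, y', u, u', hy, hy', h, h', hi⟩ := hA
    rcases hφ.direct_or_collapse hy hy' hi h h' with h | h <;> tauto
  by_cases hB : ∃ y y' v v', y ≠ 0 ∧ y' ≠ 0 ∧ MapsLR φ y v ∧ MapsLR φ y' v' ∧ RowInd v v'
  · obtain ⟨y, y', u, u', hy, hy', h, h', hi⟩ := hB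
    rcases hφ.swap_or_collapse hy hy' hi h h' with h | h <;> tauto
  have hA' : ∀ y₀ u₀, y₀ ≠ 0 → u₀ ≠ 0 → MapsLL φ y₀ u₀ → ∀ y u, y ≠ 0 → u ≠ 0 → MapsLL φ y u →
      MapsLL φ y u₀ := by
    intro y₀ u₀ hy₀ hu₀ h₀ y u hy hu h
    obtain ⟨k, -, rfl⟩ := (colInd_or_smul hu₀ hu).resolve_left
      (fun hi => hA ⟨_, _, _, _, hy₀, hy, h₀, h, hi⟩)
    exact h.of_smul
  have hB' : ∀ y₀ v₀, y₀ ≠ 0 → v₀ ≠ 0 → MapsLR φ y₀ v₀ → ∀ y v, y ≠ 0 → v ≠ 0 → MapsLR φ y v →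
      MapsLR φ y v₀ := by
    intro y₀ v₀ hy₀ hv₀ h₀ y v hy hv h
    obtain ⟨k, -, rfl⟩ := (rowInd_or_smul hv₀ hv).resolve_left
      (fun hi => hB ⟨_, _, _, _, hy₀, hy, h₀, h, hi⟩)
    exact h.of_smul
  have hy0 : (![1, 0] : Fin 2 → K) ≠ 0 := fun e => by simpa using congrFun e 0
  by_cases hL : ∃ y₀ u₀, y₀ ≠ 0 ∧ u₀ ≠ 0 ∧ MapsLL φ y₀ u₀
  · obtain ⟨y₀, u₀, hy₀, hu₀, h₀⟩ := hL
    by_cases hR : ∃ y₁ v₁, y₁ ≠ 0 ∧ v₁ ≠ 0 ∧ MapsLR φ y₁ v₁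
    · obtain ⟨y₁, v₁, hy₁, hv₁, h₁⟩ := hR
      exfalso
      refine hφ.not_mixed h1 e hy₀ hy₁ hu₀ hv₁ h₀ h₁ fun x hx => ?_
      rcases hφ.right_cases two_pos hx with ⟨u, hu, h⟩ | ⟨v, hv, h⟩
      · left
        obtain ⟨k, -, rfl⟩ := (colInd_or_smul hu₀ hu).resolve_left
          (not_colInd_of_mem hφ hy₀ hx (h₀ x) (h y₀))
        exact h.of_smul
      · right
        obtain ⟨k, -, rfl⟩ := (rowInd_or_smul hv₁ hv).resolve_left
          (not_rowInd_of_mem hφ hy₁ hx (h₁ x) (h y₁))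
        exact h.of_smul
    · refine Or.inr (Or.inr (Or.inl ⟨u₀, fun z w => ?_⟩))
      by_cases hz : z = 0
      · exact ⟨0, by rw [hz, zero_vecMulVec', hφ.zero, vecMulVec_zero']⟩
      rcases hφ.left_cases two_pos hz with ⟨u, hu, h⟩ | ⟨v, hv, h⟩
      · exact hA' _ _ hy₀ hu₀ h₀ _ _ hz hu h w
      · exact absurd ⟨_, _, hz, hv, h⟩ hR
  · obtain ⟨v₀, hv₀, h₀⟩ := (hφ.left_cases two_pos hy0).resolve_left
      (fun ⟨u, hu, h⟩ => hL ⟨_, _, hy0, hu, h⟩)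
    refine Or.inr (Or.inr (Or.inr ⟨v₀, fun z w => ?_⟩))
    by_cases hz : z = 0
    · exact ⟨0, by rw [hz, zero_vecMulVec', hφ.zero, zero_vecMulVec']⟩
    rcases hφ.left_cases two_pos hz with ⟨u, hu, h⟩ | ⟨v, hv, h⟩
    · exact absurd ⟨_, _, hz, hu, h⟩ hL
    · exact hB' _ _ hy0 hv₀ h₀ _ _ hz hv h w

end Trichotomy

section Regular

variable {K E : Type*} [DivisionRing K] [DivisionRing E] {p q : ℕ}

/-- A preserver mapping lines to lines of the same kind, faithfully on directions. -/
structure RegularMap (φ : Matrix (Fin 2) (Fin 2) K → Matrix (Fin p) (Fin q) E) : Prop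
    extends IsPreserver φ where
  direct : TypeDirect φ
  left_ind : ∀ {y y' u u'}, ColInd y y' → u ≠ 0 → u' ≠ 0 → MapsLL φ y u → MapsLL φ y' u' →
    ColInd u u'
  right_ind : ∀ {x x' v v'}, RowInd x x' → v ≠ 0 → v' ≠ 0 → MapsRR φ x v → MapsRR φ x' v' →
    RowInd v v'
  span : ∀ {x x' z v v' w}, RowInd x x' → z ≠ 0 → v ≠ 0 → v' ≠ 0 → w ≠ 0 →
    MapsRR φ x v → MapsRR φ x' v' → MapsRR φ z w → ∃ a b : E, w = a • v + b • v'

variable {φ : Matrix (Fin 2) (Fin 2) K → Matrix (Fin p) (Fin q) E}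

theorem IsPreserver.regularMap_of_direct (hφ : IsPreserver φ) (h1 : RankTwo (φ 1))
    (hd : TypeDirect φ) : RegularMap φ := by
  have hright : ∀ {x x' v v'}, RowInd x x' → v ≠ 0 → v' ≠ 0 → MapsRR φ x v → MapsRR φ x' v' →
      RowInd v v' := by
    intro x x' v v' hi hv hv' h h'
    refine (rowInd_or_smul hv hv').resolve_right ?_
    rintro ⟨k, hk, rfl⟩
    have hxx : x ≠ x' := fun e => hi.not_smul 1 (by rw [one_smul, e])
    have hx := hi.ne_zero
    have hx' := hi.symm.ne_zero
    obtain ⟨c, d, h3, h4, h5, h6⟩ := hi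
    have hxc : x ⬝ᵥ (c + d) = 1 := by rw [dotProduct_add, h3, h5, add_zero]
    have hxc' : x' ⬝ᵥ (c + d) = 1 := by rw [dotProduct_add, h4, h6, zero_add]
    have hcd : c + d ≠ 0 := fun e => by simp [e] at hxc
    obtain ⟨u, hu, hLL⟩ := hd.1 _ hcd
    exact hφ.idem_false h1 hxc hxc' hu hv ⟨hLL _, h _⟩ ⟨hLL _, h'.of_smul _⟩
      (adjacent_vecMulVec_left hcd hxx)
  refine ⟨hφ, hd, ?_, hright, ?_⟩
  · intro y y' u u' hi hu hu' h h'
    refine (colInd_or_smul hu hu').resolve_right ?_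
    rintro ⟨k, hk, rfl⟩
    have hyy : y ≠ y' := fun e => hi.not_smul 1 (by simp [e])
    obtain ⟨c, d, h3, h4, h5, h6⟩ := hi
    have hcy : (c + d) ⬝ᵥ y = 1 := by rw [add_dotProduct, h3, h5, add_zero]
    have hcy' : (c + d) ⬝ᵥ y' = 1 := by rw [add_dotProduct, h4, h6, zero_add]
    have hcd : c + d ≠ 0 := fun e => by simp [e] at hcy
    obtain ⟨v, hv, hRR⟩ := hd.2 _ hcd
    exact hφ.idem_false h1 hcy hcy' hu hv ⟨h _, hRR _⟩ ⟨h'.of_smul _, hRR _⟩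
      (adjacent_vecMulVec_right hcd hyy)
  · intro x x' z v v' w hi hz hv hv' hw h h' hzw
    have hind := hright hi hv hv' h h'
    obtain ⟨U, V, U', V', hU, hV, e1⟩ := h1
    have key : ∀ x v, x ≠ 0 → MapsRR φ x v → (v ᵥ* V') ᵥ* V = v := by
      intro x v hx h
      obtain ⟨y, hy⟩ := exists_dotProduct_eq_one hx
      obtain ⟨s, t, -, -, hst⟩ := adjacent_iff_s10.mp (hφ.adj _ _ (adjacent_one_of_dotProduct hy))
      obtain ⟨s', hs'⟩ := h y
      exact (decomposition_mul hU hV (u := s') (s := s) (t := t)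
        (by rw [← hs', ← hst, ← e1, add_sub_cancel])).2
    have e := key x v hi.ne_zero h
    have e' := key x' v' hi.symm.ne_zero h'
    have ez := key z w hz hzw
    have ha : v ᵥ* V' ≠ 0 := fun h0 => hv (by rw [← e, h0, zero_vecMul])
    have ha' : v' ᵥ* V' ≠ 0 := fun h0 => hv' (by rw [← e', h0, zero_vecMul])
    have hi' : RowInd (v ᵥ* V') (v' ᵥ* V') := by
      refine (rowInd_or_smul ha ha').resolve_right ?_
      rintro ⟨k, -, hk⟩
      exact hind.not_smul k (by rw [← e', hk, smul_vecMul, e])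
    obtain ⟨a, b, hab⟩ := hi'.exists_eq (w ᵥ* V')
    exact ⟨a, b, by rw [← ez, hab, add_vecMul, smul_vecMul, smul_vecMul, e, e']⟩

theorem vecMul_ne_zero_of_mul_eq_one {A B : Matrix (Fin 2) (Fin 2) K} (h : A * B = 1)
    {v : Fin 2 → K} (hv : v ≠ 0) : v ᵥ* A ≠ 0 := fun e =>
  hv (by rw [← vecMul_one v, ← h, ← vecMul_vecMul, e, zero_vecMul])

theorem RowInd.vecMul {A B : Matrix (Fin 2) (Fin 2) K} (h : A * B = 1) {v t : Fin 2 → K}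
    (hi : RowInd v t) : RowInd (v ᵥ* A) (t ᵥ* A) := by
  obtain ⟨c, d, h1, h2, h3, h4⟩ := hi
  have key : ∀ a b : Fin 2 → K, (a ᵥ* A) ⬝ᵥ (B *ᵥ b) = a ⬝ᵥ b := fun a b => by
    rw [← dotProduct_mulVec, mulVec_mulVec, h, one_mulVec]
  exact ⟨B *ᵥ c, B *ᵥ d, by rw [key, h1], by rw [key, h2], by rw [key, h3], by rw [key, h4]⟩

theorem IsPreserver.comp_mul_right (hφ : IsPreserver φ) {A B : Matrix (Fin 2) (Fin 2) K}
    (h : A * B = 1) : IsPreserver (fun M => φ (M * A)) := by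
  refine ⟨fun M N hMN => hφ.adj _ _ ?_, by simp [hφ.zero]⟩
  obtain ⟨u, v, hu, hv, e⟩ := adjacent_iff_s10.mp hMN
  exact adjacent_iff_s10.mpr ⟨u, v ᵥ* A, hu, vecMul_ne_zero_of_mul_eq_one h hv,
    by rw [← Matrix.sub_mul, e, vecMulVec_mul]⟩

theorem mapsLL_comp_mul_right {A B : Matrix (Fin 2) (Fin 2) K} (h : A * B = 1) {y : Fin 2 → K}
    {u : Fin p → E} : MapsLL (fun M => φ (M * A)) y u ↔ MapsLL φ y u := by
  constructor
  · intro hm w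
    simpa [vecMulVec_mul, vecMul_vecMul, mul_eq_one_comm.mp h] using hm (w ᵥ* B)
  · intro hm w
    simpa [vecMulVec_mul] using hm (w ᵥ* A)

theorem mapsRR_comp_mul_right {A : Matrix (Fin 2) (Fin 2) K} {x : Fin 2 → K}
    {v : Fin q → E} : MapsRR (fun M => φ (M * A)) x v ↔ MapsRR φ (x ᵥ* A) v := by
  simp [MapsRR, vecMulVec_mul]

theorem RegularMap.comp_mul_right (hφ : RegularMap φ) {A B : Matrix (Fin 2) (Fin 2) K}
    (h : A * B = 1) : RegularMap (fun M => φ (M * A)) where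
  toIsPreserver := hφ.toIsPreserver.comp_mul_right h
  direct := by
    refine ⟨fun y hy => ?_, fun x hx => ?_⟩
    · obtain ⟨u, hu, hm⟩ := hφ.direct.1 y hy
      exact ⟨u, hu, (mapsLL_comp_mul_right h).mpr hm⟩
    · obtain ⟨v, hv, hm⟩ := hφ.direct.2 _ (vecMul_ne_zero_of_mul_eq_one h hx)
      exact ⟨v, hv, mapsRR_comp_mul_right.mpr hm⟩
  left_ind hi hu hu' hm hm' := hφ.left_ind hi hu hu' ((mapsLL_comp_mul_right h).mp hm)
    ((mapsLL_comp_mul_right h).mp hm')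
  right_ind hi hv hv' hm hm' := hφ.right_ind (hi.vecMul h) hv hv' (mapsRR_comp_mul_right.mp hm)
    (mapsRR_comp_mul_right.mp hm')
  span hi hz hv hv' hw hm hm' hmz := hφ.span (hi.vecMul h) (vecMul_ne_zero_of_mul_eq_one h hz)
    hv hv' hw (mapsRR_comp_mul_right.mp hm) (mapsRR_comp_mul_right.mp hm')
    (mapsRR_comp_mul_right.mp hmz)

theorem RankTwo.exists_mul_eq_one {A : Matrix (Fin 2) (Fin 2) K} (h : RankTwo A) :
    ∃ B, A * B = 1 := by
  obtain ⟨U, V, U', V', hU, hV, rfl⟩ := h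
  refine ⟨V' * U', ?_⟩
  rw [Matrix.mul_assoc, ← Matrix.mul_assoc V, hV, Matrix.one_mul, mul_eq_one_comm.mp hU]

theorem IsPreserver.regularMap_or_collapse (hφ : IsPreserver φ) (e : K ≃ E)
    {A : Matrix (Fin 2) (Fin 2) K} (hA : RankTwo A) (hA' : RankTwo (φ A)) :
    RegularMap φ ∨ TypeSwap φ ∨ CollapseL φ ∨ CollapseR φ := by
  obtain ⟨B, h⟩ := hA.exists_mul_eq_one
  have h' := mul_eq_one_comm.mp h
  have hψ := hφ.comp_mul_right h
  have h1 : RankTwo ((fun M => φ (M * A)) 1) := by simpa using hA'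
  have hback : (fun M => (fun M => φ (M * A)) (M * B)) = φ := by
    funext M
    simp [Matrix.mul_assoc, h']
  rcases hψ.classification h1 e with hd | hs | ⟨u, hc⟩ | ⟨v, hc⟩
  · left
    have := (hψ.regularMap_of_direct h1 hd).comp_mul_right h'
    rwa [hback] at this
  · right; left
    refine ⟨fun y hy => ?_, fun x hx => ?_⟩
    · obtain ⟨v, hv, hm⟩ := hs.1 y hy
      refine ⟨v, hv, fun w => ?_⟩
      simpa [vecMulVec_mul, vecMul_vecMul, h'] using hm (w ᵥ* B)
    · obtain ⟨u, hu, hm⟩ := hs.2 _ (vecMul_ne_zero_of_mul_eq_one h' hx)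
      refine ⟨u, hu, fun z => ?_⟩
      simpa [vecMulVec_mul, vecMul_vecMul, h'] using hm z
  · right; right; left
    refine ⟨u, fun z w => ?_⟩
    simpa [vecMulVec_mul, vecMul_vecMul, h'] using hc z (w ᵥ* B)
  · right; right; right
    refine ⟨v, fun z w => ?_⟩
    simpa [vecMulVec_mul, vecMul_vecMul, h'] using hc z (w ᵥ* B)

theorem IsPreserver.regularMap_of_maps (hφ : IsPreserver φ) (e : K ≃ E)
    {A : Matrix (Fin 2) (Fin 2) K} (hA : RankTwo A) (hA' : RankTwo (φ A)) {y x : Fin 2 → K}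
    {u : Fin p → E} {v : Fin q → E} (hy : y ≠ 0) (hx : x ≠ 0) (hu : u ≠ 0) (hv : v ≠ 0)
    (hyu : MapsLL φ y u) (hxv : MapsRR φ x v) : RegularMap φ := by
  obtain ⟨B, h⟩ := hA.exists_mul_eq_one
  have h' := mul_eq_one_comm.mp h
  have hψ := hφ.comp_mul_right h
  have h1 : RankTwo ((fun M => φ (M * A)) 1) := by simpa using hA'
  have hL : ∀ v', v' ≠ 0 → ¬ MapsLR φ y v' := fun v' hv' hm =>
    hψ.not_mapsLL_mapsLR h1 hy hu hv' ((mapsLL_comp_mul_right h).mpr hyu)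
      (fun w => by simpa [vecMulVec_mul] using hm (w ᵥ* A))
  have hR : ∀ u', u' ≠ 0 → ¬ MapsRL φ x u' := fun u' hu' hm =>
    hψ.not_mapsRL_mapsRR h1 (x := x ᵥ* B) (vecMul_ne_zero_of_mul_eq_one h' hx) hu' hv
      (fun w => by simpa [vecMulVec_mul, vecMul_vecMul, h'] using hm w)
      (mapsRR_comp_mul_right.mpr (by simpa [vecMul_vecMul, h'] using hxv))
  rcases hφ.regularMap_or_collapse e hA hA' with hd | hs | ⟨u', hc⟩ | ⟨v', hc⟩
  · exact hd
  · obtain ⟨v', hv', hm⟩ := hs.1 y hy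
    exact absurd hm (hL v' hv')
  · refine absurd (fun w => hc w x) (hR u' ?_)
    rintro rfl
    obtain ⟨t, ht⟩ := hc y x
    exact hφ.map_ne_zero hy hx (by rw [ht, zero_vecMulVec'])
  · refine absurd (fun w => hc y w) (hL v' ?_)
    rintro rfl
    obtain ⟨t, ht⟩ := hc y x
    exact hφ.map_ne_zero hy hx (by rw [ht, vecMulVec_zero'])

theorem RegularMap.exists_smul (hφ : RegularMap φ) {y x : Fin 2 → K} {u : Fin p → E}
    {v : Fin q → E} (hy : y ≠ 0) (hx : x ≠ 0) (hu : u ≠ 0) (hv : v ≠ 0)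
    (hyu : MapsLL φ y u) (hxv : MapsRR φ x v) :
    ∃ k : E, k ≠ 0 ∧ φ (vecMulVec y x) = vecMulVec u (k • v) := by
  obtain ⟨k, hk⟩ := MemBoth.exists_smul hu hv ⟨hyu x, hxv y⟩
  refine ⟨k, ?_, hk⟩
  rintro rfl
  exact hφ.map_ne_zero hy hx (by rw [hk, zero_smul, vecMulVec_zero'])

/-- The map `φ` recentred at `B`. -/
def recenter (φ : Matrix (Fin 2) (Fin 2) K → Matrix (Fin p) (Fin q) E)
    (B : Matrix (Fin 2) (Fin 2) K) (M : Matrix (Fin 2) (Fin 2) K) : Matrix (Fin p) (Fin q) E :=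
  φ (B + M) - φ B

theorem IsPreserver.shift (hφ : IsPreserver φ) (B : Matrix (Fin 2) (Fin 2) K) :
    IsPreserver (recenter φ B) := by
  refine ⟨fun M N h => ?_, by simp [recenter]⟩
  have : Adjacent (B + M) (B + N) := by
    rwa [Adjacent, add_sub_add_left_eq_sub]
  have := hφ.adj _ _ this
  rwa [Adjacent, recenter, recenter, sub_sub_sub_cancel_right]

theorem recenter_recenter (B C : Matrix (Fin 2) (Fin 2) K) :
    recenter (recenter φ B) C = recenter φ (B + C) := by
  funext M
  simp [recenter, add_assoc]

theorem RegularMap.shift_vecMulVec (hφ : RegularMap φ) (e : K ≃ E) {y w : Fin 2 → K} (hy : y ≠ 0)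
    (hw : w ≠ 0) : RegularMap (recenter φ (vecMulVec y w)) := by
  obtain ⟨y', hyy⟩ := exists_colInd hy
  obtain ⟨w', hww⟩ := exists_rowInd hw
  obtain ⟨u, hu, hyu⟩ := hφ.direct.1 y hy
  obtain ⟨u', hu', hyu'⟩ := hφ.direct.1 y' hyy.symm.ne_zero
  obtain ⟨v, hv, hwv⟩ := hφ.direct.2 w hw
  obtain ⟨v', hv', hwv'⟩ := hφ.direct.2 w' hww.symm.ne_zero
  obtain ⟨k, hk, ek⟩ := hφ.exists_smul hy hw hu hv hyu hwv
  obtain ⟨l, hl, el⟩ := hφ.exists_smul hyy.symm.ne_zero hww.symm.ne_zero hu' hv' hyu' hwv'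
  refine (hφ.toIsPreserver.shift _).regularMap_of_maps e
    (A := vecMulVec y' w' + vecMulVec y (-w)) ?_ ?_ hy hw hu hv ?_ ?_
  · refine rankTwo_of_ind hyy.symm ?_
    simpa using hww.symm.smul one_ne_zero (neg_ne_zero.mpr one_ne_zero)
  · have : recenter φ (vecMulVec y w) (vecMulVec y' w' + vecMulVec y (-w)) =
        vecMulVec u' (l • v') + vecMulVec u (-k • v) := by
      rw [recenter, vecMulVec_neg, ek, add_comm, neg_add_cancel_right, el, neg_smul, vecMulVec_neg,
        sub_eq_add_neg]
    rw [this]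
    exact rankTwo_of_ind (hφ.left_ind hyy hu hu' hyu hyu').symm
      ((hφ.right_ind hww hv hv' hwv hwv').symm.smul hl (neg_ne_zero.mpr hk))
  · intro x
    obtain ⟨t, ht⟩ := hyu (w + x)
    exact ⟨t - k • v, by rw [recenter, ← vecMulVec_add, ht, ek, vecMulVec_sub]⟩
  · intro z
    obtain ⟨t, ht⟩ := hwv (y + z)
    exact ⟨t - MulOpposite.op k • u, by
      rw [recenter, ← add_vecMulVec, ht, ek, sub_vecMulVec, op_smul_vecMulVec']⟩

theorem RegularMap.shift (hφ : RegularMap φ) (e : K ≃ E) (B : Matrix (Fin 2) (Fin 2) K) :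
    RegularMap (recenter φ B) := by
  have hz : ∀ {ψ : Matrix (Fin 2) (Fin 2) K → Matrix (Fin p) (Fin q) E}, RegularMap ψ →
      RegularMap (recenter ψ 0) := by
    intro ψ hψ
    have : recenter ψ 0 = ψ := by
      funext M
      simp [recenter, hψ.zero]
    rwa [this]
  have key : ∀ {ψ : Matrix (Fin 2) (Fin 2) K → Matrix (Fin p) (Fin q) E}, RegularMap ψ →
      ∀ y w, y ≠ 0 → RegularMap (recenter ψ (vecMulVec y w)) := by
    intro ψ hψ y w hy
    by_cases hw : w = 0
    · rw [hw, vecMulVec_zero']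
      exact hz hψ
    · exact hψ.shift_vecMulVec e hy hw
  have hB : B = vecMulVec ![1, 0] (B 0) + vecMulVec ![0, 1] (B 1) := by
    ext i j
    rw [Matrix.add_apply, vecMulVec_apply, vecMulVec_apply]
    fin_cases i <;> simp
  rw [hB, ← recenter_recenter]
  exact key (key hφ _ _ fun e => by simpa using congrFun e 0) _ _
    fun e => by simpa using congrFun e 1

end Regular

section Plane

variable {K E : Type*} [DivisionRing K] [DivisionRing E]

/-- A multiplicative map which is additive on pairs with nonzero sum is additive. -/
theorem map_add_of_map_add_ne_zero (e : K ≃ E) {τ : K → E} (h0 : τ 0 = 0)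
    (hadd : ∀ a b, a + b ≠ 0 → τ (a + b) = τ a + τ b) (a b : K) : τ (a + b) = τ a + τ b := by
  by_cases hab : a + b = 0
  swap
  · exact hadd a b hab
  obtain rfl : b = -a := (neg_eq_of_add_eq_zero_right hab).symm
  rw [hab, h0]
  by_cases ha : a = 0
  · simp [ha, h0]
  by_cases hk : ∃ k : K, k ≠ 0 ∧ a + k ≠ 0
  · obtain ⟨k, hk, hak⟩ := hk
    have e1 := hadd a k hak
    have e2 := hadd (-a) (a + k) (by rwa [neg_add_cancel_left])
    rw [neg_add_cancel_left, e1] at e2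
    have e3 : τ k + 0 = τ k + (τ a + τ (-a)) := by
      rw [add_zero]; nth_rewrite 1 [e2]; abel
    exact add_left_cancel e3
  · push Not at hk
    have haa : a = -a := eq_neg_of_add_eq_zero_left (hk a ha)
    have hcases : ∀ k : K, k = 0 ∨ k = -a := fun k => by
      by_cases h : k = 0
      · exact Or.inl h
      · exact Or.inr (neg_eq_of_add_eq_zero_right (hk k h)).symm
    have h2 : (1 : E) + 1 = 0 := by
      have ne : (0 : E) ≠ 1 := zero_ne_one
      by_contra h
      have i1 := e.symm.injective.ne ne
      have i2 := e.symm.injective.ne h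
      have i3 : e.symm (1 + 1) ≠ e.symm 1 :=
        e.symm.injective.ne (fun h => one_ne_zero (add_eq_left.mp h))
      rcases hcases (e.symm 0) with a1 | a1 <;> rcases hcases (e.symm 1) with a2 | a2 <;>
        rcases hcases (e.symm (1 + 1)) with a3 | a3 <;>
        first
        | exact i1 (a1.trans a2.symm)
        | exact i2 (a3.trans a1.symm)
        | exact i3 (a3.trans a2.symm)
    rw [← haa]
    calc (0 : E) = τ a * (1 + 1) := by rw [h2, mul_zero]
      _ = τ a + τ a := by rw [mul_add, mul_one]

/-- A collinearity preserving map of the plane which respects the pencils of lines parallel to the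
axes is semilinear on the axes. -/
theorem plane_semilinear (e : K ≃ E) (hs : ∀ f : K →+* E, Function.Surjective f)
    {α β : K → K → E} {p q : E} (hα0 : ∀ t, α 0 t = 0) (hβ0 : ∀ s, β s 0 = 0)
    (hβ : ∀ s t, β s t = (1 - α s t * p) * β 0 t) (hα : ∀ s t, α s t = (1 - β s t * q) * α s 0)
    (ha : ∀ s, α s 0 * p ≠ 1) (hb : ∀ t, β 0 t * q ≠ 1) (ha1 : α 1 0 ≠ 0) (hb1 : β 0 1 ≠ 0)
    (hcol : ∀ s t s' t' k, ∃ l : E,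
      α (s + k * s') (t + k * t') - α s t = l * (α (s + s') (t + t') - α s t) ∧
      β (s + k * s') (t + k * t') - β s t = l * (β (s + s') (t + t') - β s t)) :
    p = 0 ∧ q = 0 ∧ ∃ τ : K →+* E, ∀ s t, α s t = τ s * α 1 0 ∧ β s t = τ t * β 0 1 := by
  set A : K → E := fun s => (1 - α s 0 * p)⁻¹ * α s 0 with hA
  set B : K → E := fun t => (1 - β 0 t * q)⁻¹ * β 0 t with hB
  set L : K → K → E := fun s t => 1 - α s t * p - β s t * q with hL
  have ha' : ∀ s, 1 - α s 0 * p ≠ 0 := fun s => sub_ne_zero.mpr (ha s).symm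
  have hb' : ∀ t, 1 - β 0 t * q ≠ 0 := fun t => sub_ne_zero.mpr (hb t).symm
  have hL1 : ∀ s t, L s t = (1 - β s t * q) * (1 - α s 0 * p) := fun s t => by
    rw [mul_sub, mul_one, ← mul_assoc, ← hα]
    simp only [hL]
    abel
  have hL2 : ∀ s t, L s t = (1 - α s t * p) * (1 - β 0 t * q) := fun s t => by
    rw [mul_sub, mul_one, ← mul_assoc, ← hβ]
  have hL0 : ∀ s t, L s t ≠ 0 := fun s t h => by
    rw [hL1] at h
    rcases mul_eq_zero.mp h with h | h
    · have h3 := hα s t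
      rw [h, zero_mul] at h3
      have h4 := hβ s t
      rw [h3, zero_mul, sub_zero, one_mul] at h4
      rw [h4] at h
      exact hb' t h
    · exact ha' s h
  have hαL : ∀ s t, α s t = L s t * A s := fun s t => by
    rw [hL1, hA, mul_assoc]
    simp only
    rw [mul_inv_cancel_left₀ (ha' s), ← hα]
  have hβL : ∀ s t, β s t = L s t * B t := fun s t => by
    rw [hL2, hB, mul_assoc]
    simp only
    rw [mul_inv_cancel_left₀ (hb' t), ← hβ]
  have hA0 : A 0 = 0 := by simp [hA, hα0]
  have hB0 : B 0 = 0 := by simp [hB, hβ0]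
  have hA1 : A 1 ≠ 0 := mul_ne_zero (inv_ne_zero (ha' 1)) ha1
  have hB1 : B 1 ≠ 0 := mul_ne_zero (inv_ne_zero (hb' 1)) hb1
  have hmulB : ∀ s k, B (s * k) = A s * (A 1)⁻¹ * B k := fun s k => by
    obtain ⟨l, h1, h2⟩ := hcol 0 0 1 k s
    simp only [zero_add, mul_one, hα0, hβ0, sub_zero] at h1 h2
    rw [hαL, hαL 1] at h1
    rw [hβL, hβL 1] at h2
    have e1 : A s = (L s (s * k))⁻¹ * l * L 1 k * A 1 := by
      rw [mul_assoc, mul_assoc, ← h1, inv_mul_cancel_left₀ (hL0 _ _)]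
    have e2 : B (s * k) = (L s (s * k))⁻¹ * l * L 1 k * B k := by
      rw [mul_assoc, mul_assoc, ← h2, inv_mul_cancel_left₀ (hL0 _ _)]
    rw [e2, e1, mul_inv_cancel_right₀ hA1]
  set T : K → E := fun s => A s * (A 1)⁻¹ with hT
  have hAT : ∀ s, A s = T s * A 1 := fun s => by
    simp only [hT]; rw [inv_mul_cancel_right₀ hA1]
  have hBT : ∀ s, B s = T s * B 1 := fun s => by
    have := hmulB s 1
    rwa [mul_one] at this
  have hTmul : ∀ s k, T (s * k) = T s * T k := fun s k => by
    have := hmulB s k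
    rw [hBT (s * k), hBT k, ← mul_assoc _ (T k) (B 1)] at this
    exact mul_right_cancel₀ hB1 this
  have hT1 : T 1 = 1 := by simp only [hT]; rw [mul_inv_cancel₀ hA1]
  have hT0 : T 0 = 0 := by simp only [hT]; rw [hA0, zero_mul]
  have hadd' : ∀ s r, s + r ≠ 0 → T (s + r) = T s + T r := by
    intro s r hc
    obtain ⟨l, h1, h2⟩ := hcol (s + r) 0 (-(s + r)) (s + r) (r * (s + r)⁻¹)
    have hk : r * (s + r)⁻¹ * (s + r) = r := inv_mul_cancel_right₀ hc r
    simp only [mul_neg, hk, add_neg_cancel, zero_add, add_neg_cancel_right, hα0, hβ0, sub_zero,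
      zero_sub] at h1 h2
    have h3 : L s r = (1 - l) * L (s + r) 0 + l * L 0 (s + r) := by
      simp only [hL, hα0, hβ0, h2, sub_eq_iff_eq_add.mp h1]
      noncomm_ring
    have h4 : L s r * T s = (1 - l) * L (s + r) 0 * T (s + r) := by
      refine mul_right_cancel₀ hA1 ?_
      rw [mul_assoc _ (T s), mul_assoc _ (T (s + r)), ← hAT, ← hAT, ← hαL, mul_assoc, ← hαL,
        sub_eq_iff_eq_add.mp h1]
      noncomm_ring
    have h5 : L s r * T r = l * L 0 (s + r) * T (s + r) := by
      refine mul_right_cancel₀ hB1 ?_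
      rw [mul_assoc _ (T r), mul_assoc _ (T (s + r)), ← hBT, ← hBT, ← hβL, mul_assoc, ← hβL, h2]
    refine mul_left_cancel₀ (hL0 s r) ?_
    rw [mul_add, h4, h5, ← add_mul, ← h3]
  let τ : K →+* E :=
    { toFun := T, map_one' := hT1, map_mul' := hTmul, map_zero' := hT0
      map_add' := map_add_of_map_add_ne_zero e hT0 hadd' }
  have hp : p = 0 := by
    by_contra hp
    obtain ⟨s, h⟩ := hs τ (-(p⁻¹ * (A 1)⁻¹))
    have h : T s = -(p⁻¹ * (A 1)⁻¹) := h
    have h3 : A s * p = -1 := by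
      rw [hAT, h, neg_mul, neg_mul, inv_mul_cancel_right₀ hA1, inv_mul_cancel₀ hp]
    have h4 : L s 0 = 1 + L s 0 := by
      nth_rewrite 1 [hL]
      simp only
      rw [hβ0, hαL, mul_assoc, h3]
      simp
    simp at h4
  have hq : q = 0 := by
    by_contra hq
    obtain ⟨s, h⟩ := hs τ (-(q⁻¹ * (B 1)⁻¹))
    have h : T s = -(q⁻¹ * (B 1)⁻¹) := h
    have h3 : B s * q = -1 := by
      rw [hBT, h, neg_mul, neg_mul, inv_mul_cancel_right₀ hB1, inv_mul_cancel₀ hq]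
    have h4 : L 0 s = 1 + L 0 s := by
      nth_rewrite 1 [hL]
      simp only
      rw [hα0, hβL, mul_assoc, h3]
      simp
    simp at h4
  refine ⟨hp, hq, τ, fun s t => ?_⟩
  have hLone : ∀ s t, L s t = 1 := fun s t => by simp [hL, hp, hq]
  have h1 := hAT s
  have h2 := hBT t
  have h3 := hαL s t
  have h4 := hβL s t
  have h5 := hαL 1 0
  have h6 := hβL 0 1
  rw [hLone, one_mul] at h3 h4 h5 h6
  exact ⟨by rw [h3, h1, h5]; rfl, by rw [h4, h2, h6]; rfl⟩

end Plane

section Geometry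

variable {K E : Type*} [DivisionRing K] [DivisionRing E] {p q : ℕ}
  {φ : Matrix (Fin 2) (Fin 2) K → Matrix (Fin p) (Fin q) E}

theorem MapsLL.shift_self {y : Fin 2 → K} {u : Fin p → E} (h : MapsLL φ y u) (w : Fin 2 → K) :
    MapsLL (recenter φ (vecMulVec y w)) y u := fun x => by
  obtain ⟨s, hs⟩ := h (w + x)
  obtain ⟨t, ht⟩ := h w
  exact ⟨s - t, by rw [recenter, ← vecMulVec_add, hs, ht, vecMulVec_sub]⟩

theorem RegularMap.vecMul_ne_zero (hφ : RegularMap φ) (e : K ≃ E) {y z x : Fin 2 → K}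
    (hyz : ColInd y z) (hx : x ≠ 0) {u u' : Fin p → E} (hu : MapsLL φ y u)
    (hu' : MapsLL (recenter φ (vecMulVec z x)) y u') (hu0' : u' ≠ 0) {c : Fin p → E}
    (h1 : c ⬝ᵥ u = 1) (h2 : c ⬝ᵥ u' = 0) : c ᵥ* φ (vecMulVec z x) ≠ 0 := by
  intro h0
  have hu0 : u ≠ 0 := by rintro rfl; simp at h1
  obtain ⟨x', hxx⟩ := exists_rowInd hx
  obtain ⟨v, hv, hxv⟩ := hφ.direct.2 x hx
  obtain ⟨v', hv', hxv'⟩ := hφ.direct.2 x' hxx.symm.ne_zero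
  obtain ⟨s, hs, hzs⟩ := hφ.direct.1 z hyz.symm.ne_zero
  obtain ⟨k, hk, ek⟩ := hφ.exists_smul hyz.symm.ne_zero hx hs hv hzs hxv
  obtain ⟨l, hl, el⟩ := hφ.exists_smul hyz.ne_zero hxx.symm.ne_zero hu0 hv' hu hxv'
  have hvl : RowInd (k • v) (l • v') := (hφ.right_ind hxx hv hv' hxv hxv').smul hk hl
  have hsu : ColInd s u' := (hφ.shift e _).left_ind hyz.symm hs hu0' (hzs.shift_self x) hu'
  obtain ⟨t, ht⟩ := hu' x'
  obtain ⟨a, b, hab⟩ := ((hφ.shift e (vecMulVec y x')).toIsPreserver).map_vecMulVec z x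
  have ht : φ (vecMulVec z x + vecMulVec y x') = vecMulVec s (k • v) + vecMulVec u' t := by
    rw [← ek, ← ht, recenter, add_sub_cancel]
  have hab : φ (vecMulVec z x + vecMulVec y x') = vecMulVec u (l • v') + vecMulVec a b := by
    rw [← el, ← hab, recenter, add_sub_cancel, add_comm]
  have hcomb := congrArg (fun M => c ᵥ* M) (ht.symm.trans hab)
  rw [ek] at h0
  simp only [vecMul_add, h0] at hcomb
  simp only [vecMul_vecMulVec, h1, h2, zero_smul, one_smul, add_zero] at hcomb
  have hb : l • v' = -(c ⬝ᵥ a) • b := by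
    rw [neg_smul]; exact eq_neg_of_add_eq_zero_left hcomb.symm
  have hc0 : -(c ⬝ᵥ a) ≠ 0 := fun h => by
    rw [h, zero_smul] at hb
    exact hvl.symm.ne_zero hb
  have hb' : b = (-(c ⬝ᵥ a))⁻¹ • (l • v') := by rw [hb, smul_smul, inv_mul_cancel₀ hc0, one_smul]
  rw [ht, hb', ← op_smul_vecMulVec' a, ← add_vecMulVec] at hab
  obtain ⟨m, -, hm, -⟩ := hsu.rows_of_add hab
  exact hvl.symm.not_smul m hm

theorem RegularMap.concurrent (hφ : RegularMap φ) (e : K ≃ E) {y z x : Fin 2 → K}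
    (hyz : ColInd y z) (hx : x ≠ 0) {u u' : Fin p → E} (hu : MapsLL φ y u)
    (hu' : MapsLL (recenter φ (vecMulVec z x)) y u') (hu0' : u' ≠ 0) {c : Fin p → E}
    (h1 : c ⬝ᵥ u = 1) (h2 : c ⬝ᵥ u' = 0) {w : Fin 2 → K} {m g : Fin q → E}
    (hm : φ (vecMulVec y w) = vecMulVec u m) (hg : MapsRR (recenter φ (vecMulVec y w)) x g) :
    ∃ k : E, k ≠ 0 ∧ c ᵥ* φ (vecMulVec z x) - m = k • g := by
  have hne := (hφ.shift e (vecMulVec y w)).vecMul_ne_zero e hyz hx (hu.shift_self w)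
    (by rw [recenter_recenter, add_comm, ← recenter_recenter]; exact hu'.shift_self w) hu0' h1 h2
  obtain ⟨s, hs⟩ := hg z
  obtain ⟨t, ht⟩ := hu' w
  have hval : c ᵥ* recenter φ (vecMulVec y w) (vecMulVec z x) = c ᵥ* φ (vecMulVec z x) - m := by
    have : φ (vecMulVec y w + vecMulVec z x) = φ (vecMulVec z x) + vecMulVec u' t := by
      rw [← ht, recenter, add_sub_cancel, add_comm]
    rw [recenter, this, hm, vecMul_sub, vecMul_add, vecMul_vecMulVec, vecMul_vecMulVec, h1, h2,
      zero_smul, add_zero, one_smul]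
  rw [hs, vecMul_vecMulVec] at hne hval
  exact ⟨c ⬝ᵥ s, fun h => hne (by rw [h, zero_smul]), hval.symm⟩

theorem RegularMap.parallel (hφ : RegularMap φ) {y z x : Fin 2 → K}
    (hyz : ColInd y z) (hx : x ≠ 0) {u : Fin p → E} (hu0 : u ≠ 0) (hu : MapsLL φ y u)
    (hu' : MapsLL (recenter φ (vecMulVec z x)) y u) {v g : Fin q → E} (hv : v ≠ 0)
    (hxv : MapsRR φ x v) {w : Fin 2 → K} (hg : MapsRR (recenter φ (vecMulVec y w)) x g) :
    MapsRR (recenter φ (vecMulVec y w)) x v := by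
  obtain ⟨s, hs, hzs⟩ := hφ.direct.1 z hyz.symm.ne_zero
  obtain ⟨k, hk, ek⟩ := hφ.exists_smul hyz.symm.ne_zero hx hs hv hzs hxv
  obtain ⟨d, c, -, -, h3, h4⟩ := hφ.left_ind hyz hu0 hs hu hzs
  obtain ⟨m, hm⟩ := hu w
  obtain ⟨t, ht⟩ := hu' w
  obtain ⟨a, ha⟩ := hg z
  have h := congrArg (fun M => c ᵥ* M) (show vecMulVec s (k • v) + vecMulVec u t =
      vecMulVec u m + vecMulVec a g by
    rw [← ek, ← ht, ← hm, ← ha, recenter, recenter, add_sub_cancel, add_sub_cancel, add_comm])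
  simp only [vecMul_add, vecMul_vecMulVec, h3, h4, zero_smul, one_smul, add_zero, zero_add] at h
  have hc : c ⬝ᵥ a ≠ 0 := fun h0 => by
    rw [h0, zero_smul] at h
    exact (smul_ne_zero hk hv) h
  have hg' : g = ((c ⬝ᵥ a)⁻¹ * k) • v := by
    rw [mul_smul, h, smul_smul, inv_mul_cancel₀ hc, one_smul]
  rw [hg'] at hg
  exact hg.of_smul

theorem exists_smul_of_mapsRR {y x w : Fin 2 → K} {u : Fin p → E} (hu0 : u ≠ 0)
    {ψ : (Fin 2 → K) → Fin q → E}
    (hψ : ∀ w, φ (vecMulVec y w) = vecMulVec u (ψ w)) {g : Fin q → E} (hg : g ≠ 0)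
    (h : MapsRR (recenter φ (vecMulVec y w)) x g) (d : K) :
    ∃ k : E, ψ (w + d • x) - ψ w = k • g := by
  obtain ⟨s, hs⟩ := h (MulOpposite.op d • y)
  rw [op_smul_vecMulVec', recenter, ← vecMulVec_add, hψ, hψ, ← vecMulVec_sub] at hs
  exact eq_smul_of_vecMulVec_eq hu0 hg hs

/-- The images of the lines in a fixed direction form a pencil. -/
theorem RegularMap.pencil (hφ : RegularMap φ) (e : K ≃ E) {y z x₁ x₂ : Fin 2 → K}
    (hyz : ColInd y z) (hx : RowInd x₁ x₂) {u u' : Fin p → E} (hu0 : u ≠ 0) (hu : MapsLL φ y u)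
    (hu0' : u' ≠ 0) (hu' : MapsLL (recenter φ (vecMulVec z x₁)) y u') {v₁ v₂ : Fin q → E}
    (hv₁ : v₁ ≠ 0) (hv₂ : v₂ ≠ 0) (h₁ : MapsRR φ x₁ v₁) (h₂ : MapsRR φ x₂ v₂)
    {ψ : (Fin 2 → K) → Fin q → E} (hψ : ∀ w, φ (vecMulVec y w) = vecMulVec u (ψ w))
    {α β : K → K → E} (hαβ : ∀ s t, ψ (s • x₁ + t • x₂) = α s t • v₁ + β s t • v₂)
    (hα0 : ∀ t, α 0 t = 0) (hβ0 : ∀ s, β s 0 = 0) :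
    ∃ r : E, (∀ s t, β s t = (1 - α s t * r) * β 0 t) ∧ (∀ s, α s 0 * r ≠ 1) ∧
      (ColInd u u' → r ≠ 0) := by
  have hind := hφ.right_ind hx hv₁ hv₂ h₁ h₂
  have hg : ∀ w, ∃ g, g ≠ 0 ∧ MapsRR (recenter φ (vecMulVec y w)) x₁ g := fun w =>
    (hφ.shift e _).direct.2 x₁ hx.ne_zero
  have hbase : ∀ t, ψ (t • x₂) = β 0 t • v₂ := fun t => by
    have := hαβ 0 t
    rwa [zero_smul, zero_add, hα0, zero_smul, zero_add] at this
  rcases colInd_or_smul hu0 hu0' with hc | ⟨k, -, rfl⟩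
  · have hc' := hc
    obtain ⟨c, -, hc1, hc2, -⟩ := hc'
    have hz : ψ 0 = 0 := by
      have := hαβ 0 0
      simpa [hα0, hβ0] using this
    obtain ⟨r, hr, hr'⟩ : ∃ r : E, r ≠ 0 ∧ c ᵥ* φ (vecMulVec z x₁) = r • v₁ := by
      obtain ⟨r, hr, h⟩ := hφ.concurrent e hyz hx.ne_zero hu hu' hu0' hc1 hc2 (hψ 0) (g := v₁)
        (by
          have : recenter φ (vecMulVec y 0) = φ := by
            funext M
            simp [recenter, hφ.zero]
          rwa [this])
      exact ⟨r, hr, by rw [← h, hz, sub_zero]⟩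
    have hcon : ∀ w, ∀ d : K, ∃ k : E, ψ (w + d • x₁) - ψ w = k • (r • v₁ - ψ w) := by
      intro w d
      obtain ⟨g, hg0, hg⟩ := hg w
      obtain ⟨k, hk, ek⟩ := hφ.concurrent e hyz hx.ne_zero hu hu' hu0' hc1 hc2 (hψ w) hg
      obtain ⟨l, hl⟩ := exists_smul_of_mapsRR hu0 hψ hg0 hg d
      exact ⟨l * k⁻¹, by rw [hl, ← hr', ek, smul_smul, inv_mul_cancel_right₀ hk]⟩
    refine ⟨r⁻¹, fun s t => ?_, fun s h => ?_, fun _ => inv_ne_zero hr⟩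
    · obtain ⟨k, hk⟩ := hcon (t • x₂) s
      rw [add_comm, hαβ, hbase, sub_eq_iff_eq_add] at hk
      obtain ⟨ha, hb⟩ := hind.unique (a' := k * r) (b' := β 0 t - k * β 0 t) (by
        rw [hk, smul_sub, smul_smul, smul_smul, sub_smul]; abel)
      rw [hb, ha, mul_inv_cancel_right₀ hr, sub_mul, one_mul]
    · have hs : α s 0 = r := by
        rw [← mul_one r, ← mul_inv_cancel₀ hr]
        rw [← mul_inv_cancel_right₀ (inv_ne_zero hr) (α s 0), h, one_mul, inv_inv,
          mul_inv_cancel₀ hr, mul_one]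
      obtain ⟨g, hg0, hg⟩ := hg (s • x₁)
      obtain ⟨k, hk, ek⟩ := hφ.concurrent e hyz hx.ne_zero hu hu' hu0' hc1 hc2 (hψ _) hg
      have := hαβ s 0
      rw [zero_smul, add_zero, hβ0, zero_smul, add_zero, hs] at this
      rw [hr', this, sub_self] at ek
      exact smul_ne_zero hk hg0 ek.symm
  · refine ⟨0, fun s t => ?_, fun s => ?_, fun h => (h.not_smul k rfl).elim⟩
    · obtain ⟨g, hg0, hg⟩ := hg (t • x₂)
      have hR := hφ.parallel hyz hx.ne_zero hu0 hu hu'.of_smul hv₁ h₁ hg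
      obtain ⟨l, hl⟩ := exists_smul_of_mapsRR hu0 hψ hv₁ hR s
      rw [add_comm, hαβ, hbase, sub_eq_iff_eq_add] at hl
      rw [mul_zero, sub_zero, one_mul]
      exact (hind.unique hl).2
    · rw [mul_zero]; exact zero_ne_one

/-- Directions do not depend on the base point, and the map is semilinear along lines. -/
theorem RegularMap.semilinear (hφ : RegularMap φ) (e : K ≃ E)
    (hs : ∀ f : K →+* E, Function.Surjective f) {y z x₁ x₂ : Fin 2 → K}
    (hyz : ColInd y z) (hx : RowInd x₁ x₂) {u u' : Fin p → E} (hu0 : u ≠ 0) (hu : MapsLL φ y u)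
    (hu0' : u' ≠ 0) (hu' : MapsLL (recenter φ (vecMulVec z x₁)) y u') {v₁ v₂ : Fin q → E}
    (hv₁ : v₁ ≠ 0) (hv₂ : v₂ ≠ 0) (h₁ : MapsRR φ x₁ v₁) (h₂ : MapsRR φ x₂ v₂)
    {ψ : (Fin 2 → K) → Fin q → E} (hψ : ∀ w, φ (vecMulVec y w) = vecMulVec u (ψ w)) :
    ¬ ColInd u u' ∧ ∃ (τ : K →+* E) (a b : E), a ≠ 0 ∧ b ≠ 0 ∧
      ∀ s t, ψ (s • x₁ + t • x₂) = (τ s * a) • v₁ + (τ t * b) • v₂ := by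
  have hind := hφ.right_ind hx hv₁ hv₂ h₁ h₂
  have hy := hyz.ne_zero
  have hψ0 : ψ 0 = 0 := by
    refine vecMulVec_left_cancel hu0 ?_
    rw [← hψ, vecMulVec_zero', vecMulVec_zero', hφ.zero]
  have hψne : ∀ w, w ≠ 0 → ψ w ≠ 0 := fun w hw h => hφ.map_ne_zero hy hw (by
    rw [hψ, h, vecMulVec_zero'])
  have hψR : ∀ {x : Fin 2 → K} {v : Fin q → E}, v ≠ 0 → MapsRR φ x v → ∃ k : E, ψ x = k • v := by
    intro x v hv h
    obtain ⟨s, hs⟩ := h y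
    exact eq_smul_of_vecMulVec_eq hu0 hv ((hψ x).symm.trans hs)
  have hco : ∀ s t : K, ∃ a b : E, ψ (s • x₁ + t • x₂) = a • v₁ + b • v₂ := by
    intro s t
    by_cases hw : s • x₁ + t • x₂ = 0
    · exact ⟨0, 0, by rw [hw, hψ0, zero_smul, zero_smul, add_zero]⟩
    obtain ⟨g, hg, hwg⟩ := hφ.direct.2 _ hw
    obtain ⟨a, b, rfl⟩ := hφ.span hx hw hv₁ hv₂ hg h₁ h₂ hwg
    obtain ⟨k, hk⟩ := hψR hg hwg
    exact ⟨k * a, k * b, by rw [hk, smul_add, smul_smul, smul_smul]⟩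
  choose α β hαβ using hco
  have hα0 : ∀ t, α 0 t = 0 := fun t => by
    have hR : MapsRR φ (t • x₂) v₂ := fun w => by
      rw [← op_smul_vecMulVec']
      exact h₂ _
    obtain ⟨k, hk⟩ := hψR hv₂ hR
    have := hαβ 0 t
    rw [zero_smul, zero_add, hk] at this
    exact (hind.unique (a := 0) (b := k) (by rw [← this, zero_smul, zero_add])).1.symm
  have hβ0 : ∀ s, β s 0 = 0 := fun s => by
    have hR : MapsRR φ (s • x₁) v₁ := fun w => by
      rw [← op_smul_vecMulVec']
      exact h₁ _
    obtain ⟨k, hk⟩ := hψR hv₁ hR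
    have := hαβ s 0
    rw [zero_smul, add_zero, hk] at this
    exact (hind.unique (a := k) (b := 0) (by rw [← this, zero_smul, add_zero])).2.symm
  obtain ⟨r₁, hr1, hr2, hr3⟩ :=
    hφ.pencil e hyz hx hu0 hu hu0' hu' hv₁ hv₂ h₁ h₂ hψ hαβ hα0 hβ0
  obtain ⟨u'', hu0'', hu''⟩ := (hφ.shift e (vecMulVec z x₂)).direct.1 y hy
  obtain ⟨r₂, hr1', hr2', -⟩ :=
    hφ.pencil e hyz hx.symm hu0 hu hu0'' hu'' hv₂ hv₁ h₂ h₁ hψ (α := fun t s => β s t)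
      (β := fun t s => α s t) (fun s t => by rw [add_comm, hαβ, add_comm]) hβ0 hα0
  have ha1 : α 1 0 ≠ 0 := fun h => hψne x₁ hx.ne_zero (by
    have := hαβ 1 0
    rwa [h, hβ0, zero_smul, zero_smul, one_smul, zero_smul, add_zero, add_zero] at this)
  have hb1 : β 0 1 ≠ 0 := fun h => hψne x₂ hx.symm.ne_zero (by
    have := hαβ 0 1
    rwa [h, hα0, zero_smul, zero_smul, one_smul, zero_smul, zero_add, add_zero] at this)
  have hcol : ∀ s t s' t' k : K, ∃ l : E,
      α (s + k * s') (t + k * t') - α s t = l * (α (s + s') (t + t') - α s t) ∧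
      β (s + k * s') (t + k * t') - β s t = l * (β (s + s') (t + t') - β s t) := by
    intro s t s' t' k
    by_cases hx0 : s' • x₁ + t' • x₂ = 0
    · obtain ⟨h1, h2⟩ := hx.unique (a' := 0) (b' := 0) (hx0.trans (by simp))
      exact ⟨0, by simp [h1, h2]⟩
    obtain ⟨g, hg, hRg⟩ := (hφ.shift e (vecMulVec y (s • x₁ + t • x₂))).direct.2 _ hx0
    obtain ⟨l, hl⟩ := exists_smul_of_mapsRR hu0 hψ hg hRg k
    obtain ⟨m, hm⟩ := exists_smul_of_mapsRR hu0 hψ hg hRg 1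
    have hm0 : m ≠ 0 := by
      rintro rfl
      rw [zero_smul, one_smul, sub_eq_zero] at hm
      refine (hφ.adj _ _ (adjacent_vecMulVec_left hy
        (v := s • x₁ + t • x₂ + (s' • x₁ + t' • x₂)) (w := s • x₁ + t • x₂) ?_)).ne ?_
      · rwa [Ne, add_eq_left]
      · rw [hψ, hψ, hm]
    refine ⟨l * m⁻¹, ?_⟩
    have hsum : ∀ k : K, s • x₁ + t • x₂ + k • (s' • x₁ + t' • x₂) =
        (s + k * s') • x₁ + (t + k * t') • x₂ := fun k => by
      rw [smul_add, smul_smul, smul_smul, add_smul, add_smul]; abel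
    have hdiff : ψ (s • x₁ + t • x₂ + k • (s' • x₁ + t' • x₂)) - ψ (s • x₁ + t • x₂) =
        (l * m⁻¹) • (ψ (s • x₁ + t • x₂ + (1 : K) • (s' • x₁ + t' • x₂)) -
          ψ (s • x₁ + t • x₂)) := by
      rw [hl, hm, smul_smul, inv_mul_cancel_right₀ hm0]
    rw [hsum, hsum, hαβ, hαβ, hαβ, one_mul, one_mul] at hdiff
    refine hind.unique ?_
    simp only [mul_smul, sub_smul, smul_sub, smul_add] at hdiff ⊢
    rw [← sub_eq_zero] at hdiff ⊢
    rw [← hdiff]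
    abel
  obtain ⟨hp, -, τ, hτ⟩ := plane_semilinear e hs hα0 hβ0 hr1 (fun s t => hr1' t s) hr2 hr2' ha1
    hb1 hcol
  refine ⟨fun h => hr3 h hp, τ, α 1 0, β 0 1, ha1, hb1, fun s t => ?_⟩
  rw [hαβ, (hτ s t).1, (hτ s t).2]

end Geometry

section Form

variable {K E : Type*} [DivisionRing K] [DivisionRing E] {p q : ℕ}
  {φ : Matrix (Fin 2) (Fin 2) K → Matrix (Fin p) (Fin q) E}

theorem RegularMap.recenter_zero (hφ : RegularMap φ) : recenter φ 0 = φ := by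
  funext M
  simp [recenter, hφ.zero]

theorem RegularMap.mapsLL_recenter (hφ : RegularMap φ) (e : K ≃ E)
    (hs : ∀ f : K →+* E, Function.Surjective f) {y z : Fin 2 → K} (hyz : ColInd y z)
    {u : Fin p → E} (hu0 : u ≠ 0) (hu : MapsLL φ y u) (x : Fin 2 → K) :
    MapsLL (recenter φ (vecMulVec z x)) y u := by
  by_cases hx0 : x = 0
  · rwa [hx0, vecMulVec_zero', hφ.recenter_zero]
  obtain ⟨x', hx⟩ := exists_rowInd hx0
  obtain ⟨u', hu0', hu'⟩ := (hφ.shift e (vecMulVec z x)).direct.1 y hyz.ne_zero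
  obtain ⟨v₁, hv₁, h₁⟩ := hφ.direct.2 x hx0
  obtain ⟨v₂, hv₂, h₂⟩ := hφ.direct.2 x' hx.symm.ne_zero
  have hψ := hu
  choose ψ hψ using hψ
  obtain ⟨hc, -⟩ := hφ.semilinear e hs hyz hx hu0 hu hu0' hu' hv₁ hv₂ h₁ h₂ hψ
  rcases colInd_or_smul hu0 hu0' with h | ⟨k, -, rfl⟩
  · exact absurd h hc
  · exact hu'.of_smul

theorem RegularMap.map_add_vecMulVec (hφ : RegularMap φ) (e : K ≃ E)
    (hs : ∀ f : K →+* E, Function.Surjective f) {y z : Fin 2 → K} (hyz : ColInd y z)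
    (w x : Fin 2 → K) :
    φ (vecMulVec y w + vecMulVec z x) = φ (vecMulVec y w) + φ (vecMulVec z x) := by
  obtain ⟨u, hu0, hu⟩ := hφ.direct.1 y hyz.ne_zero
  obtain ⟨s, hs0, hzs⟩ := hφ.direct.1 z hyz.symm.ne_zero
  have hus := hφ.left_ind hyz hu0 hs0 hu hzs
  obtain ⟨t, ht⟩ := hφ.mapsLL_recenter e hs hyz hu0 hu x w
  obtain ⟨t', ht'⟩ := hφ.mapsLL_recenter e hs hyz.symm hs0 hzs w x
  obtain ⟨a, ha⟩ := hu w
  obtain ⟨b, hb⟩ := hzs x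
  rw [recenter, sub_eq_iff_eq_add, hb, add_comm] at ht
  rw [recenter, sub_eq_iff_eq_add, ha, add_comm _ (vecMulVec u a)] at ht'
  have := (hus.unique (ht.symm.trans ht')).1
  rw [ht, ha, hb, this]

theorem RegularMap.exists_form (hφ : RegularMap φ) (e : K ≃ E)
    (hs : ∀ f : K →+* E, Function.Surjective f) :
    ∃ (τ : K →+* E) (u₁ u₂ : Fin p → E) (v₁ v₂ : Fin q → E), ColInd u₁ u₂ ∧ RowInd v₁ v₂ ∧
      ∀ M, φ M = vecMulVec u₁ (τ (M 0 0) • v₁ + τ (M 0 1) • v₂) +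
        vecMulVec u₂ (τ (M 1 0) • v₁ + τ (M 1 1) • v₂) := by
  have hyz : ColInd (![1, 0] : Fin 2 → K) ![0, 1] := by
    refine ⟨![1, 0], ![0, 1], ?_, ?_, ?_, ?_⟩ <;> simp
  have hx : RowInd (![1, 0] : Fin 2 → K) ![0, 1] := by
    refine ⟨![1, 0], ![0, 1], ?_, ?_, ?_, ?_⟩ <;> simp
  set y : Fin 2 → K := ![1, 0] with hy
  set z : Fin 2 → K := ![0, 1] with hz
  obtain ⟨u, hu0, hu⟩ := hφ.direct.1 y hyz.ne_zero
  obtain ⟨s, hs0, hzs⟩ := hφ.direct.1 z hyz.symm.ne_zero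
  obtain ⟨v₁, hv₁, h₁⟩ := hφ.direct.2 y hx.ne_zero
  obtain ⟨v₂, hv₂, h₂⟩ := hφ.direct.2 z hx.symm.ne_zero
  have hyz0 : y + z ≠ 0 := fun h => by simpa [hy, hz] using congrFun h 0
  obtain ⟨h, -, hh⟩ := hφ.direct.1 (y + z) hyz0
  have hus := hφ.left_ind hyz hu0 hs0 hu hzs
  have hψ := hu
  have hχ := hzs
  choose ψ hψ using hψ
  choose χ hχ using hχ
  obtain ⟨-, τ, a, b, ha, hb, hτ⟩ := hφ.semilinear e hs hyz.symm hx hs0 hzs hs0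
    (hφ.mapsLL_recenter e hs hyz.symm hs0 hzs y) hv₁ hv₂ h₁ h₂ hχ
  obtain ⟨c, d, hc1, hc2, hd1, hd2⟩ := id hus
  have hprop : ∀ w, ∃ t, ψ w = (c ⬝ᵥ h) • t ∧ χ w = (d ⬝ᵥ h) • t := fun w => by
    obtain ⟨t, ht⟩ := hh w
    rw [add_vecMulVec, hφ.map_add_vecMulVec e hs hyz, hψ, hχ] at ht
    refine ⟨t, ?_, ?_⟩
    · simpa [vecMul_add, vecMul_vecMulVec, hc1, hc2] using congrArg (fun M => c ᵥ* M) ht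
    · simpa [vecMul_add, vecMul_vecMulVec, hd1, hd2] using congrArg (fun M => d ᵥ* M) ht
  have hc0 : c ⬝ᵥ h ≠ 0 := fun h0 => by
    obtain ⟨t, ht, -⟩ := hprop y
    exact hφ.map_ne_zero hyz.ne_zero hx.ne_zero (by rw [hψ, ht, h0, zero_smul, vecMulVec_zero'])
  have hd0 : d ⬝ᵥ h ≠ 0 := fun h0 => by
    obtain ⟨t, -, ht⟩ := hprop y
    exact hφ.map_ne_zero hyz.symm.ne_zero hx.ne_zero
      (by rw [hχ, ht, h0, zero_smul, vecMulVec_zero'])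
  have hψχ : ∀ w, ψ w = ((c ⬝ᵥ h) * (d ⬝ᵥ h)⁻¹) • χ w := fun w => by
    obtain ⟨t, ht, ht'⟩ := hprop w
    rw [ht, ht', smul_smul, inv_mul_cancel_right₀ hd0]
  refine ⟨τ, MulOpposite.op ((c ⬝ᵥ h) * (d ⬝ᵥ h)⁻¹) • u, s, a • v₁, b • v₂, ?_,
    (hφ.right_ind hx hv₁ hv₂ h₁ h₂).smul ha hb, fun M => ?_⟩
  · simpa using hus.smul (mul_ne_zero hc0 (inv_ne_zero hd0)) one_ne_zero
  have hrow : ∀ i, τ (M i 0) • a • v₁ + τ (M i 1) • b • v₂ = χ (M i) := fun i => by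
    have : M i = M i 0 • y + M i 1 • z := by
      ext j; fin_cases j <;> simp [hy, hz]
    rw [this, hτ, smul_smul, smul_smul]
    simp [hy, hz]
  have hM : M = vecMulVec y (M 0) + vecMulVec z (M 1) := by
    ext i j
    rw [Matrix.add_apply, vecMulVec_apply, vecMulVec_apply]
    fin_cases i <;> simp [hy, hz]
  rw [hrow, hrow, op_smul_vecMulVec', ← hψχ]
  conv_lhs => rw [hM, hφ.map_add_vecMulVec e hs hyz, hψ, hχ]

end Form

section Extension

variable {E : Type*} [DivisionRing E]

theorem RowInd.linearIndependent {q : ℕ} {v t : Fin q → E} (h : RowInd v t) :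
    LinearIndependent E ![v, t] := by
  rw [LinearIndependent.pair_iff]
  intro a b hab
  exact h.unique (a' := 0) (b' := 0) (by simpa using hab)

theorem RowInd.exists_isUnit {q : ℕ} {v t : Fin q → E} (h : RowInd v t) (i j : Fin q)
    (hij : i ≠ j) : ∃ S : Matrix (Fin q) (Fin q) E, IsUnit S ∧ S i = v ∧ S j = t := by
  have hli := h.linearIndependent
  have hset := hli.linearIndepOn_id
  let b := Module.Basis.extend hset
  have hmem : ∀ k : Fin 2, ![v, t] k ∈ hset.extend (Set.subset_univ _) := fun k =>
    hset.subset_extend _ (Set.mem_range_self k)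
  have hb : ∀ k : Fin 2, b ⟨_, hmem k⟩ = ![v, t] k := fun k => Module.Basis.extend_apply_self _ _
  have hne : (⟨_, hmem 0⟩ : hset.extend (Set.subset_univ _)) ≠ ⟨_, hmem 1⟩ := fun e =>
    zero_ne_one (hli.injective (Subtype.ext_iff.mp e))
  let σ := b.indexEquiv (Pi.basisFun E (Fin q))
  let π₁ := Equiv.swap (σ ⟨_, hmem 0⟩) i
  let π₂ := Equiv.swap (π₁ (σ ⟨_, hmem 1⟩)) j
  let ρ := (σ.trans π₁).trans π₂
  have h1 : ρ ⟨_, hmem 1⟩ = j := Equiv.swap_apply_left _ _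
  have h0 : ρ ⟨_, hmem 0⟩ = i := by
    have : π₁ (σ ⟨_, hmem 0⟩) = i := Equiv.swap_apply_left _ _
    change π₂ (π₁ (σ ⟨_, hmem 0⟩)) = i
    rw [this]
    refine Equiv.swap_apply_of_ne_of_ne ?_ hij
    rw [← this]
    exact fun e => hne (σ.injective (π₁.injective e))
  let b' := b.reindex ρ
  have hb0 : b' i = v := by
    rw [Module.Basis.reindex_apply, ← h0, Equiv.symm_apply_apply]; exact hb 0
  have hb1 : b' j = t := by
    rw [Module.Basis.reindex_apply, ← h1, Equiv.symm_apply_apply]; exact hb 1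
  have hinv : (Matrix.of fun k l => b'.repr (Pi.single k 1) l) * Matrix.of (fun k => b' k) = 1 := by
    ext k l
    have := congrFun (b'.sum_repr (Pi.single k 1)) l
    simpa [Matrix.mul_apply, Finset.sum_apply, Matrix.one_apply, Pi.single_apply, eq_comm]
      using this
  exact ⟨Matrix.of fun k => b' k, ⟨⟨_, _, mul_eq_one_comm.mp hinv, hinv⟩, rfl⟩, hb0, hb1⟩

/-- The transpose, with entries in the opposite ring. -/
def opTranspose {R : Type*} {m n : ℕ} (M : Matrix (Fin m) (Fin n) R) :
    Matrix (Fin n) (Fin m) Rᵐᵒᵖ :=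
  Matrix.of fun i j => MulOpposite.op (M j i)

theorem opTranspose_mul {l m n : ℕ} (M : Matrix (Fin l) (Fin m) E) (N : Matrix (Fin m) (Fin n) E) :
    opTranspose (M * N) = opTranspose N * opTranspose M := by
  ext i j
  simp [opTranspose, Matrix.mul_apply]

theorem opTranspose_one {n : ℕ} : opTranspose (1 : Matrix (Fin n) (Fin n) E) = 1 := by
  ext i j
  by_cases h : i = j <;> simp [opTranspose, Matrix.one_apply, h, eq_comm]

theorem opTranspose_sub {m n : ℕ} (M N : Matrix (Fin m) (Fin n) E) :
    opTranspose (M - N) = opTranspose M - opTranspose N := by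
  ext i j
  simp [opTranspose]

theorem opTranspose_vecMulVec {m n : ℕ} (u : Fin m → E) (v : Fin n → E) :
    opTranspose (vecMulVec u v) = vecMulVec (fun i => MulOpposite.op (v i))
      (fun i => MulOpposite.op (u i)) := by
  ext i j
  simp [opTranspose, vecMulVec_apply]

theorem RankTwo.opTranspose {p q : ℕ} {Z : Matrix (Fin p) (Fin q) E} (h : RankTwo Z) :
    RankTwo (opTranspose Z) := by
  obtain ⟨U, V, U', V', hU, hV, rfl⟩ := h
  exact ⟨_, _, _, _, by rw [← opTranspose_mul, hV, opTranspose_one],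
    by rw [← opTranspose_mul, hU, opTranspose_one], opTranspose_mul U V⟩

theorem ColInd.op {m : ℕ} {u s : Fin m → E} (h : ColInd u s) :
    RowInd (fun i => MulOpposite.op (u i)) (fun i => MulOpposite.op (s i)) := by
  obtain ⟨c, d, h1, h2, h3, h4⟩ := h
  refine ⟨fun i => MulOpposite.op (c i), fun i => MulOpposite.op (d i), ?_, ?_, ?_, ?_⟩ <;>
    apply MulOpposite.unop_injective <;> simpa [dotProduct]

theorem ColInd.unop {m : ℕ} {u s : Fin m → Eᵐᵒᵖ} (h : ColInd u s) :
    RowInd (fun i => (u i).unop) (fun i => (s i).unop) := by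
  obtain ⟨c, d, h1, h2, h3, h4⟩ := h
  refine ⟨fun i => (c i).unop, fun i => (d i).unop, ?_, ?_, ?_, ?_⟩ <;>
    apply MulOpposite.op_injective <;> simpa [dotProduct]

theorem RowInd.unop {m : ℕ} {u s : Fin m → Eᵐᵒᵖ} (h : RowInd u s) :
    ColInd (fun i => (u i).unop) (fun i => (s i).unop) := by
  obtain ⟨c, d, h1, h2, h3, h4⟩ := h
  refine ⟨fun i => (c i).unop, fun i => (d i).unop, ?_, ?_, ?_, ?_⟩ <;>
    apply MulOpposite.op_injective <;> simpa [dotProduct]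

theorem ColInd.exists_isUnit {p : ℕ} {u s : Fin p → E} (h : ColInd u s) (i j : Fin p)
    (hij : i ≠ j) : ∃ T : Matrix (Fin p) (Fin p) E, IsUnit T ∧ T.col i = u ∧ T.col j = s := by
  obtain ⟨_, ⟨⟨S, S', _, h'⟩, rfl⟩, hi, hj⟩ := h.op.exists_isUnit i j hij
  have hT : (Matrix.of fun k l => (S l k).unop) * (Matrix.of fun k l => (S' l k).unop) =
      (1 : Matrix (Fin p) (Fin p) E) := by
    ext k l
    have := congrArg MulOpposite.unop (congrFun (congrFun h' l) k)
    by_cases hkl : k = l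
    · simpa [Matrix.mul_apply, Matrix.one_apply, hkl] using this
    · simpa [Matrix.mul_apply, Matrix.one_apply, hkl, Ne.symm hkl] using this
  refine ⟨_, ⟨⟨_, _, hT, mul_eq_one_comm.mp hT⟩, rfl⟩, ?_, ?_⟩
  · ext k
    exact congrArg MulOpposite.unop (congrFun hi k)
  · ext k
    exact congrArg MulOpposite.unop (congrFun hj k)

theorem pad_eq {p q : ℕ} (hp : 2 ≤ p) (hq : 2 ≤ q) (B : Matrix (Fin 2) (Fin 2) E) :
    pad p q B =
      vecMulVec (Pi.single ⟨0, by omega⟩ 1)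
        (B 0 0 • Pi.single ⟨0, by omega⟩ 1 + B 0 1 • Pi.single ⟨1, hq⟩ 1) +
      vecMulVec (Pi.single ⟨1, hp⟩ 1)
        (B 1 0 • Pi.single ⟨0, by omega⟩ 1 + B 1 1 • Pi.single ⟨1, hq⟩ 1) := by
  ext ⟨i, hi⟩ ⟨j, hj⟩
  rcases i with _ | _ | i <;> rcases j with _ | _ | j <;>
    simp [pad, vecMulVec_apply]

theorem exists_eq_mul_pad_mul {p q : ℕ} (hp : 2 ≤ p) (hq : 2 ≤ q) {u₁ u₂ : Fin p → E}
    {v₁ v₂ : Fin q → E} (hu : ColInd u₁ u₂) (hv : RowInd v₁ v₂) :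
    ∃ (T : Matrix (Fin p) (Fin p) E) (S : Matrix (Fin q) (Fin q) E), IsUnit T ∧ IsUnit S ∧
      ∀ B : Matrix (Fin 2) (Fin 2) E, vecMulVec u₁ (B 0 0 • v₁ + B 0 1 • v₂) +
        vecMulVec u₂ (B 1 0 • v₁ + B 1 1 • v₂) = T * pad p q B * S := by
  obtain ⟨T, hT, hT1, hT2⟩ := hu.exists_isUnit ⟨0, by omega⟩ ⟨1, hp⟩ (by simp)
  obtain ⟨S, hS, hS1, hS2⟩ := hv.exists_isUnit ⟨0, by omega⟩ ⟨1, hq⟩ (by simp)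
  refine ⟨T, S, hT, hS, fun B => ?_⟩
  rw [pad_eq hp hq, Matrix.mul_add, Matrix.add_mul, mul_vecMulVec, mul_vecMulVec, vecMulVec_mul,
    vecMulVec_mul]
  simp only [add_vecMul, smul_vecMul, single_one_vecMul, mulVec_single_one, hT1, hT2]
  simp only [Matrix.row, hS1, hS2]

end Extension

section Swap

variable {K E : Type*} [DivisionRing K] [DivisionRing E] {p q : ℕ}
  {φ : Matrix (Fin 2) (Fin 2) K → Matrix (Fin p) (Fin q) E}

theorem IsPreserver.opTranspose (hφ : IsPreserver φ) :
    IsPreserver fun M => opTranspose (φ M) := by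
  refine ⟨fun A B h => ?_, ?_⟩
  · obtain ⟨u, v, hu, hv, e⟩ := adjacent_iff_s10.mp (hφ.adj A B h)
    refine adjacent_iff_s10.mpr ⟨_, _, ?_, ?_, by rw [← opTranspose_sub, e, opTranspose_vecMulVec]⟩
    · exact fun h0 => hv (funext fun i => MulOpposite.op_injective (congrFun h0 i))
    · exact fun h0 => hu (funext fun i => MulOpposite.op_injective (congrFun h0 i))
  · ext i j
    simp [_root_.opTranspose, hφ.zero]

theorem TypeSwap.regularMap_opTranspose (hφ : IsPreserver φ) (e : K ≃ E)
    {A : Matrix (Fin 2) (Fin 2) K} (hA : RankTwo A) (hA' : RankTwo (φ A)) (h : TypeSwap φ) :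
    RegularMap fun M => opTranspose (φ M) := by
  have hy : (![1, 0] : Fin 2 → K) ≠ 0 := fun h => by simpa using congrFun h 0
  obtain ⟨v, hv, hm⟩ := h.1 _ hy
  obtain ⟨u, hu, hm'⟩ := h.2 _ hy
  refine hφ.opTranspose.regularMap_of_maps (e.trans MulOpposite.opEquiv) hA hA'.opTranspose hy hy
    (u := fun i => MulOpposite.op (v i)) (v := fun i => MulOpposite.op (u i))
    (fun h0 => hv (funext fun i => MulOpposite.op_injective (congrFun h0 i)))
    (fun h0 => hu (funext fun i => MulOpposite.op_injective (congrFun h0 i))) ?_ ?_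
  · intro w
    obtain ⟨s, hs⟩ := hm w
    exact ⟨_, (congrArg _ hs).trans (opTranspose_vecMulVec _ _)⟩
  · intro w
    obtain ⟨s, hs⟩ := hm' w
    exact ⟨_, (congrArg _ hs).trans (opTranspose_vecMulVec _ _)⟩

theorem EAS.surjective_op (h : EAS E) (f : E →+* Eᵐᵒᵖ) : Function.Surjective f := by
  let g : E →+* E := (RingEquiv.opOp E).symm.toRingHom.comp ((RingHom.op f).comp f)
  intro x
  obtain ⟨a, ha⟩ := h g x.unop
  refine ⟨(f a).unop, ?_⟩
  apply MulOpposite.unop_injective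
  simpa [g] using ha

theorem CollapseL.isAdjacentSet (h : CollapseL φ) :
    IsAdjacentSet (φ '' {A | rowRank A = 1}) := by
  obtain ⟨u, hu⟩ := h
  rintro _ ⟨A, hA, rfl⟩ _ ⟨B, hB, rfl⟩ hne
  obtain ⟨z, w, -, -, rfl⟩ := (rowRank_eq_one_iff A).mp hA
  obtain ⟨z', w', -, -, rfl⟩ := (rowRank_eq_one_iff B).mp hB
  obtain ⟨t, ht⟩ := hu z w
  obtain ⟨t', ht'⟩ := hu z' w'
  rw [ht, ht'] at hne ⊢
  refine adjacent_vecMulVec_left (fun h0 => hne ?_) (fun h0 => hne (by rw [h0]))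
  rw [h0, zero_vecMulVec', zero_vecMulVec']

theorem CollapseR.isAdjacentSet (h : CollapseR φ) :
    IsAdjacentSet (φ '' {A | rowRank A = 1}) := by
  obtain ⟨v, hv⟩ := h
  rintro _ ⟨A, hA, rfl⟩ _ ⟨B, hB, rfl⟩ hne
  obtain ⟨z, w, -, -, rfl⟩ := (rowRank_eq_one_iff A).mp hA
  obtain ⟨z', w', -, -, rfl⟩ := (rowRank_eq_one_iff B).mp hB
  obtain ⟨t, ht⟩ := hv z w
  obtain ⟨t', ht'⟩ := hv z' w'
  rw [ht, ht'] at hne ⊢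
  refine adjacent_vecMulVec_right (fun h0 => hne ?_) (fun h0 => hne (by rw [h0]))
  rw [h0, vecMulVec_zero', vecMulVec_zero']

end Swap

theorem RegularMap.standard {E : Type*} [DivisionRing E] (hE : EAS E) {p q : ℕ} (hp : 2 ≤ p)
    (hq : 2 ≤ q) {φ : Matrix (Fin 2) (Fin 2) E → Matrix (Fin p) (Fin q) E} (h : RegularMap φ) :
    Standard φ := by
  obtain ⟨τ, u₁, u₂, v₁, v₂, hu, hv, hform⟩ := h.exists_form (Equiv.refl E) hE
  obtain ⟨T, S, hT, hS, hTS⟩ := exists_eq_mul_pad_mul hp hq hu hv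
  refine Or.inl ⟨hp, hq, RingEquiv.ofBijective τ ⟨τ.injective, hE τ⟩, T, S, 0, hT, hS,
    fun A => ?_⟩
  rw [hform, add_zero, ← hTS]
  rfl

theorem RegularMap.standard_of_opTranspose {E : Type*} [DivisionRing E] (hE : EAS E) {p q : ℕ}
    (hp : 2 ≤ p) (hq : 2 ≤ q) {φ : Matrix (Fin 2) (Fin 2) E → Matrix (Fin p) (Fin q) E}
    (h : RegularMap fun M => opTranspose (φ M)) : Standard φ := by
  obtain ⟨τ, u₁, u₂, v₁, v₂, hu, hv, hform⟩ :=
    h.exists_form MulOpposite.opEquiv (fun f => hE.surjective_op f)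
  obtain ⟨T, S, hT, hS, hTS⟩ := exists_eq_mul_pad_mul hp hq hv.unop hu.unop
  refine Or.inr ⟨hp, hq, fun a => (τ a).unop,
    MulOpposite.unop_bijective.comp ⟨τ.injective, hE.surjective_op τ⟩, by simp, by simp, by simp,
    T, S, 0, hT, hS, fun A => ?_⟩
  rw [add_zero, ← hTS]
  ext i j
  have := congrArg MulOpposite.unop (congrFun (congrFun (hform A) j) i)
  simp only [opTranspose, Matrix.of_apply, MulOpposite.unop_op] at this
  rw [this]
  simp [vecMulVec_apply, mul_add, mul_assoc]
  abel

/-- Proposition 3.12, the key lemma. -/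
theorem stmt10 (hEAS : EAS D) (p q : ℕ) (hp : 2 ≤ p) (hq : 2 ≤ q)
    (φ : Matrix (Fin 2) (Fin 2) D → Matrix (Fin p) (Fin q) D)
    (hφ : ∀ A B, Adjacent A B → Adjacent (φ A) (φ B)) (h0 : φ 0 = 0)
    (hna : ¬ IsAdjacentSet (φ '' {A : Matrix (Fin 2) (Fin 2) D | rowRank A = 1}))
    (hrank2 : ∃ A : Matrix (Fin 2) (Fin 2) D, rowRank A = 2 ∧ rowRank (φ A) = 2) :
    Standard φ := by
  obtain ⟨A, hA, hA'⟩ := hrank2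
  replace hA := rankTwo_of_rowRank hA
  replace hA' := rankTwo_of_rowRank hA'
  have hpres : IsPreserver φ := ⟨hφ, h0⟩
  rcases hpres.regularMap_or_collapse (Equiv.refl D) hA hA' with h | h | h | h
  · exact h.standard hEAS hp hq
  · exact (h.regularMap_opTranspose hpres (Equiv.refl D) hA hA').standard_of_opTranspose hEAS hp hq
  · exact absurd h.isAdjacentSet hna
  · exact absurd h.isAdjacentSet hna
end
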